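/- There exist ε > 0, C > 1 and a natural number N such that for every odd n ≥ N the following holds. Let G be a simple graph on n vertices satisfying, for some real p ≥ C·log(n)/n: (1) δ(G) ≥ (1−ε)np; (2) G is (p,β)-jumbled for some β with 1 ≤ β ≤ ε·np/log(log n); (3) there is an edge of G between every two disjoint vertex subsets A, B with |A|, |B| ≥ ε·n·log(log n)/log n. Then C_n(G) = C(G). -/

import Mathlib

open SimpleGraph

/-- The cycle space of a simple graph: the `ZMod 2`-span of the indicator functions of
edge sets of cycles. -/
noncomputable def cycleSpace {V : Type} [Fintype V] [DecidableEq V] (G : SimpleGraph V) :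
    Submodule (ZMod 2) (Sym2 V → ZMod 2) :=
  Submodule.span (ZMod 2)
    {f | ∃ (x : V) (c : G.Walk x x), c.IsCycle ∧
      f = fun e => if e ∈ c.edges then 1 else 0}

/-- The span of indicator functions of edge sets of Hamilton cycles. -/
noncomputable def hamiltonSpace {V : Type} [Fintype V] [DecidableEq V] (G : SimpleGraph V) :
    Submodule (ZMod 2) (Sym2 V → ZMod 2) :=
  Submodule.span (ZMod 2)
    {f | ∃ (x : V) (c : G.Walk x x), c.IsHamiltonianCycle ∧
      f = fun e => if e ∈ c.edges then 1 else 0}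

/-- The number of edges of `G` with both endpoints inside `U`. -/
noncomputable def interiorEdgeCount {V : Type} (G : SimpleGraph V) (U : Set V) : ℕ :=
  {e ∈ G.edgeSet | ∀ v ∈ e, v ∈ U}.ncard

/-- `G` is `(p, β)`-jumbled: `0 < p < 1 ≤ β` and for every vertex subset `U`,
`|e_G(U) - p * binom(|U|, 2)| ≤ β * |U|`. -/
def IsJumbled {V : Type} (G : SimpleGraph V) (p β : ℝ) : Prop :=
  0 < p ∧ p < 1 ∧ 1 ≤ β ∧
    ∀ U : Set V,
      |(interiorEdgeCount G U : ℝ) - p * (Nat.choose U.ncard 2 : ℕ)| ≤ β * U.ncard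

set_option linter.unusedSectionVars false

section ListPaths

variable {V : Type}

/-- `I` occurs in `l` as a contiguous block, up to reversal. -/
def Keeps (I l : List V) : Prop := I <:+: l ∨ I.reverse <:+: l

theorem keeps_reverse {I l : List V} : Keeps I l.reverse ↔ Keeps I l := by
  have e : ∀ J : List V, J <:+: l.reverse ↔ J.reverse <:+: l := fun J => by
    rw [← List.reverse_infix, List.reverse_reverse]
  rw [Keeps, Keeps, e, e, List.reverse_reverse]
  exact or_comm

theorem Keeps.subset {I l : List V} (h : Keeps I l) : I ⊆ l := by
  rcases h with h | h
  · exact h.subset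
  · intro a ha
    exact h.subset (List.mem_reverse.2 ha)

theorem Keeps.of_isInfix {I l l' : List V} (h : Keeps I l) (hl : l <:+: l') : Keeps I l' :=
  h.imp (fun h => h.trans hl) (fun h => h.trans hl)

theorem Keeps.pair_symm {u v : V} {l : List V} (h : Keeps [u, v] l) : Keeps [v, u] l := by
  unfold Keeps at *
  simpa using h.symm

theorem infix_or_infix_of_notMem {I l1 l2 : List V} {w : V}
    (h : I <:+: l1 ++ w :: l2) (hw : w ∉ I) : I <:+: l1 ∨ I <:+: l2 := by
  obtain ⟨s, t, h⟩ := h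
  rw [List.append_assoc, List.append_eq_append_iff] at h
  rcases h with ⟨a, rfl, h⟩ | ⟨a, rfl, h⟩
  · rw [List.append_eq_append_iff] at h
    rcases h with ⟨b, rfl, h⟩ | ⟨b, rfl, h⟩
    · left; exact ⟨s, b, by simp⟩
    · cases b with
      | nil => left; exact ⟨s, [], by simp⟩
      | cons c b =>
        simp only [List.cons_append, List.cons.injEq] at h
        exact absurd (by simp [h.1]) hw
  · cases a with
    | nil =>
      simp only [List.nil_append] at h
      cases I with
      | nil => left; exact List.nil_infix
      | cons c I =>
        simp only [List.cons_append, List.cons.injEq] at h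
        exact absurd (by simp [h.1]) hw
    | cons c a =>
      simp only [List.cons_append, List.cons.injEq] at h
      right; exact ⟨a, t, by simp [h.2]⟩

theorem Keeps.or_of_notMem {I l1 l2 : List V} {w : V}
    (h : Keeps I (l1 ++ w :: l2)) (hw : w ∉ I) : Keeps I l1 ∨ Keeps I l2 := by
  rcases h with h | h
  · exact (infix_or_infix_of_notMem h hw).imp Or.inl Or.inl
  · exact (infix_or_infix_of_notMem h (by simpa using hw)).imp Or.inr Or.inr

theorem Keeps.append_left {I l : List V} (h : Keeps I l) (r : List V) : Keeps I (r ++ l) :=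
  h.of_isInfix List.infix_append_right

theorem Keeps.append_right {I l : List V} (h : Keeps I l) (r : List V) : Keeps I (l ++ r) :=
  h.of_isInfix List.infix_append_left

theorem Keeps.reverse {I l : List V} (h : Keeps I l) : Keeps I l.reverse := keeps_reverse.2 h

theorem pred_unique {l : List V} (hl : l.Nodup) {u v w : V}
    (hu : [u, w] <:+: l) (hv : [v, w] <:+: l) : u = v := by
  obtain ⟨s, t, rfl⟩ := hu
  have h1 : [v, w] <:+: (s ++ [u]) ++ w :: t := by simpa using hv
  obtain ⟨a, b, h⟩ := h1
  have h2 : (a ++ [v]) ++ w :: b = (s ++ [u]) ++ w :: t := by simpa using h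
  have hn : ((s ++ [u]) ++ w :: t).Nodup := by simpa using hl
  have hn' : ((a ++ [v]) ++ w :: b).Nodup := h2 ▸ hn
  have h3 : w ∉ a ++ [v] := fun hm =>
    (List.disjoint_of_nodup_append hn') hm (by simp)
  have h4 : w ∉ s ++ [u] := fun hm =>
    (List.disjoint_of_nodup_append hn) hm (by simp)
  have h5 : a ++ [v] = s ++ [u] := by
    rcases List.append_eq_append_iff.1 h2 with ⟨c, hc, hd⟩ | ⟨c, hc, hd⟩
    · cases c with
      | nil => simpa using hc.symm
      | cons d c =>
        simp only [List.cons_append, List.cons.injEq] at hd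
        exact absurd (by rw [hc, ← hd.1]; simp) h4
    · cases c with
      | nil => simpa using hc
      | cons d c =>
        simp only [List.cons_append, List.cons.injEq] at hd
        exact absurd (by rw [hc, ← hd.1]; simp) h3
  simpa using (List.append_inj' h5 rfl).2.symm

theorem succ_unique {l : List V} (hl : l.Nodup) {u v w : V}
    (hu : [w, u] <:+: l) (hv : [w, v] <:+: l) : u = v := by
  apply pred_unique (l := l.reverse) (List.nodup_reverse.2 hl) (w := w)
  · simpa using hu.reverse
  · simpa using hv.reverse

open Classical in
theorem card_neighbors_le [Fintype V] {l : List V} (hl : l.Nodup) (X : Finset V) :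
    (Finset.univ.filter fun w => ∃ v ∈ X, Keeps [v, w] l).card ≤ 2 * X.card := by
  have h1 : ∀ R : V → V → Prop, (∀ v w w', R v w → R v w' → w = w') →
      (Finset.univ.filter fun w => ∃ v ∈ X, R v w).card ≤ X.card := by
    intro R hR
    have : ∀ w ∈ (Finset.univ.filter fun w => ∃ v ∈ X, R v w), ∃ v ∈ X, R v w := by simp
    choose! f hf using this
    apply Finset.card_le_card_of_injOn f
    · intro w hw; exact (hf w hw).1
    · intro w hw w' hw' e
      exact hR (f w) w w' (hf w hw).2 (e ▸ (hf w' hw').2)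
  have e : (Finset.univ.filter fun w => ∃ v ∈ X, Keeps [v, w] l) ⊆
      (Finset.univ.filter fun w => ∃ v ∈ X, [v, w] <:+: l) ∪
      (Finset.univ.filter fun w => ∃ v ∈ X, [w, v] <:+: l) := by
    intro w hw
    simp only [Finset.mem_filter, Finset.mem_univ, true_and, Finset.mem_union] at *
    obtain ⟨v, hv, h | h⟩ := hw
    · left; exact ⟨v, hv, h⟩
    · right; exact ⟨v, hv, by simpa using h⟩
  refine ((Finset.card_le_card e).trans (Finset.card_union_le _ _)).trans ?_
  rw [two_mul]
  refine add_le_add ?_ ?_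
  · exact le_of_eq_of_le (by congr) (h1 (fun v w => [v, w] <:+: l)
      fun v w w' h h' => succ_unique hl h h')
  · exact le_of_eq_of_le (by congr) (h1 (fun v w => [w, v] <:+: l)
      fun v w w' h h' => pred_unique hl h h')

/-- `HRot G A B t l l'`: the path `l'` arises from `l` by `t` rotations of the first vertex,
all of whose pivots lie in `A` and all of whose new first vertices lie in `B`. -/
inductive HRot (G : SimpleGraph V) (A B : Set V) : ℕ → List V → List V → Prop
  | refl (l : List V) : HRot G A B 0 l l
  | step {t : ℕ} {l l1 l2 : List V} {x y w : V} (h : HRot G A B t l (l1 ++ y :: w :: l2))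
      (hx : (l1 ++ [y]).head? = some x) (hxw : G.Adj x w) (hw : w ∈ A) (hy : y ∈ B) :
      HRot G A B (t + 1) l (y :: l1.reverse ++ w :: l2)

variable {G : SimpleGraph V} {A B : Set V} {t : ℕ} {l l' : List V}

theorem HRot.perm (h : HRot G A B t l l') : l'.Perm l := by
  induction h with
  | refl l => exact List.Perm.refl _
  | step h hx hxw hw hy ih =>
    refine List.Perm.trans ?_ ih
    rename_i l1 l2 x y w
    have : (y :: l1.reverse).Perm (l1 ++ [y]) := by
      have := List.reverse_perm (l1 ++ [y])
      simpa using this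
    simpa using this.append_right (w :: l2)

theorem isChain_reverse_of_isChain (h : l.IsChain G.Adj) : l.reverse.IsChain G.Adj := by
  rw [List.isChain_reverse]
  exact h.imp fun a b h => h.symm

theorem isChain_rotate {l1 l2 : List V} {x y w : V} (h : (l1 ++ y :: w :: l2).IsChain G.Adj)
    (hx : (l1 ++ [y]).head? = some x) (hxw : G.Adj x w) :
    (y :: l1.reverse ++ w :: l2).IsChain G.Adj := by
  have h' : ((l1 ++ [y]) ++ w :: l2).IsChain G.Adj := by simpa using h
  have e : y :: l1.reverse ++ w :: l2 = (l1 ++ [y]).reverse ++ w :: l2 := by simp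
  rw [e, List.isChain_append]
  rw [List.isChain_append] at h'
  refine ⟨?_, h'.2.1, ?_⟩
  · rw [List.isChain_reverse]
    exact h'.1.imp fun a b h => h.symm
  · intro a ha b hb
    rw [List.getLast?_reverse, hx] at ha
    simp only [Option.mem_def, Option.some.injEq, List.head?_cons] at ha hb
    subst ha hb
    exact hxw

theorem HRot.isChain (h : HRot G A B t l l') (hl : l.IsChain G.Adj) : l'.IsChain G.Adj := by
  induction h with
  | refl l => exact hl
  | step h hx hxw hw hy ih => exact isChain_rotate (ih hl) hx hxw

theorem HRot.getLast? (h : HRot G A B t l l') : l'.getLast? = l.getLast? := by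
  induction h with
  | refl l => rfl
  | step h hx hxw hw hy ih =>
    rename_i l1 l2 x y w
    rw [← ih, List.getLast?_append_of_ne_nil _ (by simp),
      show l1 ++ y :: w :: l2 = (l1 ++ [y]) ++ w :: l2 by simp,
      List.getLast?_append_of_ne_nil _ (by simp)]

theorem keeps_rotate {I l1 l2 : List V} {y w : V} (h : Keeps I (l1 ++ y :: w :: l2))
    (hw : w ∉ I) : Keeps I (y :: l1.reverse ++ w :: l2) := by
  have h' : Keeps I ((l1 ++ [y]) ++ w :: l2) := by simpa using h
  rcases h'.or_of_notMem hw with h | h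
  · have := h.reverse.append_right (w :: l2)
    simpa using this
  · have := (h.append_left [w]).append_left (y :: l1.reverse)
    simpa using this

theorem HRot.exists_pivots [DecidableEq V] (h : HRot G A B t l l') :
    ∃ P : Finset V, P.card ≤ t ∧ (∀ v ∈ P, v ∈ A) ∧
      ∀ I : List V, (∀ a ∈ I, a ∉ P) → Keeps I l → Keeps I l' := by
  induction h with
  | refl l => exact ⟨∅, by simp, by simp, fun I _ h => h⟩
  | step h hx hxw hw hy ih =>
    rename_i l1 l2 x y w
    obtain ⟨P, hP, hPA, hI⟩ := ih
    refine ⟨insert w P, (Finset.card_insert_le _ _).trans (by omega), ?_, ?_⟩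
    · intro v hv
      rcases Finset.mem_insert.1 hv with rfl | hv
      · exact hw
      · exact hPA v hv
    · intro I hI' hk
      refine keeps_rotate (hI I (fun a ha hp => hI' a ha (Finset.mem_insert_of_mem hp)) hk) ?_
      intro hm
      exact hI' w hm (Finset.mem_insert_self _ _)

theorem HRot.append (h : HRot G A B t l l') (r : List V) : HRot G A B t (l ++ r) (l' ++ r) := by
  induction h with
  | refl l => exact HRot.refl _
  | step h hx hxw hw hy ih =>
    have := HRot.step (by simpa using ih) hx hxw hw hy
    simpa using this

/-- `y` is the first vertex of a path obtained from `l` by at most `t` rotations. -/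
def IsHead (G : SimpleGraph V) (A B : Set V) (t : ℕ) (l : List V) (y : V) : Prop :=
  ∃ s ≤ t, ∃ l', HRot G A B s l l' ∧ l'.head? = some y

theorem IsHead.mono {t s : ℕ} {y : V} (hts : t ≤ s) (h : IsHead G A B t l y) :
    IsHead G A B s l y := by
  obtain ⟨r, hr, h⟩ := h
  exact ⟨r, hr.trans hts, h⟩

theorem HRot.keeps_pair (h : HRot G A B t l l') {u v : V} (hu : ¬ IsHead G A B t l u)
    (hv : ¬ IsHead G A B t l v) (huv : Keeps [u, v] l) : Keeps [u, v] l' := by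
  induction h with
  | refl l => exact huv
  | step h hx hxw hw hy ih =>
    rename_i t l l1 l2 x y w
    have hk := ih (fun h => hu (h.mono (by omega))) (fun h => hv (h.mono (by omega))) huv
    have hy' : IsHead G A B (t + 1) l y := ⟨t + 1, le_rfl, _, HRot.step h hx hxw hw hy, by simp⟩
    have hn : y ∉ [u, v] := by
      simp only [List.mem_cons, List.not_mem_nil, or_false, not_or]
      exact ⟨fun e => hu (e ▸ hy'), fun e => hv (e ▸ hy')⟩
    rcases hk.or_of_notMem hn with h | h
    · have := (h.reverse.append_left [y]).append_right (w :: l2)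
      simpa using this
    · have := h.append_left (y :: l1.reverse)
      simpa using this

/-- Pósa's rotation lemma. -/
theorem IsHead.neighbor (hl : l.Nodup) {x w : V} (hx : IsHead G A B t l x) (hxw : G.Adj x w)
    (hw : w ∈ A) (hwl : w ∈ l) (hB : ∀ v, Keeps [v, w] l → v ∈ B) :
    IsHead G A B t l w ∨ ∃ v, IsHead G A B (t + 1) l v ∧ Keeps [v, w] l := by
  by_contra hcon
  push Not at hcon
  obtain ⟨hw0, hv0⟩ := hcon
  obtain ⟨s, hs, l', hr, hx'⟩ := hx
  have hl' : l'.Nodup := hr.perm.nodup_iff.2 hl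
  have hwl' : w ∈ l' := hr.perm.mem_iff.2 hwl
  obtain ⟨l1, l2, rfl⟩ := List.append_of_mem hwl'
  have hne : l1 ≠ [] := by
    rintro rfl
    simp only [List.nil_append, List.head?_cons, Option.some.injEq] at hx'
    exact hxw.ne hx'.symm
  obtain ⟨l1, y, rfl⟩ : ∃ l1' y, l1 = l1' ++ [y] :=
    ⟨l1.dropLast, l1.getLast hne, (List.dropLast_append_getLast hne).symm⟩
  have hyw : [y, w] <:+: (l1 ++ [y]) ++ w :: l2 := ⟨l1, l2, by simp⟩
  have persist : ∀ u, Keeps [u, w] l → Keeps [u, w] ((l1 ++ [y]) ++ w :: l2) := by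
    intro u hu
    refine hr.keeps_pair (fun h => hv0 u (h.mono (by omega)) hu) (fun h => hw0 (h.mono hs)) hu
  have key : Keeps [y, w] l := by
    obtain ⟨p, q, rfl⟩ := List.append_of_mem hwl
    rcases List.eq_nil_or_concat p with rfl | ⟨p, a, rfl⟩
    · exact absurd ⟨0, Nat.zero_le _, _, HRot.refl _, by simp⟩ hw0
    have ha : Keeps [a, w] (p.concat a ++ w :: q) := Or.inl ⟨p, q, by simp⟩
    rcases persist a ha with h | h
    · rw [pred_unique hl' hyw h]; exact ha
    · have h' : [w, a] <:+: (l1 ++ [y]) ++ w :: l2 := by simpa using h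
      cases q with
      | nil =>
        have hlast := hr.getLast?
        cases l2 with
        | nil =>
          have := infix_or_infix_of_notMem (I := [a]) (l1 := l1 ++ [y]) (l2 := []) (w := w)
          exfalso
          have h2 : [a, w] <:+: w :: (l1 ++ [y]).reverse := by simpa using h'.reverse
          obtain ⟨c, d, e⟩ := h2
          cases c with
          | nil =>
            simp at e
            have hn : (a :: w :: d).Nodup := by
              have : (w :: (l1 ++ [y]).reverse).Nodup := by
                have := List.nodup_reverse.2 hl'
                simpa using this
              rw [show w :: (l1 ++ [y]).reverse = a :: w :: d by simp [e.1, e.2]] at this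
              exact this
            simp [e.1] at hn
          | cons c0 c =>
            simp at e
            have : (w :: (l1 ++ [y]).reverse).Nodup := by
              have := List.nodup_reverse.2 hl'
              simpa using this
            rw [show w :: (l1 ++ [y]).reverse = w :: (c ++ a :: w :: d) by simp [e.2]] at this
            simp at this
        | cons b l2 =>
          exfalso
          have hlast' : (b :: l2).getLast? = some w := by simpa using hlast
          have hm : w ∈ b :: l2 := List.mem_of_getLast? hlast'
          exact (List.nodup_cons.1 (List.nodup_append.1 hl').2.1).1 hm
      | cons b q =>
        have hb : Keeps [b, w] (p.concat a ++ w :: b :: q) := Or.inr ⟨p ++ [a], q, by simp⟩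
        rcases persist b hb with hb' | hb'
        · rw [pred_unique hl' hyw hb']; exact hb
        · have hb'' : [w, b] <:+: (l1 ++ [y]) ++ w :: l2 := by simpa using hb'
          have := succ_unique hl' h' hb''
          subst this
          exfalso
          simp [List.nodup_append] at hl
  refine hv0 y ⟨s + 1, by omega, _, HRot.step (by simpa using hr) (x := x) ?_ hxw hw (hB y key), by simp⟩ key
  · cases l1 <;> simpa using hx'

end ListPaths

section Rotations

variable {V : Type} [Fintype V] [DecidableEq V] {G : SimpleGraph V}

open Classical in
/-- The neighbourhood of a set of vertices. -/
noncomputable def nbr (G : SimpleGraph V) (S : Finset V) : Finset V :=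
  Finset.univ.filter fun w => ∃ v ∈ S, G.Adj v w

open Classical in
/-- The vertices adjacent to some vertex of `X` along the path `l`. -/
noncomputable def pathNbr (l : List V) (X : Finset V) : Finset V :=
  Finset.univ.filter fun w => ∃ v ∈ X, Keeps [v, w] l

open Classical in
/-- The set of first vertices of paths obtained from `l` by at most `t` rotations. -/
noncomputable def heads (G : SimpleGraph V) (A B : Set V) (t : ℕ) (l : List V) : Finset V :=
  Finset.univ.filter fun v => IsHead G A B t l v

/-- Any two disjoint sets of at least `m` vertices are joined by an edge. -/
def IsJoined (G : SimpleGraph V) (m : ℕ) : Prop :=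
  ∀ A B : Finset V, Disjoint A B → m ≤ A.card → m ≤ B.card → ∃ a ∈ A, ∃ b ∈ B, G.Adj a b

@[simp] theorem mem_nbr {S : Finset V} {w : V} : w ∈ nbr G S ↔ ∃ v ∈ S, G.Adj v w := by
  simp [nbr]

@[simp] theorem mem_pathNbr {l : List V} {X : Finset V} {w : V} :
    w ∈ pathNbr l X ↔ ∃ v ∈ X, Keeps [v, w] l := by
  simp [pathNbr]

@[simp] theorem mem_heads {A B : Set V} {t : ℕ} {l : List V} {v : V} :
    v ∈ heads G A B t l ↔ IsHead G A B t l v := by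
  simp [heads]

theorem nbr_mono {S T : Finset V} (h : S ⊆ T) : nbr G S ⊆ nbr G T := by
  intro w
  simp only [mem_nbr]
  rintro ⟨v, hv, h'⟩
  exact ⟨v, h hv, h'⟩

theorem nbr_union (S T : Finset V) : nbr G (S ∪ T) = nbr G S ∪ nbr G T := by
  ext w
  simp only [mem_nbr, Finset.mem_union, or_and_right, exists_or]

theorem pathNbr_mono {l : List V} {S T : Finset V} (h : S ⊆ T) : pathNbr l S ⊆ pathNbr l T := by
  intro w
  simp only [mem_pathNbr]
  rintro ⟨v, hv, h'⟩
  exact ⟨v, h hv, h'⟩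

theorem card_pathNbr_le {l : List V} (hl : l.Nodup) (X : Finset V) :
    (pathNbr l X).card ≤ 2 * X.card := card_neighbors_le hl X

theorem IsJoined.card_compl_lt {m : ℕ} (h : IsJoined G m) {S : Finset V} (hS : m ≤ S.card) :
    (Finset.univ \ (S ∪ nbr G S)).card < m := by
  by_contra! hcon
  have hd : Disjoint S (Finset.univ \ (S ∪ nbr G S)) := by
    rw [Finset.disjoint_left]
    intro v hv hv'
    simp [hv] at hv'
  obtain ⟨a, ha, b, hb, hab⟩ := h S _ hd hS hcon
  simp only [Finset.mem_sdiff, Finset.mem_union, mem_nbr, not_or] at hb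
  exact hb.2.2 ⟨a, ha, hab⟩

theorem IsJoined.card_le {m : ℕ} (h : IsJoined G m) {S : Finset V} (hS : m ≤ S.card) :
    Fintype.card V ≤ S.card + (nbr G S).card + m := by
  have h1 := h.card_compl_lt hS
  have h2 := Finset.card_sdiff_add_card_eq_card (Finset.subset_univ (S ∪ nbr G S))
  have h3 := Finset.card_union_le S (nbr G S)
  rw [Finset.card_univ] at h2
  omega

theorem IsJoined.exists_adj {m : ℕ} (h : IsJoined G m) {A B : Finset V} (hA : m ≤ A.card)
    (hB : 2 * m ≤ B.card) : ∃ a ∈ A, ∃ b ∈ B, G.Adj a b := by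
  obtain ⟨A', hA', hc⟩ := Finset.exists_subset_card_eq hA
  obtain ⟨a, ha, b, hb, hab⟩ := h A' (B \ A') Finset.disjoint_sdiff hc.ge (by
    have := Finset.le_card_sdiff A' B
    omega)
  exact ⟨a, hA' ha, b, (Finset.mem_sdiff.1 hb).1, hab⟩

/-- A path which contains the given path `sp` as a block. -/
structure IsGood (G : SimpleGraph V) (sp l : List V) : Prop where
  isChain : l.IsChain G.Adj
  nodup : l.Nodup
  keeps : Keeps sp l

/-- A longest path containing `sp` as a block. -/
structure IsLongest (G : SimpleGraph V) (sp l : List V) : Prop extends IsGood G sp l where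
  le : ∀ l', IsGood G sp l' → l'.length ≤ l.length

variable {sp l l' : List V} {A B : Set V} {t : ℕ}

theorem IsGood.reverse (h : IsGood G sp l) : IsGood G sp l.reverse :=
  ⟨isChain_reverse_of_isChain h.isChain, List.nodup_reverse.2 h.nodup, h.keeps.reverse⟩

theorem HRot.keeps (h : HRot G A B t l l') (hA : ∀ v ∈ sp, v ∉ A) (hk : Keeps sp l) :
    Keeps sp l' := by
  obtain ⟨P, -, hP, hI⟩ := h.exists_pivots
  exact hI sp (fun a ha hp => hA a ha (hP a hp)) hk

theorem HRot.isGood (h : HRot G A B t l l') (hA : ∀ v ∈ sp, v ∉ A) (hl : IsGood G sp l) :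
    IsGood G sp l' :=
  ⟨h.isChain hl.isChain, h.perm.nodup_iff.2 hl.nodup, h.keeps hA hl.keeps⟩

theorem IsGood.isLongest (h : IsGood G sp l) {P : List V} (hP : IsLongest G sp P)
    (hlen : P.length ≤ l.length) : IsLongest G sp l :=
  ⟨h, fun l' hl' => (hP.le l' hl').trans hlen⟩

theorem exists_isLongest (h : IsGood G sp sp) : ∃ l, IsLongest G sp l := by
  have hb : BddAbove {k | ∃ l, IsGood G sp l ∧ l.length = k} := by
    refine ⟨Fintype.card V, ?_⟩
    rintro _ ⟨l, hl, rfl⟩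
    exact hl.nodup.length_le_card
  obtain ⟨l, hl, hk⟩ := Nat.sSup_mem (s := {k | ∃ l, IsGood G sp l ∧ l.length = k}) ⟨_, sp, h, rfl⟩ hb
  exact ⟨l, hl, fun l' hl' => hk ▸ le_csSup hb ⟨l', hl', rfl⟩⟩

theorem IsLongest.mem_of_adj_head (h : IsLongest G sp l) {x w : V} (hx : l.head? = some x)
    (hxw : G.Adj x w) : w ∈ l := by
  by_contra hw
  have hg : IsGood G sp (w :: l) := by
    refine ⟨?_, List.nodup_cons.2 ⟨hw, h.nodup⟩, h.keeps.append_left [w]⟩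
    rw [List.isChain_cons]
    refine ⟨?_, h.isChain⟩
    intro y hy
    rw [hx, Option.mem_def, Option.some.injEq] at hy
    exact hy ▸ hxw.symm
  have := h.le _ hg
  simp at this

theorem IsLongest.nbr_heads (h : IsLongest G sp l) (hA : ∀ v ∈ sp, v ∉ A) {w : V}
    (hw : w ∈ nbr G (heads G A B t l)) : w ∈ l := by
  simp only [mem_nbr, mem_heads] at hw
  obtain ⟨x, ⟨s, -, l', hr, hx⟩, hxw⟩ := hw
  have := (hr.isGood hA h.toIsGood).isLongest h hr.perm.length_eq.ge
  exact hr.perm.mem_iff.1 (this.mem_of_adj_head hx hxw)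

theorem heads_mono {s : ℕ} (h : t ≤ s) : heads G A B t l ⊆ heads G A B s l := by
  intro v
  simp only [mem_heads]
  exact IsHead.mono h

theorem IsHead.mem {y : V} (h : IsHead G A B t l y) : y ∈ l := by
  obtain ⟨s, -, l', hr, hy⟩ := h
  exact hr.perm.mem_iff.1 (List.mem_of_mem_head? hy)

/-- The numbers of heads grow. -/
theorem IsLongest.card_nbr_heads_le (h : IsLongest G sp l) (t : ℕ) :
    (nbr G (heads G {v | v ∉ sp} Set.univ t l) \ sp.toFinset).card ≤
      3 * (heads G {v | v ∉ sp} Set.univ (t + 1) l).card := by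
  have hsub : nbr G (heads G {v | v ∉ sp} Set.univ t l) \ sp.toFinset ⊆
      heads G {v | v ∉ sp} Set.univ (t + 1) l ∪
        pathNbr l (heads G {v | v ∉ sp} Set.univ (t + 1) l) := by
    intro w hw
    rw [Finset.mem_sdiff, List.mem_toFinset] at hw
    have hwl := h.nbr_heads (by simp) hw.1
    obtain ⟨x, hx, hxw⟩ := mem_nbr.1 hw.1
    rw [mem_heads] at hx
    rw [Finset.mem_union, mem_heads, mem_pathNbr]
    rcases hx.neighbor h.nodup hxw hw.2 hwl (fun _ _ => Set.mem_univ _) with h1 | ⟨v, h1, h2⟩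
    · exact Or.inl (h1.mono (Nat.le_succ t))
    · exact Or.inr ⟨v, mem_heads.2 h1, h2⟩
  have h1 := (Finset.card_le_card hsub).trans (Finset.card_union_le _ _)
  have h2 := card_pathNbr_le h.nodup (heads G {v | v ∉ sp} Set.univ (t + 1) l)
  omega

theorem IsLongest.card_heads (h : IsLongest G sp l) (hne : l ≠ []) {m T : ℕ} (hT : m ≤ 2 ^ T)
    (hE : ∀ S : Finset V, S.card ≤ m → 6 * S.card ≤ (nbr G S \ sp.toFinset).card) :
    m ≤ (heads G {v | v ∉ sp} Set.univ T l).card := by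
  have key : ∀ t, min (2 ^ t) m ≤ (heads G {v | v ∉ sp} Set.univ t l).card := by
    intro t
    induction t with
    | zero =>
      refine (min_le_left _ _).trans ?_
      rw [pow_zero, Nat.one_le_iff_ne_zero, Finset.card_ne_zero]
      exact ⟨l.head hne, mem_heads.2 ⟨0, le_rfl, l, HRot.refl l, List.head?_eq_some_head hne⟩⟩
    | succ t ih =>
      rcases le_or_gt m (heads G {v | v ∉ sp} Set.univ t l).card with hm | hm
      · exact (min_le_right _ _).trans (hm.trans (Finset.card_le_card (heads_mono (Nat.le_succ t))))
      · have h1 := hE _ hm.le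
        have h2 := h.card_nbr_heads_le t
        have h3 : 2 ^ t ≤ (heads G {v | v ∉ sp} Set.univ t l).card := by
          rcases min_le_iff.1 ih with h | h
          · exact h
          · omega
        refine (min_le_left _ _).trans ?_
        rw [pow_succ]
        omega
  simpa [hT] using key T

theorem IsLongest.card_compl_lt (h : IsLongest G sp l) (hne : l ≠ []) {m T : ℕ} (hT : m ≤ 2 ^ T)
    (hE : ∀ S : Finset V, S.card ≤ m → 6 * S.card ≤ (nbr G S \ sp.toFinset).card)
    (hJ : IsJoined G m) : (Finset.univ \ l.toFinset).card < m := by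
  refine lt_of_le_of_lt (Finset.card_le_card ?_) (hJ.card_compl_lt (h.card_heads hne hT hE))
  intro v hv
  rw [Finset.mem_sdiff, List.mem_toFinset] at hv
  rw [Finset.mem_sdiff, Finset.mem_union, not_or]
  exact ⟨hv.1, fun h' => hv.2 (mem_heads.1 h').mem, fun h' => hv.2 (h.nbr_heads (by simp) h')⟩

theorem IsLongest.card_le_heads (h : IsLongest G sp l) (hne : l ≠ []) {m T : ℕ} (hT : m ≤ 2 ^ T)
    (hE : ∀ S : Finset V, S.card ≤ m → 6 * S.card ≤ (nbr G S \ sp.toFinset).card)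
    (hJ : IsJoined G m) (hsp : sp.length ≤ m) (hn : 12 * m ≤ Fintype.card V) :
    Fintype.card V ≤ 4 * (heads G {v | v ∉ sp} Set.univ (T + 1) l).card := by
  obtain ⟨S, hS, hSm⟩ := Finset.exists_subset_card_eq (h.card_heads hne hT hE)
  have h1 := hJ.card_le hSm.ge
  have h2 := h.card_nbr_heads_le T
  have h3 := Finset.card_le_card (Finset.sdiff_subset_sdiff (nbr_mono (G := G) hS)
    (subset_refl sp.toFinset))
  have h4 := Finset.le_card_sdiff sp.toFinset (nbr G S)
  have h5 := List.toFinset_card_le sp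
  omega

/-- Many pairs of vertices are joined by longest paths which differ little from a given one. -/
theorem IsLongest.exists_pairs (h : IsLongest G sp l) (hne : l ≠ []) {m T : ℕ} (hT : m ≤ 2 ^ T)
    (hE : ∀ S : Finset V, S.card ≤ m → 6 * S.card ≤ (nbr G S \ sp.toFinset).card)
    (hJ : IsJoined G m) (hsp : sp.length ≤ m) (hn : 12 * m ≤ Fintype.card V) :
    ∃ X : Finset (V × V), Fintype.card V ^ 2 ≤ 16 * X.card ∧ ∀ p ∈ X, ∃ l', IsGood G sp l' ∧
      l'.Perm l ∧ l'.head? = some p.1 ∧ l'.getLast? = some p.2 ∧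
      ∃ D : Finset V, D.card ≤ 2 * (T + 1) ∧
        ∀ I : List V, (∀ a ∈ I, a ∉ D) → Keeps I l → Keeps I l' := by
  have hx : ∀ x ∈ heads G {v | v ∉ sp} Set.univ (T + 1) l,
      ∃ s ≤ T + 1, ∃ l', HRot G {v | v ∉ sp} Set.univ s l l' ∧ l'.head? = some x :=
    fun x hx => mem_heads.1 hx
  choose! s hs f hf using hx
  refine ⟨(heads G {v | v ∉ sp} Set.univ (T + 1) l).biUnion fun x =>
    (heads G {v | v ∉ sp} Set.univ (T + 1) (f x).reverse).image fun y => (x, y), ?_, ?_⟩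
  · rw [Finset.card_biUnion]
    · have h1 := h.card_le_heads hne hT hE hJ hsp hn
      have h2 : ∀ x ∈ heads G {v | v ∉ sp} Set.univ (T + 1) l, Fintype.card V ≤
          4 * ((heads G {v | v ∉ sp} Set.univ (T + 1) (f x).reverse).image fun y => (x, y)).card := by
        intro x hx
        rw [Finset.card_image_of_injective _ (Prod.mk_right_injective x)]
        have hp := (hf x hx).1.perm
        have hL : IsLongest G sp (f x).reverse :=
          ((hf x hx).1.isGood (by simp) h.toIsGood).reverse.isLongest h (by simp [hp.length_eq])
        refine hL.card_le_heads ?_ hT hE hJ hsp hn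
        intro h0
        rw [List.reverse_eq_nil_iff] at h0
        rw [h0] at hp
        exact hne (List.nil_perm.1 hp)
      have h3 := Finset.sum_le_sum h2
      rw [Finset.sum_const, smul_eq_mul, ← Finset.mul_sum] at h3
      nlinarith
    · intro x _ x' _ hxx
      simp only [Function.onFun]
      rw [Finset.disjoint_left]
      rintro ⟨a, b⟩ ha hb
      simp only [Finset.mem_image, Prod.mk.injEq] at ha hb
      obtain ⟨_, _, rfl, _⟩ := ha
      obtain ⟨_, _, rfl, _⟩ := hb
      exact hxx rfl
  · rintro ⟨a, b⟩ hp
    simp only [Finset.mem_biUnion, Finset.mem_image, Prod.mk.injEq] at hp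
    obtain ⟨x, hx, y, hy, rfl, rfl⟩ := hp
    obtain ⟨r, hr, g, hg, hgy⟩ := mem_heads.1 hy
    obtain ⟨hfx, hfx'⟩ := hf x hx
    have hgood := hfx.isGood (by simp) h.toIsGood
    refine ⟨g.reverse, (hg.isGood (by simp) hgood.reverse).reverse, ?_, ?_, ?_, ?_⟩
    · exact (List.reverse_perm _).trans (hg.perm.trans ((List.reverse_perm _).trans hfx.perm))
    · rw [List.head?_reverse, hg.getLast?, List.getLast?_reverse, hfx']
    · rw [List.getLast?_reverse, hgy]
    · obtain ⟨D, hD, -, hDI⟩ := hfx.exists_pivots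
      obtain ⟨D', hD', -, hDI'⟩ := hg.exists_pivots
      refine ⟨D ∪ D', ?_, ?_⟩
      · have := Finset.card_union_le D D'
        have := hs x hx
        omega
      · intro I hI hk
        simp only [Finset.mem_union, not_or] at hI
        exact (hDI' I (fun a ha => (hI a ha).2) (hDI I (fun a ha => (hI a ha).1) hk).reverse).reverse

end Rotations

section Segments

variable {V : Type} [DecidableEq V] {l : List V}

/-- The `j`-th block of length `L` of the list `l`. -/
def seg (l : List V) (L j : ℕ) : List V := (l.drop (j * L)).take L

theorem seg_isInfix (l : List V) (L j : ℕ) : seg l L j <:+: l :=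
  (List.take_prefix _ _).isInfix.trans (List.drop_suffix _ _).isInfix

theorem mem_seg_iff {L j : ℕ} {a : V} :
    a ∈ seg l L j ↔ ∃ i, ∃ h : j * L + i < l.length, i < L ∧ l[j * L + i] = a := by
  rw [seg, List.mem_iff_getElem]
  constructor
  · rintro ⟨i, hi, rfl⟩
    rw [List.length_take, List.length_drop] at hi
    exact ⟨i, by omega, by omega, by simp⟩
  · rintro ⟨i, hi, hiL, rfl⟩
    exact ⟨i, by rw [List.length_take, List.length_drop]; omega, by simp⟩

theorem seg_index_unique (hl : l.Nodup) {L i j : ℕ} {a : V} (hi : a ∈ seg l L i)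
    (hj : a ∈ seg l L j) : i = j := by
  obtain ⟨s, hs, hsL, hs'⟩ := mem_seg_iff.1 hi
  obtain ⟨r, hr, hrL, hr'⟩ := mem_seg_iff.1 hj
  have h := (hl.getElem_inj_iff (hi := hs) (hj := hr)).1 (hs'.trans hr'.symm)
  have h1 : (i * L + s) / L = i := by
    rw [mul_comm, Nat.mul_add_div (by omega), Nat.div_eq_of_lt hsL, add_zero]
  have h2 : (j * L + r) / L = j := by
    rw [mul_comm, Nat.mul_add_div (by omega), Nat.div_eq_of_lt hrL, add_zero]
  rw [← h1, ← h2, h]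

theorem triple_infix_seg {L j i : ℕ} (hi : i + 2 < L) (h : j * L + (i + 2) < l.length) :
    [l[j * L + i], l[j * L + (i + 1)], l[j * L + (i + 2)]] <:+: seg l L j := by
  have e : seg l L j = (seg l L j).take i ++
      [l[j * L + i], l[j * L + (i + 1)], l[j * L + (i + 2)]] ++ (seg l L j).drop (i + 3) := by
    have hlen : (seg l L j).length = min L (l.length - j * L) := by
      rw [seg, List.length_take, List.length_drop]
    have h3 : (seg l L j).drop i = [l[j * L + i], l[j * L + (i + 1)], l[j * L + (i + 2)]] ++
        (seg l L j).drop (i + 3) := by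
      rw [List.drop_eq_getElem_cons (by omega), List.drop_eq_getElem_cons (by omega),
        List.drop_eq_getElem_cons (by omega)]
      simp [seg]
    rw [List.append_assoc, ← h3, List.take_append_drop]
  exact ⟨_, _, e.symm⟩

theorem eq_or_eq_of_keeps (hl : l.Nodup) {u v w a : V} (h : [u, w, v] <:+: l)
    (ha : Keeps [a, w] l) : a = u ∨ a = v := by
  have h1 : [u, w] <:+: l := List.IsInfix.trans ⟨[], [v], rfl⟩ h
  have h2 : [w, v] <:+: l := List.IsInfix.trans ⟨[u], [], rfl⟩ h
  rcases ha with ha | ha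
  · exact Or.inl (pred_unique hl ha h1)
  · exact Or.inr (succ_unique hl (by simpa using ha) h2)

theorem keeps_pair_of_keeps {I : List V} (hl : l.Nodup) (hI : Keeps I l) {u v w a : V}
    (h : [u, w, v] <:+: I) (ha : Keeps [a, w] l) : Keeps [a, w] I := by
  have h1 : Keeps [u, w] I := Or.inl (List.IsInfix.trans ⟨[], [v], rfl⟩ h)
  have h2 : Keeps [v, w] I := Or.inr (List.IsInfix.trans ⟨[u], [], rfl⟩ h)
  have h3 : a = u ∨ a = v := by
    rcases hI with hI | hI
    · exact eq_or_eq_of_keeps hl (h.trans hI) ha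
    · have : [v, w, u] <:+: I.reverse := by simpa using h.reverse
      exact (eq_or_eq_of_keeps hl (this.trans hI) ha).symm
  rcases h3 with rfl | rfl
  · exact h1
  · exact h2

open Classical in
/-- A bounded number of broken blocks. -/
theorem card_kept_segments (hl : l.Nodup) {l' : List V} {D : Finset V} {q L : ℕ}
    (hD : ∀ I : List V, (∀ a ∈ I, a ∉ D) → Keeps I l → Keeps I l') :
    q ≤ ((Finset.range q).filter fun j => Keeps (seg l L j) l').card + D.card := by
  have h1 : ((Finset.range q).filter fun j => ¬ Keeps (seg l L j) l').card ≤ D.card := by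
    have : ∀ j, ¬ Keeps (seg l L j) l' → ∃ a ∈ seg l L j, a ∈ D := by
      intro j hj
      by_contra! hcon
      exact hj (hD _ hcon (Or.inl (seg_isInfix l L j)))
    rcases isEmpty_or_nonempty V with hV | hV
    · rw [Finset.filter_eq_empty_iff.2, Finset.card_empty]
      · exact Nat.zero_le _
      · intro j _ hj
        exact hV.elim (this j hj).choose
    choose! f hf hfD using this
    apply Finset.card_le_card_of_injOn f
    · intro j hj
      exact hfD j (Finset.mem_filter.1 hj).2
    · intro i hi j hj hij
      exact seg_index_unique hl (hf i (Finset.mem_filter.1 hi).2)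
        (hij ▸ hf j (Finset.mem_filter.1 hj).2)
  have h2 := Finset.card_filter_add_card_filter_not (s := Finset.range q)
    (fun j => Keeps (seg l L j) l')
  rw [Finset.card_range] at h2
  omega

open Classical in
theorem exists_split (hl : l.Nodup) {l' : List V} {D : Finset V} {ρ L : ℕ} (hρ : 1 ≤ ρ)
    (hL : 1 ≤ L) (hlen : 8 * ρ * L ≤ l.length) (hDc : D.card ≤ ρ)
    (hD : ∀ I : List V, (∀ a ∈ I, a ∉ D) → Keeps I l → Keeps I l') :
    ∃ Q1 Q2, l' = Q1 ++ Q2 ∧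
      3 * ρ ≤ ((Finset.range (8 * ρ)).filter fun j => Keeps (seg l L j) Q1).card ∧
      3 * ρ ≤ ((Finset.range (8 * ρ)).filter fun j => Keeps (seg l L j) Q2).card := by
  have h0 := card_kept_segments hl (q := 8 * ρ) (L := L) hD
  have hex : ∃ i, 3 * ρ ≤
      ((Finset.range (8 * ρ)).filter fun j => Keeps (seg l L j) (l'.take i)).card :=
    ⟨l'.length, by rw [List.take_length]; omega⟩
  obtain ⟨hi, hmin⟩ := And.intro (Nat.find_spec hex) (fun k => Nat.find_min hex (m := k))
  generalize Nat.find hex = i at hi hmin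
  refine ⟨l'.take i, l'.drop i, (List.take_append_drop i l').symm, hi, ?_⟩
  have hi0 : i ≠ 0 := by
    rintro rfl
    have : ((Finset.range (8 * ρ)).filter fun j => Keeps (seg l L j) (l'.take 0)) = ∅ := by
      rw [Finset.filter_eq_empty_iff]
      intro j hj hk
      rw [Finset.mem_range] at hj
      have hm : j * L + 0 < l.length := by nlinarith
      have := hk.subset (mem_seg_iff.2 ⟨0, hm, by omega, rfl⟩)
      simp at this
    rw [this, Finset.card_empty] at hi
    omega
  obtain ⟨i, rfl⟩ := Nat.exists_eq_succ_of_ne_zero hi0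
  have hi1 := hmin i (Nat.lt_succ_self i)
  rw [not_le] at hi1
  have hil : i < l'.length := by
    by_contra! hcon
    rw [List.take_of_length_le hcon] at hi1
    rw [List.take_of_length_le (by omega)] at hi
    omega
  have e : l' = l'.take i ++ l'[i] :: l'.drop (i + 1) := by
    rw [← List.drop_eq_getElem_cons, List.take_append_drop]
  have hsub : ((Finset.range (8 * ρ)).filter fun j => Keeps (seg l L j) l') ⊆
      ((Finset.range (8 * ρ)).filter fun j => Keeps (seg l L j) (l'.take i)) ∪
      ((Finset.range (8 * ρ)).filter fun j => Keeps (seg l L j) (l'.drop (i + 1))) ∪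
      ((Finset.range (8 * ρ)).filter fun j => l'[i] ∈ seg l L j) := by
    intro j hj
    simp only [Finset.mem_union, Finset.mem_filter] at hj ⊢
    by_cases hm : l'[i] ∈ seg l L j
    · exact Or.inr ⟨hj.1, hm⟩
    · have hk := hj.2
      rw [e] at hk
      rcases hk.or_of_notMem hm with h | h
      · exact Or.inl (Or.inl ⟨hj.1, h⟩)
      · exact Or.inl (Or.inr ⟨hj.1, h⟩)
  have hone : ((Finset.range (8 * ρ)).filter fun j => l'[i] ∈ seg l L j).card ≤ 1 := by
    rw [Finset.card_le_one]
    intro a ha b hb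
    exact seg_index_unique hl (Finset.mem_filter.1 ha).2 (Finset.mem_filter.1 hb).2
  have h2 := Finset.card_le_card hsub
  have h3 := Finset.card_union_le
    (((Finset.range (8 * ρ)).filter fun j => Keeps (seg l L j) (l'.take i)) ∪
      ((Finset.range (8 * ρ)).filter fun j => Keeps (seg l L j) (l'.drop (i + 1))))
    ((Finset.range (8 * ρ)).filter fun j => l'[i] ∈ seg l L j)
  have h4 := Finset.card_union_le
    ((Finset.range (8 * ρ)).filter fun j => Keeps (seg l L j) (l'.take i))
    ((Finset.range (8 * ρ)).filter fun j => Keeps (seg l L j) (l'.drop (i + 1)))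
  rw [Nat.succ_eq_add_one]
  omega

variable [Fintype V]

open Classical in
/-- The vertices outside `W` in the interior of one of the blocks indexed by `J`. -/
noncomputable def segInterior (l : List V) (L : ℕ) (J : Finset ℕ) (W : Finset V) : Finset V :=
  Finset.univ.filter fun w => w ∉ W ∧ ∃ j ∈ J, ∃ u v, [u, w, v] <:+: seg l L j

theorem card_segInterior (hl : l.Nodup) {L q : ℕ} {J : Finset ℕ} (hJ : J ⊆ Finset.range q)
    (hlen : q * L ≤ l.length) (W : Finset V) :
    J.card * (L - 2) ≤ (segInterior l L J W).card + W.card := by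
  have hb : ∀ p ∈ J ×ˢ Finset.range (L - 2), p.1 * L + (p.2 + 2) < l.length := by
    rintro ⟨j, i⟩ hp
    rw [Finset.mem_product, Finset.mem_range] at hp
    have h1 := Finset.mem_range.1 (hJ hp.1)
    have h2 : (j + 1) * L ≤ q * L := Nat.mul_le_mul_right L h1
    have h3 := hp.2
    simp only at h3 ⊢
    rw [add_mul] at h2
    omega
  have hsub : ((J ×ˢ Finset.range (L - 2)).attach.image fun p =>
      l[p.1.1 * L + (p.1.2 + 1)]'(by have := hb p.1 p.2; omega)) \ W ⊆ segInterior l L J W := by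
    intro w hw
    rw [Finset.mem_sdiff, Finset.mem_image] at hw
    obtain ⟨⟨⟨⟨j, i⟩, hp⟩, -, rfl⟩, hW⟩ := hw
    rw [segInterior, Finset.mem_filter]
    have hp' := Finset.mem_product.1 hp
    refine ⟨Finset.mem_univ _, hW, j, hp'.1, _, _, triple_infix_seg (i := i) ?_ (hb _ hp)⟩
    have := Finset.mem_range.1 hp'.2
    simp only at this
    omega
  have h1 := Finset.card_le_card hsub
  have h2 := Finset.le_card_sdiff W ((J ×ˢ Finset.range (L - 2)).attach.image fun p =>
      l[p.1.1 * L + (p.1.2 + 1)]'(by have := hb p.1 p.2; omega))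
  rw [Finset.card_image_of_injective, Finset.card_attach, Finset.card_product,
    Finset.card_range] at h2
  · omega
  · rintro ⟨⟨j, i⟩, hp⟩ ⟨⟨j', i'⟩, hp'⟩ h
    have h3 := hb _ hp
    have h4 := hb _ hp'
    have hi := Finset.mem_range.1 (Finset.mem_product.1 hp).2
    have hi' := Finset.mem_range.1 (Finset.mem_product.1 hp').2
    simp only at h h3 h4 hi hi'
    have hm : l[j * L + (i + 1)] ∈ seg l L j := mem_seg_iff.2 ⟨i + 1, by omega, by omega, rfl⟩
    have hm' : l[j' * L + (i' + 1)] ∈ seg l L j' := mem_seg_iff.2 ⟨i' + 1, by omega, by omega, rfl⟩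
    have hj := seg_index_unique hl hm (h ▸ hm')
    subst hj
    have := hl.getElem_inj_iff.1 h
    simp only [Subtype.mk.injEq, Prod.mk.injEq, true_and]
    omega

end Segments

section Counting

theorem choose_le_four_pow_mul {ρ k : ℕ} (hk : k ≤ ρ) :
    (8 * ρ).choose k ≤ 4 ^ k * (3 * ρ).choose k := by
  have h1 : (8 * ρ).descFactorial k ≤ (8 * ρ) ^ k := Nat.descFactorial_le_pow _ _
  have h2 : (3 * ρ + 1 - k) ^ k ≤ (3 * ρ).descFactorial k := Nat.pow_sub_le_descFactorial _ _
  have h3 : (2 * ρ) ^ k ≤ (3 * ρ + 1 - k) ^ k := Nat.pow_le_pow_left (by omega) k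
  have h4 : (8 * ρ) ^ k = 4 ^ k * (2 * ρ) ^ k := by rw [← mul_pow]; ring_nf
  rw [Nat.descFactorial_eq_factorial_mul_choose] at h1 h2
  have h5 := Nat.factorial_pos k
  refine Nat.le_of_mul_le_mul_left ?_ h5
  calc _ ≤ _ := h1
    _ = _ := h4
    _ ≤ 4 ^ k * (k.factorial * (3 * ρ).choose k) := Nat.mul_le_mul_left _ (h3.trans h2)
    _ = _ := by ring

open Classical in
/-- Averaging over pairs of `k`-subsets. -/
theorem exists_common_subsets {α : Type*} (X : Finset α) {ρ k : ℕ} (hk : k ≤ ρ)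
    (U1 U2 : α → Finset ℕ)
    (h1 : ∀ p ∈ X, U1 p ⊆ Finset.range (8 * ρ) ∧ 3 * ρ ≤ (U1 p).card)
    (h2 : ∀ p ∈ X, U2 p ⊆ Finset.range (8 * ρ) ∧ 3 * ρ ≤ (U2 p).card) :
    ∃ J1 J2 : Finset ℕ, J1 ⊆ Finset.range (8 * ρ) ∧ J2 ⊆ Finset.range (8 * ρ) ∧
      J1.card = k ∧ J2.card = k ∧
      X.card ≤ 16 ^ k * (X.filter fun p => J1 ⊆ U1 p ∧ J2 ⊆ U2 p).card := by
  set Ω := Finset.powersetCard k (Finset.range (8 * ρ)) with hΩ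
  have hc : Ω.card = (8 * ρ).choose k := by rw [hΩ, Finset.card_powersetCard, Finset.card_range]
  have hpos : 0 < (8 * ρ).choose k := Nat.choose_pos (by omega)
  have hne : (Ω ×ˢ Ω).Nonempty := by
    rw [← Finset.card_pos, Finset.card_product, hc]
    positivity
  have hdeg : ∀ p ∈ X, (3 * ρ).choose k ^ 2 ≤
      ((Ω ×ˢ Ω).filter fun J => J.1 ⊆ U1 p ∧ J.2 ⊆ U2 p).card := by
    intro p hp
    have hsub : Finset.powersetCard k (U1 p) ×ˢ Finset.powersetCard k (U2 p) ⊆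
        (Ω ×ˢ Ω).filter fun J => J.1 ⊆ U1 p ∧ J.2 ⊆ U2 p := by
      rintro ⟨a, b⟩ hab
      rw [Finset.mem_product, Finset.mem_powersetCard, Finset.mem_powersetCard] at hab
      rw [Finset.mem_filter, Finset.mem_product, hΩ, Finset.mem_powersetCard,
        Finset.mem_powersetCard]
      exact ⟨⟨⟨hab.1.1.trans (h1 p hp).1, hab.1.2⟩, ⟨hab.2.1.trans (h2 p hp).1, hab.2.2⟩⟩,
        hab.1.1, hab.2.1⟩
    refine le_trans ?_ (Finset.card_le_card hsub)
    rw [Finset.card_product, Finset.card_powersetCard, Finset.card_powersetCard, sq]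
    exact Nat.mul_le_mul (Nat.choose_le_choose k (h1 p hp).2) (Nat.choose_le_choose k (h2 p hp).2)
  have hswap : ∑ p ∈ X, ((Ω ×ˢ Ω).filter fun J => J.1 ⊆ U1 p ∧ J.2 ⊆ U2 p).card =
      ∑ J ∈ Ω ×ˢ Ω, (X.filter fun p => J.1 ⊆ U1 p ∧ J.2 ⊆ U2 p).card :=
    Finset.sum_card_bipartiteAbove_eq_sum_card_bipartiteBelow
      (fun p (J : Finset ℕ × Finset ℕ) => J.1 ⊆ U1 p ∧ J.2 ⊆ U2 p)
  have hsum : X.card * (3 * ρ).choose k ^ 2 ≤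
      ∑ J ∈ Ω ×ˢ Ω, (X.filter fun p => J.1 ⊆ U1 p ∧ J.2 ⊆ U2 p).card := by
    rw [← hswap, ← smul_eq_mul, ← Finset.sum_const]
    exact Finset.sum_le_sum hdeg
  by_contra! hcon
  have hlt : ∑ J ∈ Ω ×ˢ Ω, 16 ^ k * (X.filter fun p => J.1 ⊆ U1 p ∧ J.2 ⊆ U2 p).card <
      ∑ J ∈ Ω ×ˢ Ω, X.card := by
    refine Finset.sum_lt_sum_of_nonempty hne ?_
    rintro ⟨a, b⟩ hab
    rw [Finset.mem_product, hΩ, Finset.mem_powersetCard, Finset.mem_powersetCard] at hab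
    exact hcon a b hab.1.1 hab.2.1 hab.1.2 hab.2.2
  rw [← Finset.mul_sum, Finset.sum_const, smul_eq_mul, Finset.card_product, hc] at hlt
  have h3 : (8 * ρ).choose k * (8 * ρ).choose k ≤ 16 ^ k * (3 * ρ).choose k ^ 2 := by
    calc _ ≤ (4 ^ k * (3 * ρ).choose k) * (4 ^ k * (3 * ρ).choose k) :=
          Nat.mul_le_mul (choose_le_four_pow_mul hk) (choose_le_four_pow_mul hk)
      _ = (4 * 4) ^ k * (3 * ρ).choose k ^ 2 := by rw [mul_pow]; ring
      _ = _ := by norm_num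
  have h4 := Nat.mul_le_mul_left (16 ^ k) hsum
  have h5 := Nat.mul_le_mul_right X.card h3
  nlinarith

open Classical in
/-- A dense relation has many elements of large degree. -/
theorem exists_many_large_degree {V : Type} [Fintype V] (R : V → V → Prop) {D : ℕ}
    (h : 2 * Fintype.card V ^ 2 ≤ D * (Finset.univ.filter fun p : V × V => R p.1 p.2).card)
    (hV : 0 < Fintype.card V) :
    Fintype.card V ≤ D * (Finset.univ.filter fun x =>
      Fintype.card V ≤ D * (Finset.univ.filter fun y => R x y).card).card := by
  set n := Fintype.card V with hn
  have e : (Finset.univ.filter fun p : V × V => R p.1 p.2).card =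
      ∑ x, (Finset.univ.filter fun y => R x y).card := by
    simp only [Finset.card_filter, ← Finset.univ_product_univ, Finset.sum_product]
  set A := Finset.univ.filter fun x => n ≤ D * (Finset.univ.filter fun y => R x y).card with hA
  have h1 : ∀ x, D * (Finset.univ.filter fun y => R x y).card ≤
      (if x ∈ A then D * n else 0) + n := by
    intro x
    split_ifs with hx
    · have : (Finset.univ.filter fun y => R x y).card ≤ n := Finset.card_le_univ _
      nlinarith
    · rw [hA, Finset.mem_filter] at hx
      simp only [Finset.mem_univ, true_and, not_le] at hx
      omega
  have h2 := Finset.sum_le_sum fun x (_ : x ∈ Finset.univ) => h1 x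
  rw [← Finset.mul_sum, ← e, Finset.sum_add_distrib, Finset.sum_ite_mem, Finset.univ_inter,
    Finset.sum_const, Finset.sum_const, Finset.card_univ, smul_eq_mul, smul_eq_mul, ← hn] at h2
  have h3 : n * n ≤ D * A.card * n := by nlinarith
  exact Nat.le_of_mul_le_mul_right h3 hV

end Counting

section Hamilton

variable {V : Type} [Fintype V] [DecidableEq V] {G : SimpleGraph V} {l : List V} {m : ℕ}

/-- A subset all of whose small sets of path neighbours expand into it. -/
theorem IsJoined.exists_core (hJ : IsJoined G m) (hl : l.Nodup) {S : Finset V}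
    (hS : 21 * m ≤ S.card) :
    ∃ C ⊆ S, 2 * m ≤ C.card ∧ ∀ X ⊆ pathNbr l C, X.Nonempty → X.card ≤ m →
      7 * X.card < (nbr G X ∩ C).card := by
  classical
  set bad : Finset (Finset V) := Finset.univ.filter fun X =>
    X.card ≤ 2 * m ∧ (nbr G X ∩ (S \ pathNbr l X)).card ≤ 7 * X.card with hbad
  have hne : bad.Nonempty := by
    refine ⟨∅, ?_⟩
    rw [hbad, Finset.mem_filter]
    refine ⟨Finset.mem_univ _, by simp, ?_⟩
    have : nbr G (∅ : Finset V) = ∅ := by ext; simp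
    simp [this]
  obtain ⟨X, hX, hmax⟩ := bad.exists_max_image Finset.card hne
  rw [hbad, Finset.mem_filter] at hX
  obtain ⟨-, hX2, hX7⟩ := hX
  have hPX := card_pathNbr_le hl X
  have hXm : X.card < m := by
    by_contra! hcon
    have h1 := hJ.card_compl_lt hcon
    have h2 : S ⊆ (nbr G X ∩ (S \ pathNbr l X)) ∪ (pathNbr l X ∪ (X ∪
        (Finset.univ \ (X ∪ nbr G X)))) := by
      intro v hv
      simp only [Finset.mem_union, Finset.mem_inter, Finset.mem_sdiff, Finset.mem_univ, hv,
        true_and]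
      tauto
    have h3 := Finset.card_le_card h2
    have h4 := Finset.card_union_le (nbr G X ∩ (S \ pathNbr l X)) (pathNbr l X ∪ (X ∪
        (Finset.univ \ (X ∪ nbr G X))))
    have h5 := Finset.card_union_le (pathNbr l X) (X ∪ (Finset.univ \ (X ∪ nbr G X)))
    have h6 := Finset.card_union_le X (Finset.univ \ (X ∪ nbr G X))
    omega
  refine ⟨S \ pathNbr l X, Finset.sdiff_subset, ?_, ?_⟩
  · have := Finset.le_card_sdiff (pathNbr l X) S
    omega
  · intro Y hY hYne hYm
    by_contra! hcon
    have hd : Disjoint X Y := by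
      rw [Finset.disjoint_left]
      intro v hvX hvY
      obtain ⟨w, hw, hk⟩ := mem_pathNbr.1 (hY hvY)
      exact (Finset.mem_sdiff.1 hw).2 (mem_pathNbr.2 ⟨v, hvX, hk.pair_symm⟩)
    have hc := Finset.card_union_of_disjoint hd
    have hsub : nbr G (X ∪ Y) ∩ (S \ pathNbr l (X ∪ Y)) ⊆
        (nbr G X ∩ (S \ pathNbr l X)) ∪ (nbr G Y ∩ (S \ pathNbr l X)) := by
      rw [nbr_union, ← Finset.union_inter_distrib_right]
      exact Finset.inter_subset_inter_left
        (Finset.sdiff_subset_sdiff subset_rfl (pathNbr_mono Finset.subset_union_left))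
    have h1 := (Finset.card_le_card hsub).trans (Finset.card_union_le _ _)
    have h2 := hmax (X ∪ Y) (by
      rw [hbad, Finset.mem_filter]
      exact ⟨Finset.mem_univ _, by omega, by omega⟩)
    have h3 := hYne.card_pos
    omega

theorem HRot.head_mem {A B : Set V} {t : ℕ} {l' : List V} {x y : V} (h : HRot G A B t l l')
    (hx : l.head? = some x) (hy : l'.head? = some y) : y = x ∨ y ∈ B := by
  cases h with
  | refl => exact Or.inl (Option.some.inj (hy.symm.trans hx))
  | step _ _ _ _ hB =>
    simp only [List.cons_append, List.head?_cons, Option.some.injEq] at hy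
    exact Or.inr (hy ▸ hB)

theorem HRot.mono {A B B' : Set V} {t : ℕ} {l' : List V} (h : HRot G A B t l l') (hB : B ⊆ B') :
    HRot G A B' t l l' := by
  induction h with
  | refl l => exact HRot.refl l
  | step _ hx hxw hw hy ih => exact HRot.step ih hx hxw hw (hB hy)

/-- If small subsets of `E` expand into `C`, where `E` contains the path neighbours of `C`,
then rotations with pivots in `C` produce many heads. -/
theorem exists_many_heads {Q : List V} (hQ : Q.Nodup) {x w : V} (hx : Q.head? = some x)
    {C E : Finset V} (hCQ : ∀ w ∈ C, w ∈ Q) (hCE : ∀ w ∈ C, ∀ v, Keeps [v, w] Q → v ∈ E)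
    (hexp : ∀ X ⊆ E, X.Nonempty → X.card ≤ m → 7 * X.card < (nbr G X ∩ C).card)
    (hw : w ∈ C) (hxw : G.Adj x w) :
    ∃ X : Finset V, m < X.card ∧ ∀ v ∈ X, ∃ t l', HRot G (C : Set V) Set.univ t Q l' ∧
      l'.head? = some v := by
  classical
  set B : Set V := {v | v ∈ E}
  set X : Finset V := Finset.univ.filter fun v => ∃ t, IsHead G (C : Set V) B t Q v with hX
  have hmem : ∀ v, v ∈ X ↔ ∃ t, IsHead G (C : Set V) B t Q v := by simp [hX]
  have hXE : X ⊆ insert x (X ∩ E) := by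
    intro v hv
    obtain ⟨t, s, -, l', hr, hv'⟩ := (hmem v).1 hv
    rw [Finset.mem_insert, Finset.mem_inter]
    exact (hr.head_mem hx hv').imp id fun h => ⟨hv, h⟩
  have hnb : ∀ y ∈ X, ∀ w ∈ C, G.Adj y w → w ∈ X ∨ ∃ v ∈ X, Keeps [v, w] Q := by
    intro y hy w hw hyw
    obtain ⟨t, ht⟩ := (hmem y).1 hy
    rcases ht.neighbor hQ hyw hw (hCQ w hw) (fun v hv => hCE w hw v hv) with h | ⟨v, h1, h2⟩
    · exact Or.inl ((hmem w).2 ⟨t, h⟩)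
    · exact Or.inr ⟨v, (hmem v).2 ⟨_, h1⟩, h2⟩
  have hxX : x ∈ X := (hmem x).2 ⟨0, 0, le_rfl, Q, HRot.refl Q, hx⟩
  have hne : (X ∩ E).Nonempty := by
    rcases hnb x hxX w hw hxw with h | ⟨v, hv, hk⟩
    · rcases Finset.mem_insert.1 (hXE h) with h' | h'
      · exact absurd h'.symm hxw.ne
      · exact ⟨w, h'⟩
    · exact ⟨v, Finset.mem_inter.2 ⟨hv, hCE w hw v hk⟩⟩
  have h1 := (Finset.card_le_card hXE).trans (Finset.card_insert_le _ _)
  have h2 := hne.card_pos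
  have h3 : nbr G (X ∩ E) ∩ C ⊆ X ∪ pathNbr Q X := by
    intro w hw
    rw [Finset.mem_inter, mem_nbr] at hw
    obtain ⟨⟨y, hy, hyw⟩, hwC⟩ := hw
    rw [Finset.mem_union, mem_pathNbr]
    exact hnb y (Finset.mem_inter.1 hy).1 w hwC hyw
  have h4 := (Finset.card_le_card h3).trans (Finset.card_union_le _ _)
  have h5 := card_pathNbr_le hQ X
  have h6 := Finset.card_le_card (Finset.inter_subset_left (s₁ := X) (s₂ := E))
  refine ⟨X, ?_, ?_⟩
  · by_contra! hcon
    have := hexp (X ∩ E) Finset.inter_subset_right hne (by omega)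
    omega
  · intro v hv
    obtain ⟨t, s, -, l', hr, hv'⟩ := (hmem v).1 hv
    exact ⟨s, l', hr.mono (Set.subset_univ B), hv'⟩

/-- A cycle through all the vertices which contains `sp` as a block. -/
structure IsSpanningCycle (G : SimpleGraph V) (sp l : List V) : Prop extends IsGood G sp l where
  mem : ∀ v, v ∈ l
  closed : ∃ x y, l.head? = some x ∧ l.getLast? = some y ∧ G.Adj y x

theorem IsLongest.isSpanningCycle {sp : List V} (hl : IsLongest G sp l)
    (hE : ∀ S : Finset V, S.card ≤ m → 6 * S.card ≤ (nbr G S \ sp.toFinset).card)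
    (hc : (Finset.univ \ l.toFinset).card ≤ m) {x y : V} (hx : l.head? = some x)
    (hy : l.getLast? = some y) (hyx : G.Adj y x) : IsSpanningCycle G sp l := by
  refine ⟨hl.toIsGood, ?_, x, y, hx, hy, hyx⟩
  by_contra! hcon
  obtain ⟨v, hv⟩ := hcon
  set O := Finset.univ \ l.toFinset with hO
  have hvO : v ∈ O := by simp [hO, hv]
  have h1 := hE O hc
  have h2 : 0 < O.card := Finset.card_pos.2 ⟨v, hvO⟩
  obtain ⟨u, hu, huO⟩ : ∃ u ∈ nbr G O \ sp.toFinset, u ∉ O := by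
    by_contra! h
    have := Finset.card_le_card h
    omega
  rw [Finset.mem_sdiff, mem_nbr, List.mem_toFinset] at hu
  obtain ⟨⟨z, hz, hzu⟩, husp⟩ := hu
  have hul : u ∈ l := by simpa [hO] using huO
  have hzl : z ∉ l := by simpa [hO] using hz
  obtain ⟨l1, l2, rfl⟩ := List.append_of_mem hul
  have hperm : (z :: (u :: l2 ++ l1)).Perm (z :: (l1 ++ u :: l2)) :=
    List.Perm.cons z List.perm_append_comm
  have hg : IsGood G sp (z :: (u :: l2 ++ l1)) := by
    refine ⟨?_, hperm.nodup_iff.2 (List.nodup_cons.2 ⟨hzl, hl.nodup⟩), ?_⟩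
    · have hch := List.isChain_append.1 hl.isChain
      refine List.isChain_cons.2 ⟨by simpa using hzu, ?_⟩
      refine List.isChain_append.2 ⟨hch.2.1, hch.1, ?_⟩
      intro a ha b hb
      have ha' : a = y := by
        rw [List.getLast?_append_of_ne_nil _ (by simp)] at hy
        exact Option.some.inj ((Option.mem_def.1 ha).symm.trans hy)
      have hb' : b = x := by
        cases l1 with
        | nil => simp at hb
        | cons c l1 =>
          simp only [List.cons_append, List.head?_cons, Option.some.injEq, Option.mem_def] at hb hx
          rw [← hb, ← hx]
      rw [ha', hb']
      exact hyx
    · rcases hl.keeps.or_of_notMem husp with h | h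
      · exact h.append_left (z :: u :: l2)
      · exact (h.append_left [z, u]).append_right l1
  have := hl.le _ hg
  rw [hperm.length_eq] at this
  simp at this

/-- Data on a pair of endpoints `x`, `y`: a rearrangement of the path `P` into a path
`Q1 ++ Q2` from `x` to `y` which keeps the given blocks. -/
def SplitsAt (G : SimpleGraph V) (sp P : List V) (L : ℕ) (J1 J2 : Finset ℕ) (x y : V) : Prop :=
  ∃ Q1 Q2, IsGood G sp (Q1 ++ Q2) ∧ (Q1 ++ Q2).Perm P ∧ (Q1 ++ Q2).head? = some x ∧
    (Q1 ++ Q2).getLast? = some y ∧ (∀ j ∈ J1, Keeps (seg P L j) Q1) ∧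
    ∀ j ∈ J2, Keeps (seg P L j) Q2

theorem keeps_pair_of_mem_segInterior {P Q : List V} (hQ : Q.Nodup) {L : ℕ}
    {J : Finset ℕ} {W : Finset V} (hJ : ∀ j ∈ J, Keeps (seg P L j) Q) {w : V}
    (hw : w ∈ segInterior P L J W) : w ∈ Q ∧ ∀ v, Keeps [v, w] Q → Keeps [v, w] P := by
  rw [segInterior, Finset.mem_filter] at hw
  obtain ⟨-, -, j, hj, u, v, h⟩ := hw
  exact ⟨(hJ j hj).subset (h.subset (by simp)), fun a ha =>
    (keeps_pair_of_keeps hQ (hJ j hj) h ha).of_isInfix (seg_isInfix P L j)⟩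

theorem IsLongest.exists_spanningCycle_of_splits {sp P : List V} (hP : IsLongest G sp P)
    (hE : ∀ S : Finset V, S.card ≤ m → 6 * S.card ≤ (nbr G S \ sp.toFinset).card)
    (hJn : IsJoined G m) (hc : (Finset.univ \ P.toFinset).card ≤ m) {L : ℕ} {J1 J2 : Finset ℕ}
    (h1 : 21 * m ≤ (segInterior P L J1 sp.toFinset).card)
    (h2 : 21 * m ≤ (segInterior P L J2 sp.toFinset).card)
    {A : Finset V} (hA : m ≤ A.card)
    (hAB : ∀ x ∈ A, ∃ B : Finset V, m ≤ B.card ∧ ∀ y ∈ B, SplitsAt G sp P L J1 J2 x y) :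
    ∃ l, IsSpanningCycle G sp l := by
  obtain ⟨C1, hC1, hC1c, hexp1⟩ := hJn.exists_core hP.nodup h1
  obtain ⟨C2, hC2, hC2c, hexp2⟩ := hJn.exists_core hP.nodup h2
  obtain ⟨x, hx, w1, hw1, hxw1⟩ := hJn.exists_adj hA hC1c
  obtain ⟨B, hB, hBs⟩ := hAB x hx
  obtain ⟨y, hy, w2, hw2, hyw2⟩ := hJn.exists_adj hB hC2c
  obtain ⟨Q1, Q2, hgood, hperm, hhead, hlast, hk1, hk2⟩ := hBs y hy
  have hnd := List.nodup_append.1 hgood.nodup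
  have e1 := fun w (hw : w ∈ C1) => keeps_pair_of_mem_segInterior hnd.1 hk1 (hC1 hw)
  have e2 := fun w (hw : w ∈ C2) => keeps_pair_of_mem_segInterior hnd.2.1 hk2 (hC2 hw)
  have hQ1 : Q1 ≠ [] := List.ne_nil_of_mem (e1 w1 hw1).1
  have hQ2 : Q2 ≠ [] := List.ne_nil_of_mem (e2 w2 hw2).1
  rw [List.head?_append_of_ne_nil _ hQ1] at hhead
  rw [List.getLast?_append_of_ne_nil _ hQ2] at hlast
  have hsp1 : ∀ v ∈ sp, v ∉ (C1 : Set V) := fun v hv hvC => by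
    have := Finset.mem_filter.1 (hC1 (Finset.mem_coe.1 hvC))
    exact this.2.1 (List.mem_toFinset.2 hv)
  have hsp2 : ∀ v ∈ sp, v ∉ (C2 : Set V) := fun v hv hvC => by
    have := Finset.mem_filter.1 (hC2 (Finset.mem_coe.1 hvC))
    exact this.2.1 (List.mem_toFinset.2 hv)
  obtain ⟨X, hX, hXr⟩ := exists_many_heads (m := m) hnd.1 hhead (fun w hw => (e1 w hw).1)
    (E := pathNbr P C1)
    (fun w hw v hv => mem_pathNbr.2 ⟨w, hw, ((e1 w hw).2 v hv).pair_symm⟩) hexp1 hw1 hxw1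
  obtain ⟨Y, hY, hYr⟩ := exists_many_heads (m := m) (List.nodup_reverse.2 hnd.2.1)
    (x := y) (by rw [List.head?_reverse, hlast])
    (fun w hw => List.mem_reverse.2 (e2 w hw).1) (E := pathNbr P C2)
    (fun w hw v hv => mem_pathNbr.2 ⟨w, hw, ((e2 w hw).2 v (keeps_reverse.1 hv)).pair_symm⟩)
    hexp2 hw2 hyw2
  have hXY : Disjoint X Y := by
    rw [Finset.disjoint_left]
    intro v hvX hvY
    obtain ⟨t, l1, hr1, hv1⟩ := hXr v hvX
    obtain ⟨s, l2, hr2, hv2⟩ := hYr v hvY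
    have m1 := hr1.perm.mem_iff.1 (List.mem_of_mem_head? hv1)
    have m2 := hr2.perm.mem_iff.1 (List.mem_of_mem_head? hv2)
    exact hnd.2.2 v m1 v (List.mem_reverse.1 m2) rfl
  obtain ⟨x', hx', y', hy', hadj⟩ := hJn X Y hXY hX.le hY.le
  obtain ⟨t, Q1', hr1, hv1⟩ := hXr x' hx'
  obtain ⟨s, Q2', hr2, hv2⟩ := hYr y' hy'
  have g1 := (hr1.append Q2).isGood hsp1 hgood
  have g2 := g1.reverse
  rw [List.reverse_append] at g2
  have g3 := ((hr2.append Q1'.reverse).isGood hsp2 g2).reverse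
  rw [List.reverse_append, List.reverse_reverse] at g3
  have hp : (Q1' ++ Q2'.reverse).Perm P := by
    refine List.Perm.trans ?_ hperm
    exact hr1.perm.append ((List.reverse_perm _).trans (hr2.perm.trans (List.reverse_perm _)))
  have hlong := g3.isLongest hP hp.length_eq.ge
  refine ⟨_, hlong.isSpanningCycle hE ?_ (x := x') (y := y') ?_ ?_ hadj.symm⟩
  · rwa [List.toFinset_eq_of_perm _ _ hp]
  · rw [List.head?_append, hv1]; rfl
  · rw [List.getLast?_append, List.getLast?_reverse, hv2]; rfl

/-- A path contained in a sufficiently expanding graph extends to a Hamilton cycle. -/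
theorem exists_spanningCycle {sp : List V} (hsp : sp.IsChain G.Adj) (hspn : sp.Nodup)
    (hspm : sp.length ≤ m) (hm : 1 ≤ m)
    (hE : ∀ S : Finset V, S.card ≤ m → 6 * S.card ≤ (nbr G S \ sp.toFinset).card)
    (hJn : IsJoined G m) {T k L : ℕ} (hT : m ≤ 2 ^ T) (hk : k ≤ 2 * (T + 1))
    (hL : 16 * (T + 1) * L + m ≤ Fintype.card V) (hkL : 22 * m ≤ k * (L - 2))
    (h16 : 32 * 16 ^ k * m ≤ Fintype.card V) (h12 : 12 * m ≤ Fintype.card V) :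
    ∃ l, IsSpanningCycle G sp l := by
  classical
  obtain ⟨P, hP⟩ := exists_isLongest ⟨hsp, hspn, Or.inl (List.infix_refl sp)⟩
  have hne : P ≠ [] := by
    rintro rfl
    obtain ⟨v⟩ : Nonempty V := Fintype.card_pos_iff.1 (by omega)
    have hv : IsGood G sp [v] := by
      refine ⟨List.isChain_singleton v, List.nodup_singleton v, ?_⟩
      exact hP.keeps.append_right [v]
    simpa using hP.le _ hv
  have hc := hP.card_compl_lt hne hT hE hJn
  have hlen : Fintype.card V ≤ P.length + m := by
    have h1 := Finset.card_sdiff_add_card_eq_card (Finset.subset_univ P.toFinset)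
    rw [Finset.card_univ] at h1
    have := List.toFinset_card_le P
    omega
  have hlenL : 8 * (2 * (T + 1)) * L ≤ P.length := by
    have : 8 * (2 * (T + 1)) * L = 16 * (T + 1) * L := by ring
    omega
  have hL1 : 1 ≤ L := by
    by_contra! h0
    obtain rfl : L = 0 := by omega
    simp only [Nat.zero_sub, mul_zero] at hkL
    omega
  obtain ⟨X, hX, hXp⟩ := hP.exists_pairs hne hT hE hJn hspm h12
  have hsplit : ∀ p ∈ X, ∃ U : Finset ℕ × Finset ℕ,
      (U.1 ⊆ Finset.range (8 * (2 * (T + 1))) ∧ 3 * (2 * (T + 1)) ≤ U.1.card) ∧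
      (U.2 ⊆ Finset.range (8 * (2 * (T + 1))) ∧ 3 * (2 * (T + 1)) ≤ U.2.card) ∧
      SplitsAt G sp P L U.1 U.2 p.1 p.2 := by
    intro p hp
    obtain ⟨l', hg, hperm, hh, hlast, D, hD, hDI⟩ := hXp p hp
    obtain ⟨Q1, Q2, rfl, hQ1, hQ2⟩ := exists_split hP.nodup (by omega) hL1 hlenL hD hDI
    exact ⟨(_, _), ⟨Finset.filter_subset _ _, hQ1⟩, ⟨Finset.filter_subset _ _, hQ2⟩,
      Q1, Q2, hg, hperm, hh, hlast, fun j hj => (Finset.mem_filter.1 hj).2,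
      fun j hj => (Finset.mem_filter.1 hj).2⟩
  choose! U hU1 hU2 hUs using hsplit
  obtain ⟨J1, J2, hJ1, hJ2, hc1, hc2, hcard⟩ := exists_common_subsets X hk
    (fun p => (U p).1) (fun p => (U p).2) hU1 hU2
  have hdense : 2 * Fintype.card V ^ 2 ≤ 32 * 16 ^ k *
      (Finset.univ.filter fun p : V × V => SplitsAt G sp P L J1 J2 p.1 p.2).card := by
    have hsub : (X.filter fun p => J1 ⊆ (U p).1 ∧ J2 ⊆ (U p).2) ⊆
        Finset.univ.filter fun p : V × V => SplitsAt G sp P L J1 J2 p.1 p.2 := by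
      intro p hp
      rw [Finset.mem_filter] at hp ⊢
      obtain ⟨Q1, Q2, hg, hperm, hh, hlast, hk1, hk2⟩ := hUs p hp.1
      exact ⟨Finset.mem_univ _, Q1, Q2, hg, hperm, hh, hlast, fun j hj => hk1 j (hp.2.1 hj),
        fun j hj => hk2 j (hp.2.2 hj)⟩
    have := Nat.mul_le_mul_left (16 ^ k) (Finset.card_le_card hsub)
    nlinarith
  have hmany := exists_many_large_degree (SplitsAt G sp P L J1 J2) hdense (by omega)
  have hpos : 0 < 32 * 16 ^ k := by positivity
  have hint : ∀ J ⊆ Finset.range (8 * (2 * (T + 1))), J.card = k →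
      21 * m ≤ (segInterior P L J sp.toFinset).card := by
    intro J hJ hJc
    have h1 := card_segInterior hP.nodup hJ hlenL sp.toFinset
    have h2 := List.toFinset_card_le sp
    rw [hJc] at h1
    omega
  refine hP.exists_spanningCycle_of_splits hE hJn hc.le (hint J1 hJ1 hc1) (hint J2 hJ2 hc2)
    (Nat.le_of_mul_le_mul_left (h16.trans hmany) hpos) ?_
  intro x hx
  rw [Finset.mem_filter] at hx
  refine ⟨_, Nat.le_of_mul_le_mul_left (h16.trans hx.2) hpos, ?_⟩
  intro y hy
  exact (Finset.mem_filter.1 hy).2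

end Hamilton

section Weights

variable {V : Type} {G : SimpleGraph V}

/-- The sum of `w` over consecutive pairs of a list. -/
def wt (w : V → V → ZMod 2) : List V → ZMod 2
  | [] => 0
  | [_] => 0
  | a :: b :: l => w a b + wt w (b :: l)

variable {w : V → V → ZMod 2}

@[simp] theorem wt_nil : wt w [] = 0 := rfl

@[simp] theorem wt_singleton (a : V) : wt w [a] = 0 := rfl

@[simp] theorem wt_cons_cons (a b : V) (l : List V) :
    wt w (a :: b :: l) = w a b + wt w (b :: l) := rfl

theorem wt_append_cons (l1 l2 : List V) (a : V) :
    wt w (l1 ++ a :: l2) = wt w (l1 ++ [a]) + wt w (a :: l2) := by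
  induction l1 with
  | nil => simp
  | cons b l1 ih =>
    cases l1 with
    | nil => simp
    | cons c l1 =>
      simp only [List.cons_append, wt_cons_cons] at ih ⊢
      rw [ih, add_assoc]

theorem wt_reverse (hw : ∀ a b, w a b = w b a) (l : List V) : wt w l.reverse = wt w l := by
  induction l with
  | nil => simp
  | cons a l ih =>
    cases l with
    | nil => simp
    | cons b l =>
      rw [List.reverse_cons, List.reverse_cons] at *
      rw [List.append_assoc, List.singleton_append, wt_append_cons, ih]
      simp [hw a b, add_comm]

theorem wt_add_const (c : ZMod 2) (a : V) (l : List V) :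
    wt (fun x y => w x y + c) (a :: l) = wt w (a :: l) + l.length * c := by
  induction l generalizing a with
  | nil => simp
  | cons b l ih =>
    rw [wt_cons_cons, ih, wt_cons_cons, List.length_cons]
    push_cast
    ring

theorem isChain_append_cons {R : V → V → Prop} {l1 l2 : List V} {a : V} :
    (l1 ++ a :: l2).IsChain R ↔ (l1 ++ [a]).IsChain R ∧ (a :: l2).IsChain R :=
  List.isChain_split

/-- The closed walk through `a :: t` has weight `cw w a t`. -/
def cw (w : V → V → ZMod 2) (a : V) (t : List V) : ZMod 2 := wt w (a :: (t ++ [a]))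

/-- The list `a :: t` is traversed by a closed walk. -/
def IsClo (G : SimpleGraph V) (a : V) (t : List V) : Prop := (a :: (t ++ [a])).IsChain G.Adj

/-- The list `a :: t` is traversed by a cycle. -/
structure IsCyc (G : SimpleGraph V) (a : V) (t : List V) : Prop where
  clo : IsClo G a t
  nodup : (a :: t).Nodup
  two_le : 2 ≤ t.length

theorem IsClo.extract (hw : ∀ a b, w a b = w b a) {a : V} {t : List V} (h : IsClo G a t)
    (hne : cw w a t ≠ 0) : ∃ b s, IsCyc G b s ∧ cw w b s ≠ 0 ∧ s.length ≤ t.length ∧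
      b :: s ⊆ a :: t := by
  induction hk : t.length using Nat.strong_induction_on generalizing a t with
  | _ k ih =>
  subst hk
  by_cases hnd : (a :: t).Nodup
  · refine ⟨a, t, ⟨h, hnd, ?_⟩, hne, le_rfl, List.Subset.refl _⟩
    by_contra! hlt
    match t, h, hne, hlt with
    | [], h, _, _ => simp [IsClo] at h
    | [b], _, hne, _ =>
      apply hne
      simp [cw, hw b a, CharTwo.add_self_eq_zero]
  · obtain ⟨v, hv⟩ : ∃ v, List.Duplicate v (a :: t) := by
      by_contra! hcon
      exact hnd (List.nodup_iff_forall_not_duplicate.2 hcon)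
    rw [List.duplicate_iff_sublist] at hv
    obtain ⟨A, C', e, hC'⟩ : ∃ A C', a :: t = A ++ v :: C' ∧ v ∈ C' := by
      obtain ⟨r1, r2, e, h1, h2⟩ := List.cons_sublist_iff.1 hv
      obtain ⟨A, B, rfl⟩ := List.append_of_mem h1
      exact ⟨A, B ++ r2, by simp [e], List.mem_append_right _ (List.singleton_sublist.1 h2)⟩
    obtain ⟨B, C, rfl⟩ := List.append_of_mem hC'
    have e' : a :: (t ++ [a]) = A ++ v :: (B ++ v :: (C ++ [a])) := by
      rw [← List.cons_append, e]; simp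
    have hlen : t.length + 1 = A.length + B.length + C.length + 2 := by
      have := congrArg List.length e
      simp at this
      omega
    have hsub : A ++ v :: B ++ v :: C ⊆ a :: t := by rw [e]; simp
    have hch : IsClo G a t := h
    rw [IsClo, e', isChain_append_cons] at hch
    obtain ⟨hc1, hc2⟩ := hch
    rw [← List.cons_append, isChain_append_cons] at hc2
    obtain ⟨hc2, hc3⟩ := hc2
    have hwt : cw w a t = wt w (A ++ [v]) + cw w v B + wt w (v :: (C ++ [a])) := by
      rw [cw, e', wt_append_cons, ← List.cons_append, wt_append_cons (v :: B), cw, add_assoc]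
      rfl
    by_cases hB : cw w v B = 0
    · rw [hB, add_zero] at hwt
      cases A with
      | nil =>
        simp only [List.nil_append, List.cons.injEq] at e
        obtain ⟨rfl, e⟩ := e
        simp only [List.nil_append, wt_singleton, zero_add] at hwt
        have hne' : cw w a C ≠ 0 := fun h0 => hne (hwt.trans h0)
        simp only [List.length_nil] at hlen
        obtain ⟨b, s, hb, hbs, hs, hsub'⟩ := ih C.length (by omega) (a := a) (t := C) hc3 hne' rfl
        refine ⟨b, s, hb, hbs, by omega, fun x hx => hsub ?_⟩
        have := hsub' hx
        simp only [List.mem_append, List.mem_cons] at this ⊢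
        tauto
      | cons a' A =>
        simp only [List.cons_append, List.cons.injEq] at e
        obtain ⟨rfl, e⟩ := e
        have hne' : cw w a (A ++ v :: C) ≠ 0 := by
          intro h0
          apply hne
          have e2 : cw w a (A ++ v :: C) = wt w ((a :: A) ++ v :: (C ++ [a])) := by simp [cw]
          rw [hwt, ← h0, e2, wt_append_cons (a :: A) (C ++ [a]) v]
        have hc : IsClo G a (A ++ v :: C) := by
          rw [IsClo, List.append_assoc, List.cons_append, ← List.cons_append, isChain_append_cons]
          exact ⟨hc1, hc3⟩
        simp only [List.length_cons] at hlen
        obtain ⟨b, s, hb, hbs, hs, hsub'⟩ := ih (A ++ v :: C).length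
          (by simp; omega) hc hne' rfl
        refine ⟨b, s, hb, hbs, ?_, fun x hx => hsub ?_⟩
        · simp only [List.length_append, List.length_cons] at hs
          omega
        · have := hsub' hx
          simp only [List.cons_append, List.mem_append, List.mem_cons] at this ⊢
          tauto
    · obtain ⟨b, s, hb, hbs, hs, hsub'⟩ := ih B.length (by omega) (a := v) (t := B) hc2 hB rfl
      refine ⟨b, s, hb, hbs, by omega, fun x hx => hsub ?_⟩
      have := hsub' hx
      simp only [List.mem_append, List.mem_cons] at this ⊢
      tauto

theorem IsCyc.rotate {a v : V} {t : List V} (h : IsCyc G a t) (hv : v ∈ a :: t) :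
    ∃ s, IsCyc G v s ∧ cw w v s = cw w a t ∧ (v :: s).Perm (a :: t) := by
  obtain ⟨A, B, e⟩ := List.append_of_mem hv
  cases A with
  | nil =>
    simp only [List.nil_append, List.cons.injEq] at e
    obtain ⟨rfl, rfl⟩ := e
    exact ⟨t, h, rfl, List.Perm.refl _⟩
  | cons a' A =>
    simp only [List.cons_append, List.cons.injEq] at e
    obtain ⟨rfl, rfl⟩ := e
    have hp : (v :: (B ++ a :: A)).Perm (a :: (A ++ v :: B)) := by
      have := List.perm_append_comm (l₁ := v :: B) (l₂ := a :: A)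
      simpa using this
    have hclo := h.clo
    rw [IsClo, List.append_assoc, List.cons_append, ← List.cons_append,
      isChain_append_cons] at hclo
    refine ⟨B ++ a :: A, ⟨?_, hp.nodup_iff.2 h.nodup, ?_⟩, ?_, hp⟩
    · rw [IsClo, List.append_assoc, List.cons_append, ← List.cons_append, isChain_append_cons]
      exact ⟨hclo.2, hclo.1⟩
    · have h1 := hp.length_eq
      have h2 := h.two_le
      simp only [List.length_cons] at h1
      omega
    · have e1 : cw w v (B ++ a :: A) = wt w ((v :: B) ++ a :: (A ++ [v])) := by simp [cw]
      have e2 : cw w a (A ++ v :: B) = wt w ((a :: A) ++ v :: (B ++ [a])) := by simp [cw]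
      rw [e1, e2, wt_append_cons, wt_append_cons (a :: A), add_comm]
      rfl

theorem wt_eq_of_potential {s : V → ZMod 2} (hs : ∀ u v, G.Adj u v → w u v = s u + s v)
    {a z : V} {l : List V} (h : (a :: (l ++ [z])).IsChain G.Adj) :
    wt w (a :: (l ++ [z])) = s a + s z := by
  induction l generalizing a with
  | nil => simp_all
  | cons b l ih =>
    simp only [List.cons_append, List.isChain_cons_cons] at h
    rw [List.cons_append, wt_cons_cons, ih h.2, hs a b h.1]
    have := CharTwo.add_self_eq_zero (s b)
    linear_combination this

end Weights

section Potential

variable {V : Type} [Fintype V] [DecidableEq V] {G : SimpleGraph V} {w : V → V → ZMod 2}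

/-- Disjoint small sets are joined by short paths avoiding any given small set. -/
def HasConnections (G : SimpleGraph V) (a T : ℕ) : Prop :=
  ∀ A B D : Finset V, A.Nonempty → B.Nonempty → Disjoint A B → A.card + B.card + D.card ≤ a →
    ∃ x ∈ A, ∃ y ∈ B, ∃ l : List V, (∀ v ∈ l, v ∉ A ∧ v ∉ B ∧ v ∉ D) ∧ l.length ≤ 2 * T ∧
      (x :: (l ++ [y])).IsChain G.Adj ∧ l.Nodup

/-- There are short odd cycles avoiding any given small set. -/
def HasOddCycles (G : SimpleGraph V) (a T : ℕ) : Prop :=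
  ∀ D : Finset V, D.card ≤ a → ∃ x t, IsCyc G x t ∧ Even t.length ∧ t.length + 1 ≤ 4 * T + 4 ∧
    ∀ v ∈ x :: t, v ∉ D

/-- Every short even cycle has weight zero. -/
def NoEvenNegative (G : SimpleGraph V) (w : V → V → ZMod 2) (ℓ : ℕ) : Prop :=
  ∀ x t, IsCyc G x t → Odd t.length → t.length + 1 ≤ ℓ → cw w x t = 0

theorem reverse_chain_mid {a b : V} {l : List V} (h : (a :: (l ++ [b])).IsChain G.Adj) :
    (b :: (l.reverse ++ [a])).IsChain G.Adj := by
  have := isChain_reverse_of_isChain h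
  simpa using this

theorem wt_reverse_mid (hw : ∀ a b, w a b = w b a) (a b : V) (l : List V) :
    wt w (b :: (l.reverse ++ [a])) = wt w (a :: (l ++ [b])) := by
  have := wt_reverse hw (a :: (l ++ [b]))
  simpa using this

/-- Four paths closing up to an even cycle. -/
theorem NoEvenNegative.four_paths {ℓ : ℕ} (hN : NoEvenNegative G w ℓ) {a b c d : V}
    {k l p q : List V} (h1 : (a :: (k ++ [b])).IsChain G.Adj) (h2 : (b :: (l ++ [c])).IsChain G.Adj)
    (h3 : (c :: (p ++ [d])).IsChain G.Adj) (h4 : (d :: (q ++ [a])).IsChain G.Adj)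
    (hnd : (a :: (k ++ b :: (l ++ c :: (p ++ d :: q)))).Nodup)
    (heven : Even (k.length + l.length + p.length + q.length))
    (hlen : k.length + l.length + p.length + q.length + 4 ≤ ℓ) :
    wt w (a :: (k ++ [b])) + wt w (b :: (l ++ [c])) + wt w (c :: (p ++ [d])) +
      wt w (d :: (q ++ [a])) = 0 := by
  have e : a :: ((k ++ b :: (l ++ c :: (p ++ d :: q))) ++ [a]) =
      (a :: k) ++ b :: (l ++ c :: (p ++ d :: (q ++ [a]))) := by simp
  have hlen' : (k ++ b :: (l ++ c :: (p ++ d :: q))).length =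
      k.length + l.length + p.length + q.length + 3 := by simp; omega
  have h := hN a (k ++ b :: (l ++ c :: (p ++ d :: q))) ⟨?_, hnd, by omega⟩ ?_ (by omega)
  · rw [cw, e, wt_append_cons, ← List.cons_append, wt_append_cons (b :: l), ← List.cons_append,
      wt_append_cons (c :: p)] at h
    simp only [List.cons_append] at h
    rw [← h]
    ring
  · rw [IsClo, e, isChain_append_cons, ← List.cons_append, isChain_append_cons (l1 := b :: l),
      ← List.cons_append, isChain_append_cons (l1 := c :: p)]
    exact ⟨h1, h2, h3, h4⟩
  · rw [hlen', Nat.odd_add]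
    exact ⟨fun h => absurd heven (Nat.not_even_iff_odd.2 h), fun h => absurd h (by decide)⟩

theorem NoEvenNegative.eq_of_disjoint (hw : ∀ a b, w a b = w b a) {ℓ ℓ1 a T : ℕ}
    (hN : NoEvenNegative G w ℓ) (hconn : HasConnections G a T) (ha : 4 * ℓ1 + 4 * T ≤ a)
    (hℓ : 2 * ℓ1 + 4 * T ≤ ℓ) {x y : V} {s t : List V} (hs : IsCyc G x s) (ht : IsCyc G y t)
    (hse : Even s.length) (hte : Even t.length) (hsl : s.length + 1 ≤ ℓ1) (htl : t.length + 1 ≤ ℓ1)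
    (hd : ∀ v ∈ x :: s, v ∉ y :: t) : cw w x s = cw w y t := by
  have hd' : Disjoint (x :: s).toFinset (y :: t).toFinset := by
    rw [Finset.disjoint_left]
    intro v hv hv'
    exact hd v (List.mem_toFinset.1 hv) (List.mem_toFinset.1 hv')
  have c1 := List.toFinset_card_of_nodup hs.nodup
  have c2 := List.toFinset_card_of_nodup ht.nodup
  rw [List.length_cons] at c1 c2
  obtain ⟨a1, ha1, b1, hb1, m1, hm1, hl1, hc1, hn1⟩ := hconn (x :: s).toFinset (y :: t).toFinset ∅
    ⟨x, by simp⟩ ⟨y, by simp⟩ hd' (by simp only [Finset.card_empty]; omega)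
  rw [List.mem_toFinset] at ha1 hb1
  obtain ⟨s', hs', hws, hps⟩ := hs.rotate (w := w) ha1
  obtain ⟨t', ht', hwt, hpt⟩ := ht.rotate (w := w) hb1
  have hls := hps.length_eq
  have hlt := hpt.length_eq
  simp only [List.length_cons, add_left_inj] at hls hlt
  have c3 := List.toFinset_card_le m1
  have d1 := List.toFinset_card_of_nodup (List.nodup_cons.1 hs'.nodup).2
  have d2 := List.toFinset_card_of_nodup (List.nodup_cons.1 ht'.nodup).2
  have hsne : s'.toFinset.Nonempty := by
    rw [List.toFinset_nonempty_iff]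
    rintro rfl
    simpa using hs'.two_le
  have htne : t'.toFinset.Nonempty := by
    rw [List.toFinset_nonempty_iff]
    rintro rfl
    simpa using ht'.two_le
  have hdst : Disjoint s'.toFinset t'.toFinset := by
    rw [Finset.disjoint_left]
    intro v hv hv'
    rw [List.mem_toFinset] at hv hv'
    exact hd v (hps.mem_iff.1 (List.mem_cons_of_mem _ hv))
      (hpt.mem_iff.1 (List.mem_cons_of_mem _ hv'))
  have hcard : s'.toFinset.card + t'.toFinset.card + (insert a1 (insert b1 m1.toFinset)).card
      ≤ a := by
    have := Finset.card_insert_le a1 (insert b1 m1.toFinset)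
    have := Finset.card_insert_le b1 m1.toFinset
    omega
  obtain ⟨a2, ha2, b2, hb2, m2, hm2, hl2, hc2, hn2⟩ := hconn s'.toFinset t'.toFinset
    (insert a1 (insert b1 m1.toFinset)) hsne htne hdst hcard
  rw [List.mem_toFinset] at ha2 hb2
  obtain ⟨p, q, rfl⟩ := List.append_of_mem ha2
  obtain ⟨p', q', rfl⟩ := List.append_of_mem hb2
  have master : ((a1 :: (p ++ a2 :: q)) ++ (b1 :: (p' ++ b2 :: q')) ++ m1 ++ m2).Nodup := by
    refine List.Nodup.append (List.Nodup.append (List.Nodup.append hs'.nodup ht'.nodup ?_) hn1 ?_)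
      hn2 ?_
    · intro v hv hv'
      exact hd v (hps.mem_iff.1 hv) (hpt.mem_iff.1 hv')
    · intro v hv hv'
      have := hm1 v hv'
      rw [List.mem_toFinset, List.mem_toFinset] at this
      rcases List.mem_append.1 hv with h | h
      · exact this.1 (hps.mem_iff.1 h)
      · exact this.2.1 (hpt.mem_iff.1 h)
    · intro v hv hv'
      have := hm2 v hv'
      simp only [List.mem_toFinset, Finset.mem_insert, List.mem_append, List.mem_cons] at this hv
      tauto
  have k1 := hs'.clo
  rw [IsClo, List.append_assoc, List.cons_append, ← List.cons_append, isChain_append_cons] at k1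
  have k2 := ht'.clo
  rw [IsClo, List.append_assoc, List.cons_append, ← List.cons_append, isChain_append_cons] at k2
  have w1 : cw w x s = wt w (a1 :: (p ++ [a2])) + wt w (a2 :: (q ++ [a1])) := by
    rw [← hws, cw, List.append_assoc, List.cons_append, ← List.cons_append, wt_append_cons]
    rfl
  have w2 : cw w y t = wt w (b1 :: (p' ++ [b2])) + wt w (b2 :: (q' ++ [b1])) := by
    rw [← hwt, cw, List.append_assoc, List.cons_append, ← List.cons_append, wt_append_cons]
    rfl
  simp only [List.length_append, List.length_cons] at hls hlt
  rw [← hls] at hse hsl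
  rw [← hlt] at hte htl
  have master' : ∀ v, List.count v (a1 :: (p ++ a2 :: q) ++ (b1 :: (p' ++ b2 :: q')) ++ m1 ++ m2)
    ≤ 1 := List.nodup_iff_count_le_one.1 master
  have key : ∀ k ∈ ({p, q.reverse} : Set (List V)), ∀ k' ∈ ({p'.reverse, q'} : Set (List V)),
      (a1 :: (k ++ a2 :: (m2 ++ b2 :: (k' ++ b1 :: m1.reverse)))).Nodup := by
    intro k hk k' hk'
    rw [List.nodup_iff_count_le_one]
    intro v
    have := master' v
    simp only [List.count_append, List.count_cons] at this
    rcases hk with rfl | rfl <;> rcases hk' with rfl | rfl <;>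
      simp only [List.count_append, List.count_cons, List.count_reverse] <;> omega
  have z2 := CharTwo.two_eq_zero (R := ZMod 2)
  have r1 := wt_reverse_mid hw a1 b1 m1
  have r2 := wt_reverse_mid hw a2 a1 q
  have r3 := wt_reverse_mid hw b1 b2 p'
  rcases Nat.even_or_odd (p.length + m2.length + p'.length + m1.length) with he | ho
  · have e1 := hN.four_paths (k := p) (l := m2) (p := p'.reverse) (q := m1.reverse) k1.1 hc2
      (reverse_chain_mid k2.1) (reverse_chain_mid hc1) (key _ (by simp) _ (by simp))
      (by simpa using he) (by simp only [List.length_reverse]; omega)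
    have e2 := hN.four_paths (k := q.reverse) (l := m2) (p := q') (q := m1.reverse)
      (reverse_chain_mid k1.2) hc2 k2.2 (reverse_chain_mid hc1) (key _ (by simp) _ (by simp))
      (by clear z2; simp only [List.length_reverse]; grind) (by simp only [List.length_reverse]; omega)
    rw [w1, w2, ← sub_eq_zero]
    linear_combination e1 + e2 - r2 - r3 - (wt w (b1 :: (p' ++ [b2])) +
      wt w (b2 :: (q' ++ [b1])) + wt w (a2 :: (m2 ++ [b2])) + wt w (b1 :: (m1.reverse ++ [a1]))) * z2
  · have e1 := hN.four_paths (k := p) (l := m2) (p := q') (q := m1.reverse) k1.1 hc2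
      k2.2 (reverse_chain_mid hc1) (key _ (by simp) _ (by simp))
      (by clear z2; simp only [List.length_reverse]; grind) (by simp only [List.length_reverse]; omega)
    have e2 := hN.four_paths (k := q.reverse) (l := m2) (p := p'.reverse) (q := m1.reverse)
      (reverse_chain_mid k1.2) hc2 (reverse_chain_mid k2.1) (reverse_chain_mid hc1)
      (key _ (by simp) _ (by simp))
      (by clear z2; simp only [List.length_reverse]; grind) (by simp only [List.length_reverse]; omega)
    rw [w1, w2, ← sub_eq_zero]
    linear_combination e1 + e2 - r2 - r3 - (wt w (b1 :: (p' ++ [b2])) +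
      wt w (b2 :: (q' ++ [b1])) + wt w (a2 :: (m2 ++ [b2])) + wt w (b1 :: (m1.reverse ++ [a1]))) * z2

/-- If no short even cycle has weight one and some odd spanning cycle has weight zero, then all
cycles have weight zero. -/
theorem NoEvenNegative.cw_eq_zero (hw : ∀ a b, w a b = w b a) {ℓ a T : ℕ}
    (hN : NoEvenNegative G w ℓ) (hconn : HasConnections G a T) (hodd : HasOddCycles G a T)
    (ha : 20 * T + 16 ≤ a) (hℓ : 12 * T + 8 ≤ ℓ) {x0 : V} {t0 : List V} (h0 : IsClo G x0 t0)
    (h0e : Even t0.length) (h0w : cw w x0 t0 = 0) {y : V} {t : List V} (h : IsClo G y t) :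
    cw w y t = 0 := by
  obtain ⟨o, r, ho, hre, hrl, -⟩ := hodd ∅ (by simp)
  set c := cw w o r with hc
  have hsame : ∀ x s, IsCyc G x s → Even s.length → s.length + 1 ≤ 4 * T + 4 → cw w x s = c := by
    intro x s hs hse hsl
    have c1 := List.toFinset_card_le (x :: s)
    have c2 := List.toFinset_card_le (o :: r)
    simp only [List.length_cons] at c1 c2
    obtain ⟨z, u, hu, hue, hul, hd⟩ := hodd ((x :: s).toFinset ∪ (o :: r).toFinset)
      ((Finset.card_union_le _ _).trans (by omega))
    have hd' : ∀ v ∈ z :: u, v ∉ x :: s ∧ v ∉ o :: r := by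
      intro v hv
      have := hd v hv
      rw [Finset.mem_union, List.mem_toFinset, List.mem_toFinset, not_or] at this
      exact this
    rw [← hN.eq_of_disjoint hw hconn (by omega) (by omega) hu hs hue hse hul hsl
        fun v hv => (hd' v hv).1,
      hN.eq_of_disjoint hw hconn (by omega) (by omega) hu ho hue hre hul hrl
        fun v hv => (hd' v hv).2]
  set w' : V → V → ZMod 2 := fun a b => w a b + c with hw'
  have hw's : ∀ a b, w' a b = w' b a := fun a b => by simp only [hw', hw a b]
  have hcw : ∀ x s, cw w' x s = cw w x s + (s.length + 1) * c := by
    intro x s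
    rw [cw, hw', wt_add_const, cw, List.length_append, List.length_singleton]
    push_cast
    rfl
  have hcc : c + c = 0 := CharTwo.add_self_eq_zero c
  have hshort : ∀ x s, IsClo G x s → s.length + 1 ≤ 4 * T + 4 → cw w' x s = 0 := by
    intro x s hs hsl
    by_contra hne
    obtain ⟨b, u, hu, hne', hul, -⟩ := hs.extract hw's hne
    apply hne'
    rw [hcw]
    rcases Nat.even_or_odd u.length with he | ho
    · rw [hsame b u hu he (by omega), ZMod.natCast_eq_zero_iff_even.2 he]
      linear_combination hcc
    · rw [hN b u hu ho (by omega), zero_add, ← Nat.cast_add_one, ZMod.natCast_eq_zero_iff_even.2 ho.add_one]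
      simp
  have hpath : ∀ v, ∃ q : List V, q.IsChain G.Adj ∧ q.head? = some o ∧ q.getLast? = some v ∧
      q.length ≤ 2 * T + 2 := by
    intro v
    by_cases hv : o = v
    · exact ⟨[v], List.isChain_singleton v, by simp [hv], rfl, by simp⟩
    · obtain ⟨x, hx, y, hy, l, -, hl, hch, -⟩ := hconn {o} {v} ∅ (by simp) (by simp) (by simpa using hv)
        (by simp; omega)
      rw [Finset.mem_singleton] at hx hy
      subst hx hy
      refine ⟨_, hch, rfl, by rw [← List.cons_append, List.getLast?_concat], ?_⟩
      simp
      omega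
  choose q hqc hqh hql hqlen using hpath
  set s : V → ZMod 2 := fun v => wt w' (q v) with hs
  have hpot : ∀ u v, G.Adj u v → w' u v = s u + s v := by
    intro u v huv
    obtain ⟨qu, hqu⟩ : ∃ qu, q u = qu ++ [u] := by
      obtain ⟨h1, h2⟩ := List.getLast?_eq_some_iff.1 (hql u)
      exact ⟨h1, h2⟩
    obtain ⟨qv, hqv⟩ : ∃ qv, q v = qv ++ [v] := by
      obtain ⟨h1, h2⟩ := List.getLast?_eq_some_iff.1 (hql v)
      exact ⟨h1, h2⟩
    have hwt : wt w' (q u ++ (q v).reverse) = s u + w' u v + s v := by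
      rw [hs, hqu, List.append_assoc, List.singleton_append, wt_append_cons, hqv,
        List.reverse_append, List.reverse_singleton, List.singleton_append, wt_cons_cons]
      have := wt_reverse hw's (qv ++ [v])
      rw [List.reverse_append, List.reverse_singleton, List.singleton_append] at this
      simp only [this, hqu, hqv]
      ring
    have hch : (q u ++ (q v).reverse).IsChain G.Adj := by
      rw [List.isChain_append]
      refine ⟨hqc u, isChain_reverse_of_isChain (hqc v), ?_⟩
      intro a ha b hb
      rw [hql u] at ha
      rw [List.head?_reverse, hql v] at hb
      rw [Option.mem_def, Option.some.injEq] at ha hb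
      rw [← ha, ← hb]
      exact huv
    obtain ⟨u', hu'⟩ := List.head?_eq_some_iff.1 (hqh u)
    obtain ⟨v', hv'⟩ := List.head?_eq_some_iff.1 (hqh v)
    have e : q u ++ (q v).reverse = o :: ((u' ++ v'.reverse) ++ [o]) := by
      rw [hu', hv']; simp
    have l1 := hqlen u
    have l2 := hqlen v
    rw [hu', List.length_cons] at l1
    rw [hv', List.length_cons] at l2
    have h1 := hshort o (u' ++ v'.reverse) (by rw [IsClo, ← e]; exact hch)
      (by rw [List.length_append, List.length_reverse]; omega)
    rw [cw, ← e, hwt] at h1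
    have h2 := CharTwo.two_eq_zero (R := ZMod 2)
    linear_combination h1 - (s u + s v) * h2
  have hall : ∀ x s, IsClo G x s → cw w' x s = 0 := by
    intro x s hs
    rw [cw, wt_eq_of_potential hpot hs]
    exact CharTwo.add_self_eq_zero _
  have hc0 : c = 0 := by
    have h1 := hall x0 t0 h0
    rw [hcw, h0w, ZMod.natCast_eq_zero_iff_even.2 h0e] at h1
    simpa using h1
  have := hall y t h
  rw [hcw, hc0] at this
  simpa using this

end Potential

section Duality

variable {V : Type} {G : SimpleGraph V}

theorem exists_walk_of_isClo {a : V} {t : List V} (h : IsClo G a t) :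
    ∃ c : G.Walk a a, c.support = a :: (t ++ [a]) := by
  rw [IsClo] at h
  have hl : (a :: (t ++ [a])).getLast (List.cons_ne_nil _ _) = a := by
    rw [List.getLast_cons (by simp), List.getLast_concat]
  exact ⟨(Walk.ofSupport (a :: (t ++ [a])) (List.cons_ne_nil _ _) h).copy (List.head_cons ..) hl, by
    rw [Walk.support_copy, Walk.support_ofSupport]⟩

theorem exists_isCyc_of_isCycle {a : V} {c : G.Walk a a} (hc : c.IsCycle) :
    ∃ t, IsCyc G a t ∧ c.support = a :: (t ++ [a]) := by
  have h3 := hc.three_le_length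
  have hl := c.length_support
  obtain ⟨t, ht⟩ : ∃ t, c.support = a :: (t ++ [a]) := by
    have h1 := c.cons_tail_support
    have h2 : c.support.tail ≠ [] := by
      intro h
      rw [h] at h1
      rw [← h1, List.length_singleton] at hl
      omega
    have h4 : c.support.tail.getLast h2 = a := by
      rw [List.getLast_tail]
      exact c.getLast_support
    refine ⟨c.support.tail.dropLast, ?_⟩
    conv_lhs => rw [← h1]
    rw [List.cons.injEq]
    refine ⟨rfl, ?_⟩
    conv_lhs => rw [← List.dropLast_append_getLast h2, h4]
  have hn := hc.support_nodup
  have hch := c.isChain_adj_support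
  rw [ht] at hn hch hl
  refine ⟨t, ⟨hch, ?_, ?_⟩, ht⟩
  · rw [List.tail_cons] at hn
    have := List.nodup_append_comm.1 hn
    simpa using this
  · simp at hl
    omega

theorem exists_isHamiltonianCycle [DecidableEq V] {a : V} {t : List V} (h : IsCyc G a t)
    (hs : ∀ v, v ∈ a :: t) :
    ∃ c : G.Walk a a, c.IsHamiltonianCycle ∧ c.support = a :: (t ++ [a]) := by
  obtain ⟨c, hc⟩ := exists_walk_of_isClo h.clo
  have hl := c.length_support
  rw [hc] at hl
  have h2 := h.two_le
  simp only [List.length_cons, List.length_append, List.length_nil] at hl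
  have hnil : ¬ c.Nil := by
    rw [Walk.not_nil_iff_lt_length]
    omega
  have hst : c.tail.support = t ++ [a] := by
    rw [Walk.support_tail_of_not_nil c hnil, hc, List.tail_cons]
  have hp : (t ++ [a]).Perm (a :: t) := List.perm_append_comm
  have hpath : c.tail.IsPath := by
    rw [Walk.isPath_def, hst]
    exact hp.nodup_iff.2 h.nodup
  refine ⟨c, ⟨Walk.isCycle_iff_isPath_tail_and_le_length.2 ⟨hpath, by omega⟩, ?_⟩, hc⟩
  refine hpath.isHamiltonian_of_mem fun v => ?_
  rw [hst]
  exact hp.mem_iff.2 (hs v)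

theorem map_indicator_edges [DecidableEq V] (f : (Sym2 V → ZMod 2) →ₗ[ZMod 2] ZMod 2) {a b : V}
    (c : G.Walk a b) (hc : c.edges.Nodup) :
    f (fun e => if e ∈ c.edges then 1 else 0) =
      wt (fun x y => f (Pi.single s(x, y) 1)) c.support := by
  induction c with
  | nil =>
    simp only [Walk.edges_nil, List.not_mem_nil, if_false, Walk.support_nil, wt_singleton]
    exact map_zero f
  | @cons u v _ h p ih =>
    rw [Walk.edges_cons, List.nodup_cons] at hc
    have e1 : (fun e => if e ∈ (Walk.cons h p).edges then (1 : ZMod 2) else 0) =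
        Pi.single s(u, v) 1 + fun e => if e ∈ p.edges then 1 else 0 := by
      funext e
      rw [Walk.edges_cons, Pi.add_apply]
      by_cases he : e = s(u, v)
      · rw [he, Pi.single_eq_same, if_pos List.mem_cons_self, if_neg hc.1, add_zero]
      · rw [Pi.single_eq_of_ne he, zero_add]
        simp [he]
    rw [e1, map_add, ih hc.2, Walk.support_cons, ← p.cons_tail_support, wt_cons_cons]

/-- If every symmetric weighting that vanishes on spanning cycles vanishes on all cycles, then
the Hamilton cycles generate the cycle space. -/
theorem hamiltonSpace_eq_cycleSpace [Fintype V] [DecidableEq V]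
    (h : ∀ w : V → V → ZMod 2, (∀ a b, w a b = w b a) →
      (∀ x t, IsCyc G x t → (∀ v, v ∈ x :: t) → cw w x t = 0) →
      ∀ x t, IsCyc G x t → cw w x t = 0) :
    hamiltonSpace G = cycleSpace G := by
  refine le_antisymm (Submodule.span_mono ?_) (Submodule.span_le.2 ?_)
  · rintro _ ⟨x, c, hc, rfl⟩
    exact ⟨x, c, hc.isCycle, rfl⟩
  · rintro _ ⟨x, c, hc, rfl⟩
    by_contra hn
    obtain ⟨f, hf, hker⟩ := Submodule.exists_le_ker_of_notMem hn
    apply hf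
    rw [map_indicator_edges f c hc.isTrail.edges_nodup]
    obtain ⟨t, ht, hs⟩ := exists_isCyc_of_isCycle hc
    rw [hs]
    refine h _ (fun a b => by rw [Sym2.eq_swap]) ?_ x t ht
    intro y s hy hys
    obtain ⟨d, hd, hds⟩ := exists_isHamiltonianCycle hy hys
    rw [cw, ← hds, ← map_indicator_edges f d hd.isCycle.isTrail.edges_nodup]
    exact hker (Submodule.subset_span ⟨y, d, hd, rfl⟩)

end Duality

section Switch

variable {V : Type} {G : SimpleGraph V} {w : V → V → ZMod 2}

theorem isChain_cons_append_cons {R : V → V → Prop} {l1 l2 : List V} {a b : V} :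
    (b :: (l1 ++ a :: l2)).IsChain R ↔ (b :: (l1 ++ [a])).IsChain R ∧ (a :: l2).IsChain R :=
  isChain_append_cons (l1 := b :: l1)

theorem wt_cons_append_cons (l1 l2 : List V) (a b : V) :
    wt w (b :: (l1 ++ a :: l2)) = wt w (b :: (l1 ++ [a])) + wt w (a :: l2) :=
  wt_append_cons (b :: l1) l2 a

/-- The vertex list of a path given by its ends and its interior. -/
def linkList (p : V × List V × V) : List V := p.1 :: (p.2.1 ++ [p.2.2])

/-- The two ways of traversing a sequence of links alternatingly in both directions. -/
def zigzag : List (V × List V × V) → List V × List V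
  | [] => ([], [])
  | p :: Ls => (linkList p ++ (zigzag Ls).2, (linkList p).reverse ++ (zigzag Ls).1)

theorem zigzag_perm (Ls : List (V × List V × V)) :
    (zigzag Ls).1.Perm (Ls.flatMap linkList) ∧ (zigzag Ls).2.Perm (Ls.flatMap linkList) := by
  induction Ls with
  | nil => simp [zigzag]
  | cons p Ls ih =>
    rw [List.flatMap_cons]
    exact ⟨ih.2.append_left _, (List.reverse_perm _).append ih.1⟩

theorem linkList_reverse (p : V × List V × V) :
    (linkList p).reverse = p.2.2 :: (p.2.1.reverse ++ [p.1]) := by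
  simp [linkList]

theorem zigzag_isChain {Ls : List (V × List V × V)} (hL : ∀ p ∈ Ls, (linkList p).IsChain G.Adj)
    {x y e : V} (hx : (x :: (Ls.map (fun p => p.1) ++ [e])).IsChain G.Adj)
    (hy : (y :: (Ls.map (fun p => p.2.2) ++ [e])).IsChain G.Adj) :
    (x :: ((zigzag Ls).1 ++ [e])).IsChain G.Adj ∧ (y :: ((zigzag Ls).2 ++ [e])).IsChain G.Adj := by
  induction Ls generalizing x y with
  | nil => exact ⟨hx, hy⟩
  | cons p Ls ih =>
    simp only [List.map_cons, List.cons_append, List.isChain_cons_cons] at hx hy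
    obtain ⟨h1, h2⟩ := ih (fun q hq => hL q (List.mem_cons_of_mem _ hq)) hx.2 hy.2
    have h3 := hL p List.mem_cons_self
    have h4 := isChain_reverse_of_isChain h3
    rw [linkList_reverse] at h4
    rw [linkList] at h3
    rw [zigzag, linkList_reverse, linkList]
    have e1 : x :: (p.1 :: (p.2.1 ++ [p.2.2]) ++ (zigzag Ls).2 ++ [e]) =
        x :: p.1 :: (p.2.1 ++ p.2.2 :: ((zigzag Ls).2 ++ [e])) := by simp
    have e2 : y :: (p.2.2 :: (p.2.1.reverse ++ [p.1]) ++ (zigzag Ls).1 ++ [e]) =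
        y :: p.2.2 :: (p.2.1.reverse ++ p.1 :: ((zigzag Ls).1 ++ [e])) := by simp
    simp only [e1, e2]
    rw [List.isChain_cons_cons, List.isChain_cons_cons,
      isChain_cons_append_cons (l1 := p.2.1), isChain_cons_append_cons (l1 := p.2.1.reverse)]
    exact ⟨⟨hx.1, h3, h2⟩, hy.1, h4, h1⟩

theorem wt_zigzag (hw : ∀ a b, w a b = w b a) (Ls : List (V × List V × V)) (x y e : V) :
    wt w (x :: ((zigzag Ls).1 ++ [e])) + wt w (y :: ((zigzag Ls).2 ++ [e])) =
      wt w (x :: (Ls.map (fun p => p.1) ++ [e])) +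
        wt w (y :: (Ls.map (fun p => p.2.2) ++ [e])) := by
  induction Ls generalizing x y with
  | nil => rfl
  | cons p Ls ih =>
    have h4 := wt_reverse hw (linkList p)
    rw [linkList_reverse, linkList] at h4
    rw [zigzag, linkList_reverse, linkList]
    have e1 : x :: (p.1 :: (p.2.1 ++ [p.2.2]) ++ (zigzag Ls).2 ++ [e]) =
        x :: p.1 :: (p.2.1 ++ p.2.2 :: ((zigzag Ls).2 ++ [e])) := by simp
    have e2 : y :: (p.2.2 :: (p.2.1.reverse ++ [p.1]) ++ (zigzag Ls).1 ++ [e]) =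
        y :: p.2.2 :: (p.2.1.reverse ++ p.1 :: ((zigzag Ls).1 ++ [e])) := by simp
    simp only [e1, e2, List.map_cons]
    rw [List.cons_append, List.cons_append, wt_cons_cons, wt_cons_cons, wt_cons_cons, wt_cons_cons,
      wt_cons_append_cons p.2.1, wt_cons_append_cons p.2.1.reverse, h4]
    have h5 := ih p.1 p.2.2
    have h6 := CharTwo.add_self_eq_zero (wt w (p.1 :: (p.2.1 ++ [p.2.2])))
    linear_combination h5 + h6

theorem isClo_of_closed {A B : List V} {v : V} (h : (A ++ v :: B).IsChain G.Adj)
    (hcl : ∃ x y, (A ++ v :: B).head? = some x ∧ (A ++ v :: B).getLast? = some y ∧ G.Adj y x) :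
    IsClo G v (B ++ A) := by
  obtain ⟨x, y, hx, hy, hyx⟩ := hcl
  rw [List.getLast?_append_cons] at hy
  cases A with
  | nil =>
    simp only [List.nil_append, List.head?_cons, Option.some.injEq] at hx h
    subst hx
    rw [IsClo, List.append_nil, ← List.cons_append, List.isChain_append]
    refine ⟨h, List.isChain_singleton _, ?_⟩
    intro a ha b hb
    rw [hy] at ha
    simp only [List.head?_cons, Option.mem_def, Option.some.injEq] at ha hb
    rw [← ha, ← hb]
    exact hyx
  | cons a A =>
    simp only [List.cons_append, List.head?_cons, Option.some.injEq] at hx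
    subst hx
    rw [isChain_append_cons] at h
    rw [IsClo, List.append_assoc, ← List.cons_append, List.isChain_append]
    refine ⟨h.2, h.1, ?_⟩
    intro c hc d hd
    rw [hy] at hc
    simp only [List.cons_append, List.head?_cons, Option.mem_def, Option.some.injEq] at hc hd
    rw [← hc, ← hd]
    exact hyx

theorem IsSpanningCycle.exists_isCyc [Fintype V] [DecidableEq V] {s : V} {sp l : List V}
    (h : IsSpanningCycle G (s :: sp) l) (h2 : 3 ≤ l.length) :
    ∃ r, IsCyc G s (sp ++ r) ∧ ∀ v, v ∈ s :: (sp ++ r) := by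
  wlog hk : s :: sp <:+: l generalizing l
  · refine this (l := l.reverse) ⟨h.toIsGood.reverse, fun v => List.mem_reverse.2 (h.mem v), ?_⟩
      (by rwa [List.length_reverse]) ?_
    · obtain ⟨x, y, hx, hy, hyx⟩ := h.closed
      exact ⟨y, x, by rw [List.head?_reverse, hy], by rw [List.getLast?_reverse, hx], hyx.symm⟩
    · have := h.keeps.resolve_left hk
      rwa [← List.reverse_infix, List.reverse_reverse] at this
  obtain ⟨A, B, rfl⟩ := hk
  have e : A ++ s :: sp ++ B = A ++ s :: (sp ++ B) := by simp
  have hp : (s :: (sp ++ (B ++ A))).Perm (A ++ s :: sp ++ B) := by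
    rw [e, ← List.append_assoc, ← List.cons_append]
    exact List.perm_append_comm
  refine ⟨B ++ A, ⟨?_, hp.nodup_iff.2 h.nodup, ?_⟩, fun v => hp.mem_iff.2 (h.mem v)⟩
  · rw [← List.append_assoc]
    have h1 := h.isChain
    have h3 := h.closed
    rw [e] at h1 h3
    exact isClo_of_closed h1 h3
  · have := hp.length_eq
    rw [List.length_cons] at this
    omega

/-- A Hamilton cycle through one traversal of the links yields another one through the other
traversal. -/
theorem wt_links_eq_zero [Fintype V] [DecidableEq V] (hw : ∀ a b, w a b = w b a)
    (hH : ∀ x t, IsCyc G x t → (∀ v, v ∈ x :: t) → cw w x t = 0) {Ls : List (V × List V × V)}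
    {s e : V} (hL : ∀ p ∈ Ls, (linkList p).IsChain G.Adj)
    (hT : (s :: (Ls.map (fun p => p.1) ++ [e])).IsChain G.Adj)
    (hU : (s :: (Ls.map (fun p => p.2.2) ++ [e])).IsChain G.Adj) {l : List V}
    (hl : IsSpanningCycle G (s :: ((zigzag Ls).1 ++ [e])) l) (hl3 : 3 ≤ l.length) :
    wt w (s :: (Ls.map (fun p => p.1) ++ [e])) + wt w (s :: (Ls.map (fun p => p.2.2) ++ [e])) =
      0 := by
  obtain ⟨r, hr, hrs⟩ := hl.exists_isCyc hl3
  have hp : (s :: ((zigzag Ls).2 ++ [e] ++ r)).Perm (s :: ((zigzag Ls).1 ++ [e] ++ r)) :=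
    ((((zigzag_perm Ls).2.trans (zigzag_perm Ls).1.symm).append_right _).append_right _).cons _
  have hc := hr.clo
  have e' : ∀ z : List V, s :: (z ++ [e] ++ r ++ [s]) = (s :: z) ++ e :: (r ++ [s]) := by simp
  rw [IsClo, e', isChain_append_cons] at hc
  have hr' : IsCyc G s ((zigzag Ls).2 ++ [e] ++ r) := by
    refine ⟨?_, hp.nodup_iff.2 hr.nodup, ?_⟩
    · rw [IsClo, e', isChain_append_cons]
      exact ⟨(zigzag_isChain hL hT hU).2, hc.2⟩
    · have := hp.length_eq
      have := hr.two_le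
      simp only [List.length_cons] at *
      omega
  have h1 := hH _ _ hr hrs
  have h2 := hH _ _ hr' fun v => hp.mem_iff.2 (hrs v)
  rw [cw, e', wt_append_cons] at h1 h2
  rw [← wt_zigzag hw]
  have h3 := CharTwo.add_self_eq_zero (wt w (e :: (r ++ [s])))
  simp only [List.cons_append] at h1 h2
  linear_combination h1 + h2 - h3

end Switch

section Shortcut

variable {V : Type} {G : SimpleGraph V}

/-- A walk between two distinct vertices contains a path between them. -/
theorem exists_nodup_mid [DecidableEq V] {a b : V} (hab : a ≠ b) {l : List V}
    (h : (a :: (l ++ [b])).IsChain G.Adj) :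
    ∃ l', l' ⊆ l ∧ l'.length ≤ l.length ∧ (a :: (l' ++ [b])).IsChain G.Adj ∧
      (a :: (l' ++ [b])).Nodup := by
  have hl : (a :: (l ++ [b])).getLast (List.cons_ne_nil _ _) = b := by
    rw [List.getLast_cons (by simp), List.getLast_concat]
  obtain ⟨c, hc⟩ : ∃ c : G.Walk a b, c.support = a :: (l ++ [b]) :=
    ⟨(Walk.ofSupport (a :: (l ++ [b])) (List.cons_ne_nil _ _) h).copy (List.head_cons ..) hl, by
      rw [Walk.support_copy, Walk.support_ofSupport]⟩
  have h1 := c.bypass.cons_tail_support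
  have h2 : c.bypass.support.tail ≠ [] := by
    intro h
    rw [h] at h1
    have := c.bypass.getLast_support
    simp only [← h1, List.getLast_singleton] at this
    exact hab this
  have h3 : c.bypass.support.tail.getLast h2 = b := by
    rw [List.getLast_tail]
    exact c.bypass.getLast_support
  have h4 := List.dropLast_append_getLast h2
  rw [h3] at h4
  rw [← h4] at h1
  set l' := c.bypass.support.tail.dropLast
  have hnd := (Walk.isPath_def _).1 c.bypass_isPath
  have hch := c.bypass.isChain_adj_support
  have hsub := c.support_bypass_subset_support
  have hle := c.support_bypass_sublist_support.length_le
  rw [hc] at hsub hle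
  rw [← h1] at hnd hch hsub hle
  refine ⟨l', fun v hv => ?_, by simpa using hle, hch, hnd⟩
  have hv1 := hsub (List.mem_cons_of_mem _ (List.mem_append_left _ hv))
  rw [List.nodup_cons, List.nodup_append] at hnd
  have hva : v ≠ a := by
    rintro rfl
    exact hnd.1 (List.mem_append_left _ hv)
  have hvb : v ≠ b := hnd.2.2.2 v hv b (List.mem_singleton_self b)
  simpa [hva, hvb] using hv1

end Shortcut

section Levels

variable {V : Type} [Fintype V] [DecidableEq V] {G : SimpleGraph V} {m T : ℕ}

/-- The vertices reached from `A` by walks of length exactly `t` through `Y`. -/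
noncomputable def level (G : SimpleGraph V) (A Y : Finset V) : ℕ → Finset V
  | 0 => A
  | t + 1 => nbr G (level G A Y t) ∩ Y

theorem exists_walk_of_mem_level {A Y : Finset V} {t : ℕ} {v : V} (hv : v ∈ level G A Y t) :
    ∃ a ∈ A, ∃ l : List V, l.length = t ∧ (∀ z ∈ l, z ∈ Y) ∧ (a :: l).IsChain G.Adj ∧
      (a :: l).getLast? = some v := by
  induction t generalizing v with
  | zero => exact ⟨v, hv, [], rfl, by simp, List.isChain_singleton v, rfl⟩
  | succ t ih =>
    rw [level, Finset.mem_inter, mem_nbr] at hv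
    obtain ⟨⟨u, hu, huv⟩, hvY⟩ := hv
    obtain ⟨a, ha, l, hl, hlY, hch, hlast⟩ := ih hu
    refine ⟨a, ha, l ++ [v], by simp [hl], ?_, ?_, ?_⟩
    · intro z hz
      rcases List.mem_append.1 hz with h | h
      · exact hlY z h
      · rw [List.mem_singleton.1 h]
        exact hvY
    · rw [← List.cons_append, List.isChain_append]
      refine ⟨hch, List.isChain_singleton v, ?_⟩
      intro x hx y hy
      rw [hlast] at hx
      simp only [List.head?_cons, Option.mem_def, Option.some.injEq] at hx hy
      rwa [← hx, ← hy]
    · rw [← List.cons_append, List.getLast?_concat]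

theorem exists_large_level {A Y : Finset V} (hne : A.Nonempty)
    (h : ∀ S : Finset V, A.card ≤ S.card → S.card ≤ 2 * m → 2 * S.card ≤ (nbr G S ∩ Y).card)
    (hT : 2 * m ≤ 2 ^ T) : ∃ t ≤ T, 2 * m ≤ (level G A Y t).card := by
  by_contra! hcon
  have key : ∀ t ≤ T, 2 ^ t * A.card ≤ (level G A Y t).card := by
    intro t ht
    induction t with
    | zero => simp [level]
    | succ t ih =>
      have h1 := ih (by omega)
      have h2 := hcon t (by omega)
      have h3 := h _ (le_trans (Nat.le_mul_of_pos_left _ (by positivity)) h1) h2.le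
      rw [level, pow_succ]
      linarith
  have h1 := key T le_rfl
  have h2 := hcon T le_rfl
  have h3 : 2 ^ T * 1 ≤ 2 ^ T * A.card := Nat.mul_le_mul_left _ hne.card_pos
  omega

/-- Two expanding sets are joined by a short path through `Y`. -/
theorem IsJoined.exists_connection (hJ : IsJoined G m) {A B Y : Finset V} (hA : A.Nonempty)
    (hB : B.Nonempty) (hAB : Disjoint A B) (hT : 2 * m ≤ 2 ^ T)
    (hEA : ∀ S : Finset V, A.card ≤ S.card → S.card ≤ 2 * m → 2 * S.card ≤ (nbr G S ∩ Y).card)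
    (hEB : ∀ S : Finset V, B.card ≤ S.card → S.card ≤ 2 * m → 2 * S.card ≤ (nbr G S ∩ Y).card) :
    ∃ a ∈ A, ∃ b ∈ B, ∃ l : List V, (∀ v ∈ l, v ∈ Y) ∧ l.length ≤ 2 * T ∧
      (a :: (l ++ [b])).IsChain G.Adj ∧ (a :: (l ++ [b])).Nodup := by
  obtain ⟨t, ht, h1⟩ := exists_large_level hA hEA hT
  obtain ⟨s, hs, h2⟩ := exists_large_level hB hEB hT
  obtain ⟨u, hu, v, hv, huv⟩ := hJ.exists_adj (le_trans (by omega) h1) h2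
  obtain ⟨a, ha, l, hl, hlY, hch, hlast⟩ := exists_walk_of_mem_level hu
  obtain ⟨b, hb, r, hr, hrY, hch', hlast'⟩ := exists_walk_of_mem_level hv
  have hab : a ≠ b := by
    rintro rfl
    exact Finset.disjoint_left.1 hAB ha hb
  have hchain : (a :: ((l ++ r.reverse) ++ [b])).IsChain G.Adj := by
    have e : a :: ((l ++ r.reverse) ++ [b]) = (a :: l) ++ (b :: r).reverse := by simp
    rw [e, List.isChain_append]
    refine ⟨hch, isChain_reverse_of_isChain hch', ?_⟩
    intro x hx y hy
    rw [hlast] at hx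
    rw [List.head?_reverse, hlast'] at hy
    rw [Option.mem_def, Option.some.injEq] at hx hy
    rwa [← hx, ← hy]
  obtain ⟨l', hsub, hlen, hch2, hnd⟩ := exists_nodup_mid hab hchain
  refine ⟨a, ha, b, hb, l', fun z hz => ?_, ?_, hch2, hnd⟩
  · rcases List.mem_append.1 (hsub hz) with h | h
    · exact hlY z h
    · exact hrY z (List.mem_reverse.1 h)
  · rw [List.length_append, List.length_reverse] at hlen
    omega

/-- Small sets expand, even after deleting `a` vertices. -/
def Expands (G : SimpleGraph V) (Y : Finset V) (a m : ℕ) : Prop :=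
  ∀ D S : Finset V, D.card ≤ a → S.card ≤ 2 * m → 8 * S.card ≤ (nbr G S ∩ (Y \ D)).card

theorem Expands.hasConnections {Y : Finset V} {a : ℕ} (hE : Expands G Y a m) (hJ : IsJoined G m)
    (hT : 2 * m ≤ 2 ^ T) : HasConnections G a T := by
  intro A B D hA hB hAB hc
  have hE' : ∀ S : Finset V, S.card ≤ 2 * m →
      2 * S.card ≤ (nbr G S ∩ (Y \ (A ∪ B ∪ D))).card := by
    intro S hS
    have h1 := Finset.card_union_le (A ∪ B) D
    have h2 := Finset.card_union_le A B
    have := hE (A ∪ B ∪ D) S (by omega) hS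
    omega
  obtain ⟨x, hx, y, hy, l, hlY, hl, hch, hnd⟩ := hJ.exists_connection hA hB hAB hT
    (fun S _ hS => hE' S hS) (fun S _ hS => hE' S hS)
  refine ⟨x, hx, y, hy, l, fun v hv => ?_, hl, hch, ?_⟩
  · have := hlY v hv
    simp only [Finset.mem_sdiff, Finset.mem_union] at this
    tauto
  · exact ((List.nodup_cons.1 hnd).2).of_append_left

theorem Expands.hasOddCycles {Y : Finset V} {a : ℕ} (hE : Expands G Y a m) (hJ : IsJoined G m)
    (hT : 2 * m ≤ 2 ^ T) (ha : a < Fintype.card V) : HasOddCycles G a T := by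
  intro D hD
  obtain ⟨x, hx⟩ : ∃ x, x ∉ D := by
    by_contra! hcon
    have : D = Finset.univ := Finset.eq_univ_iff_forall.2 hcon
    rw [this, Finset.card_univ] at hD
    omega
  obtain ⟨t, ht, h1⟩ := exists_large_level (A := {x}) (Y := Y \ D) (by simp)
    (fun S _ hS => (by omega : 2 * S.card ≤ 8 * S.card).trans (hE D S hD hS)) hT
  obtain ⟨u, hu, v, hv, huv⟩ := hJ.exists_adj (le_trans (by omega) h1) h1
  obtain ⟨a', ha', l, hl, hlY, hch, hlast⟩ := exists_walk_of_mem_level hu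
  obtain ⟨b', hb', r, hr, hrY, hch', hlast'⟩ := exists_walk_of_mem_level hv
  rw [Finset.mem_singleton] at ha' hb'
  subst ha' hb'
  have hclo : IsClo G b' (l ++ r.reverse) := by
    have e : b' :: ((l ++ r.reverse) ++ [b']) = (b' :: l) ++ (b' :: r).reverse := by simp
    rw [IsClo, e, List.isChain_append]
    refine ⟨hch, isChain_reverse_of_isChain hch', ?_⟩
    intro y hy z hz
    rw [hlast] at hy
    rw [List.head?_reverse, hlast'] at hz
    rw [Option.mem_def, Option.some.injEq] at hy hz
    rwa [← hy, ← hz]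
  have hcw : ∀ y s, cw (fun _ _ : V => (1 : ZMod 2)) y s = (s.length + 1 : ℕ) := by
    intro y s
    have h2 := wt_add_const (w := fun _ _ : V => (0 : ZMod 2)) 1 y (s ++ [y])
    have h3 : ∀ q : List V, wt (fun _ _ : V => (0 : ZMod 2)) q = 0 := by
      intro q
      induction q with
      | nil => rfl
      | cons c q ih => cases q with
        | nil => rfl
        | cons d q => rw [wt_cons_cons, ih, add_zero]
    rw [h3, zero_add, mul_one] at h2
    simpa [cw] using h2
  have hne : cw (fun _ _ : V => (1 : ZMod 2)) b' (l ++ r.reverse) ≠ 0 := by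
    rw [hcw, Ne, ZMod.natCast_eq_zero_iff_even, List.length_append, List.length_reverse, hl, hr,
      Nat.not_even_iff_odd]
    exact ⟨t, by ring⟩
  obtain ⟨y, s, hys, hne', hlen, hsub⟩ := hclo.extract (fun _ _ => rfl) hne
  rw [hcw, Ne, ZMod.natCast_eq_zero_iff_even, Nat.even_add_one, not_not] at hne'
  rw [List.length_append, List.length_reverse] at hlen
  refine ⟨y, s, hys, hne', by omega, fun z hz => ?_⟩
  rcases List.mem_cons.1 (hsub hz) with h | h
  · rwa [h]
  · rcases List.mem_append.1 h with h | h
    · exact (Finset.mem_sdiff.1 (hlY z h)).2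
    · exact (Finset.mem_sdiff.1 (hrY z (List.mem_reverse.1 h))).2

end Levels

section Trails

variable {V : Type} [Fintype V] [DecidableEq V] {G : SimpleGraph V} {Y Z Sp : Finset V} {s : ℕ}

/-- Hall's condition for giving each vertex outside `Sp` a private neighbour in `Y \ Z`, for sets
of at most `2 * s` vertices. -/
def Extendable (G : SimpleGraph V) (Y : Finset V) (s : ℕ) (Z Sp : Finset V) : Prop :=
  ∀ A : Finset V, A.card ≤ 2 * s → (A \ Sp).card ≤ ((nbr G A ∩ Y) \ Z).card

theorem Extendable.critical_union (h : Extendable G Y s Z Sp) {A B : Finset V}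
    (hAB : A.card + B.card ≤ 2 * s) (hA : ((nbr G A ∩ Y) \ Z).card ≤ (A \ Sp).card)
    (hB : ((nbr G B ∩ Y) \ Z).card ≤ (B \ Sp).card) :
    ((nbr G (A ∪ B) ∩ Y) \ Z).card ≤ ((A ∪ B) \ Sp).card := by
  have h1 := h (A ∩ B) ((Finset.card_le_card Finset.inter_subset_left).trans (by omega))
  have e1 : (nbr G (A ∪ B) ∩ Y) \ Z = ((nbr G A ∩ Y) \ Z) ∪ ((nbr G B ∩ Y) \ Z) := by
    rw [nbr_union]
    ext z
    simp only [Finset.mem_sdiff, Finset.mem_inter, Finset.mem_union]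
    tauto
  have e2 : (A ∪ B) \ Sp = (A \ Sp) ∪ (B \ Sp) := Finset.union_sdiff_distrib A B Sp
  have e3 : (A ∩ B) \ Sp = (A \ Sp) ∩ (B \ Sp) := by
    ext z
    simp only [Finset.mem_sdiff, Finset.mem_inter]
    tauto
  have e4 : (nbr G (A ∩ B) ∩ Y) \ Z ⊆ ((nbr G A ∩ Y) \ Z) ∩ ((nbr G B ∩ Y) \ Z) := by
    intro z hz
    simp only [Finset.mem_sdiff, Finset.mem_inter] at hz ⊢
    have ha := nbr_mono (G := G) (Finset.inter_subset_left (s₁ := A) (s₂ := B)) hz.1.1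
    have hb := nbr_mono (G := G) (Finset.inter_subset_right (s₁ := A) (s₂ := B)) hz.1.1
    tauto
  have h2 := Finset.card_le_card e4
  have h3 := Finset.card_union_add_card_inter ((nbr G A ∩ Y) \ Z) ((nbr G B ∩ Y) \ Z)
  have h4 := Finset.card_union_add_card_inter (A \ Sp) (B \ Sp)
  rw [e1, e2]
  rw [e3] at h1
  omega

/-- A vertex can be given a private neighbour while maintaining Hall's condition. -/
theorem Extendable.exists_step (h : Extendable G Y s Z Sp) (hs : 1 ≤ s)
    (hE : ∀ A : Finset V, A.card ≤ 2 * s → 3 * A.card ≤ (nbr G A ∩ Y).card) (hZ : Z.card ≤ s)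
    {v : V} (hv : v ∉ Sp) :
    ∃ y ∈ Y, y ∉ Z ∧ G.Adj v y ∧ Extendable G Y s (insert y Z) (insert v Sp) := by
  by_contra! hcon
  have hsmall : ∀ A : Finset V, A.card ≤ 2 * s → ((nbr G A ∩ Y) \ Z).card ≤ (A \ Sp).card →
      2 * A.card ≤ s := by
    intro A hA hc
    have h1 := hE A hA
    have h2 := Finset.le_card_sdiff Z (nbr G A ∩ Y)
    have h3 := Finset.card_le_card (Finset.sdiff_subset (s := A) (t := Sp))
    omega
  have hcrit : ∀ y ∈ Y, y ∉ Z → G.Adj v y → ∃ A : Finset V, A.card ≤ 2 * s ∧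
      ((nbr G A ∩ Y) \ Z).card ≤ (A \ Sp).card ∧ v ∉ A ∧ y ∈ nbr G A := by
    intro y hy hyZ hvy
    have h1 := hcon y hy hyZ hvy
    rw [Extendable] at h1
    push Not at h1
    obtain ⟨A, hA, hlt⟩ := h1
    have h2 := h A hA
    have e : (nbr G A ∩ Y) \ insert y Z = ((nbr G A ∩ Y) \ Z).erase y := by
      ext z
      simp only [Finset.mem_sdiff, Finset.mem_insert, Finset.mem_erase]
      tauto
    have e' : A \ insert v Sp = (A \ Sp).erase v := by
      ext z
      simp only [Finset.mem_sdiff, Finset.mem_insert, Finset.mem_erase]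
      tauto
    rw [e, e'] at hlt
    have h3 := Finset.pred_card_le_card_erase (s := (nbr G A ∩ Y) \ Z) (a := y)
    have h4 := Finset.card_erase_le (s := A \ Sp) (a := v)
    refine ⟨A, hA, by omega, fun hvA => ?_, ?_⟩
    · have := Finset.card_erase_lt_of_mem (Finset.mem_sdiff.2 ⟨hvA, hv⟩)
      omega
    · by_contra hyA
      rw [Finset.erase_eq_of_notMem (fun hmem => hyA
        (Finset.mem_inter.1 (Finset.mem_sdiff.1 hmem).1).1)] at hlt
      omega
  have key : ∀ F : Finset V, F ⊆ (nbr G {v} ∩ Y) \ Z → ∃ A : Finset V, 2 * A.card ≤ s ∧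
      ((nbr G A ∩ Y) \ Z).card ≤ (A \ Sp).card ∧ v ∉ A ∧ F ⊆ nbr G A := by
    intro F
    induction F using Finset.induction_on with
    | empty => exact fun _ => ⟨∅, by simp, by simp [nbr], by simp, by simp⟩
    | insert y F hyF ih =>
      intro hF
      obtain ⟨A, hA, hAc, hvA, hFA⟩ := ih ((Finset.subset_insert y F).trans hF)
      have hy := hF (Finset.mem_insert_self y F)
      simp only [Finset.mem_sdiff, Finset.mem_inter, mem_nbr, Finset.mem_singleton,
        exists_eq_left] at hy
      obtain ⟨B, hB, hBc, hvB, hyB⟩ := hcrit y hy.1.2 hy.2 hy.1.1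
      have hB' := hsmall B hB hBc
      have hu := h.critical_union (by omega) hAc hBc
      have hcu := Finset.card_union_le A B
      refine ⟨A ∪ B, hsmall _ (by omega) hu, hu, by simp [hvA, hvB], ?_⟩
      intro z hz
      rcases Finset.mem_insert.1 hz with rfl | hz
      · exact nbr_mono Finset.subset_union_right hyB
      · exact nbr_mono Finset.subset_union_left (hFA hz)
  obtain ⟨A, hA, hAc, hvA, hN⟩ := key _ subset_rfl
  have h1 := h (insert v A) ((Finset.card_insert_le v A).trans (by omega))
  have e1 : (nbr G (insert v A) ∩ Y) \ Z = (nbr G A ∩ Y) \ Z := by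
    rw [Finset.insert_eq, nbr_union]
    ext z
    have := @hN z
    simp only [Finset.mem_sdiff, Finset.mem_inter, Finset.mem_union] at this ⊢
    tauto
  rw [e1, Finset.insert_sdiff_of_notMem _ hv, Finset.card_insert_of_notMem (by simp [hvA])] at h1
  omega

/-- Vertex-disjoint paths starting at the vertices of `C` and continuing in `Y`. -/
structure IsTrails (G : SimpleGraph V) (C Y : Finset V) (τ : V → List V) : Prop where
  isChain : ∀ v ∈ C, (v :: τ v).IsChain G.Adj
  mem : ∀ v ∈ C, ∀ z ∈ τ v, z ∈ Y
  nodup : ∀ v ∈ C, (τ v).Nodup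
  disjoint : ∀ u ∈ C, ∀ v ∈ C, u ≠ v → ∀ z ∈ τ u, z ∉ τ v

theorem exists_trails_aux {C : Finset V} (hCY : Disjoint C Y) (hs : 1 ≤ s)
    (hE : ∀ A : Finset V, A.card ≤ 2 * s → 3 * A.card ≤ (nbr G A ∩ Y).card) (k : ℕ) (hk : k ≤ s)
    (g : V → ℕ) (hg : ∑ v ∈ C, g v = k) :
    ∃ (τ : V → List V) (Z Sp : Finset V), IsTrails G C Z τ ∧ (∀ v ∈ C, (τ v).length = g v) ∧
      Z ⊆ Y ∧ Z.card ≤ k ∧ Sp ⊆ C ∪ Z ∧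
      (∀ v ∈ C, ∀ x, (v :: τ v).getLast? = some x → x ∉ Sp) ∧ Extendable G Y s Z Sp := by
  induction k generalizing g with
  | zero =>
    rw [Finset.sum_eq_zero_iff] at hg
    refine ⟨fun _ => [], ∅, ∅, ⟨fun v _ => List.isChain_singleton v, by simp, by simp, by simp⟩,
      fun v hv => (hg v hv).symm, by simp, by simp, by simp, by simp, fun A hA => ?_⟩
    have := hE A hA
    simp only [Finset.sdiff_empty]
    omega
  | succ k ih =>
    obtain ⟨v, hv, hgv⟩ : ∃ v ∈ C, g v ≠ 0 := by
      by_contra! hcon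
      rw [Finset.sum_eq_zero hcon] at hg
      omega
    have hg' : ∑ u ∈ C, Function.update g v (g v - 1) u = k := by
      rw [Finset.sum_update_of_mem hv]
      rw [← Finset.add_sum_erase _ _ hv, ← Finset.sdiff_singleton_eq_erase] at hg
      omega
    obtain ⟨τ, Z, Sp, hτ, hlen, hZY, hZ, hSp, hlast, hext⟩ := ih (by omega) _ hg'
    obtain ⟨x, hx⟩ : ∃ x, (v :: τ v).getLast? = some x := ⟨_, List.getLast?_cons⟩
    obtain ⟨y, hyY, hyZ, hxy, hext'⟩ := hext.exists_step hs hE (by omega) (hlast v hv x hx)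
    have hyC : y ∉ C := fun h => Finset.disjoint_left.1 hCY h hyY
    have hne : ∀ u, u ≠ v → Function.update τ v (τ v ++ [y]) u = τ u := fun u hu =>
      Function.update_of_ne hu _ _
    have hself : Function.update τ v (τ v ++ [y]) v = τ v ++ [y] := Function.update_self _ _ _
    have hyτ : ∀ u ∈ C, y ∉ τ u := fun u hu h => hyZ (hτ.mem u hu y h)
    have hlast_mem : ∀ u ∈ C, ∀ z, (u :: τ u).getLast? = some z → z ∈ u :: τ u :=
      fun u _ z hz => List.mem_of_getLast? hz
    have hmemZ : ∀ u ∈ C, ∀ z ∈ τ u, z ∉ C := fun u hu z hz hzC =>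
      Finset.disjoint_left.1 hCY hzC (hZY (hτ.mem u hu z hz))
    refine ⟨Function.update τ v (τ v ++ [y]), insert y Z, insert x Sp, ⟨?_, ?_, ?_, ?_⟩, ?_, ?_, ?_,
      ?_, ?_, hext'⟩
    · intro u hu
      by_cases h : u = v
      · subst h
        rw [hself, ← List.cons_append, List.isChain_append]
        refine ⟨hτ.isChain u hu, List.isChain_singleton y, ?_⟩
        intro a ha b hb
        rw [hx] at ha
        simp only [List.head?_cons, Option.mem_def, Option.some.injEq] at ha hb
        rwa [← ha, ← hb]
      · rw [hne u h]
        exact hτ.isChain u hu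
    · intro u hu z hz
      by_cases h : u = v
      · subst h
        rw [hself, List.mem_append, List.mem_singleton] at hz
        rcases hz with hz | rfl
        · exact Finset.mem_insert_of_mem (hτ.mem u hu z hz)
        · exact Finset.mem_insert_self _ _
      · rw [hne u h] at hz
        exact Finset.mem_insert_of_mem (hτ.mem u hu z hz)
    · intro u hu
      by_cases h : u = v
      · subst h
        rw [hself]
        refine (hτ.nodup u hu).append (List.nodup_singleton y) ?_
        simpa using hyτ u hu
      · rw [hne u h]
        exact hτ.nodup u hu
    · intro u hu w hw huw z hz
      by_cases h : u = v
      · subst h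
        rw [hne w huw.symm]
        rw [hself, List.mem_append, List.mem_singleton] at hz
        rcases hz with hz | rfl
        · exact hτ.disjoint u hu w hw huw z hz
        · exact hyτ w hw
      · rw [hne u h] at hz
        by_cases h' : w = v
        · subst h'
          rw [hself, List.mem_append, List.mem_singleton, not_or]
          refine ⟨hτ.disjoint u hu w hw huw z hz, ?_⟩
          rintro rfl
          exact hyτ u hu hz
        · rw [hne w h']
          exact hτ.disjoint u hu w hw huw z hz
    · intro u hu
      have := hlen u hu
      by_cases h : u = v
      · subst h
        rw [Function.update_self] at this
        rw [hself, List.length_append, List.length_singleton]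
        omega
      · rw [Function.update_of_ne h] at this
        rw [hne u h, this]
    · exact Finset.insert_subset hyY hZY
    · exact (Finset.card_insert_le y Z).trans (by omega)
    · intro z hz
      rw [Finset.mem_union, Finset.mem_insert]
      rcases Finset.mem_insert.1 hz with rfl | hz
      · rcases List.mem_cons.1 (hlast_mem v hv _ hx) with h | h
        · exact Or.inl (h ▸ hv)
        · exact Or.inr (Or.inr (hτ.mem v hv _ h))
      · rcases Finset.mem_union.1 (hSp hz) with h | h
        · exact Or.inl h
        · exact Or.inr (Or.inr h)
    · intro u hu z hz
      rw [Finset.mem_insert, not_or]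
      by_cases h : u = v
      · subst h
        rw [hself, ← List.cons_append, List.getLast?_concat, Option.some.injEq] at hz
        subst hz
        refine ⟨hxy.ne', fun h => ?_⟩
        rcases Finset.mem_union.1 (hSp h) with h | h
        · exact hyC h
        · exact hyZ h
      · rw [hne u h] at hz
        refine ⟨?_, hlast u hu z hz⟩
        rintro rfl
        have h1 := hlast_mem u hu _ hz
        have h2 := hlast_mem v hv _ hx
        rcases List.mem_cons.1 h1 with h1 | h1 <;> rcases List.mem_cons.1 h2 with h2 | h2
        · exact h (h1.symm.trans h2)
        · exact hmemZ v hv _ h2 (h1 ▸ hu)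
        · exact hmemZ u hu _ h1 (h2 ▸ hv)
        · exact hτ.disjoint u hu v hv h _ h1 h2

/-- Long disjoint paths from given vertices through an expanding set. -/
theorem exists_trails {C : Finset V} (hCY : Disjoint C Y) (hs : 1 ≤ s)
    (hE : ∀ A : Finset V, A.card ≤ 2 * s → 3 * A.card ≤ (nbr G A ∩ Y).card) {M : ℕ}
    (hM : C.card * M ≤ s) :
    ∃ τ : V → List V, IsTrails G C Y τ ∧ ∀ v ∈ C, (τ v).length = M := by
  obtain ⟨τ, Z, Sp, hτ, hlen, hZY, -⟩ := exists_trails_aux hCY hs hE (C.card * M) hM (fun _ => M)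
    (by simp)
  exact ⟨τ, ⟨hτ.isChain, fun v hv z hz => hZY (hτ.mem v hv z hz), hτ.nodup, hτ.disjoint⟩, hlen⟩

end Trails

section Links

variable {V : Type} {G : SimpleGraph V}

theorem exists_eq_cons_append {t u : V} (htu : t ≠ u) {W : List V} (h1 : W.head? = some t)
    (h2 : W.getLast? = some u) : ∃ l, W = t :: (l ++ [u]) := by
  cases W with
  | nil => simp at h1
  | cons x W =>
    simp only [List.head?_cons, Option.some.injEq] at h1
    subst h1
    rcases W.eq_nil_or_concat with rfl | ⟨l, y, rfl⟩
    · simp only [List.getLast?_singleton, Option.some.injEq] at h2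
      exact absurd h2 htu
    · rw [List.concat_eq_append, ← List.cons_append, List.getLast?_concat, Option.some.injEq] at h2
      subst h2
      exact ⟨l, by rw [List.concat_eq_append]⟩

variable [Fintype V] [DecidableEq V] {m T M : ℕ} {C Y1 Y2 : Finset V} {τ : V → List V}

theorem IsTrails.nodup_cons (hτ : IsTrails G C Y1 τ) (hC1 : Disjoint C Y1) {v : V} (hv : v ∈ C) :
    (v :: τ v).Nodup :=
  List.nodup_cons.2 ⟨fun h => Finset.disjoint_left.1 hC1 hv (hτ.mem v hv v h), hτ.nodup v hv⟩

theorem IsTrails.disjoint_cons (hτ : IsTrails G C Y1 τ) (hC1 : Disjoint C Y1) {u v : V}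
    (hu : u ∈ C) (hv : v ∈ C) (huv : u ≠ v) {z : V} (h1 : z ∈ u :: τ u) : z ∉ v :: τ v := by
  intro h2
  rcases List.mem_cons.1 h1 with h1 | h1 <;> rcases List.mem_cons.1 h2 with h2 | h2
  · exact huv (h1.symm.trans h2)
  · exact Finset.disjoint_left.1 hC1 hu (h1 ▸ hτ.mem v hv z h2)
  · exact Finset.disjoint_left.1 hC1 hv (h2 ▸ hτ.mem u hu z h1)
  · exact hτ.disjoint u hu v hv huv z h1 h2

theorem IsTrails.notMem_cons (hτ : IsTrails G C Y1 τ) (hC2 : Disjoint C Y2) (h12 : Disjoint Y1 Y2)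
    {v : V} (hv : v ∈ C) {z : V} (hz : z ∈ Y2) : z ∉ v :: τ v := by
  intro h
  rcases List.mem_cons.1 h with h | h
  · exact Finset.disjoint_left.1 hC2 hv (h ▸ hz)
  · exact Finset.disjoint_left.1 h12 (hτ.mem v hv z h) hz

/-- Two trails can be joined through an expanding set, avoiding a given small set. -/
theorem IsTrails.exists_link (hτ : IsTrails G C Y1 τ) (hC1 : Disjoint C Y1) (hC2 : Disjoint C Y2)
    (h12 : Disjoint Y1 Y2) (hM : ∀ v ∈ C, (τ v).length = M) (hJ : IsJoined G m)
    (hT : 2 * m ≤ 2 ^ T) (hE : ∀ S : Finset V, S.card ≤ 2 * m → 3 * S.card ≤ (nbr G S ∩ Y2).card)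
    {X : Finset V} (hX : X.card ≤ M) {t u : V} (ht : t ∈ C) (hu : u ∈ C) (htu : t ≠ u) :
    ∃ l X', X' ⊆ Y2 \ X ∧ X'.card ≤ 2 * T ∧ (linkList (t, l, u)).IsChain G.Adj ∧
      (linkList (t, l, u)).Nodup ∧ (linkList (t, l, u)).length ≤ 2 * M + 2 * T + 2 ∧
      ∀ z ∈ linkList (t, l, u), z ∈ X' ∨ z ∈ t :: τ t ∨ z ∈ u :: τ u := by
  have hcard : ∀ v ∈ C, (v :: τ v).toFinset.card = M + 1 := fun v hv => by
    rw [List.toFinset_card_of_nodup (hτ.nodup_cons hC1 hv), List.length_cons, hM v hv]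
  have hexp : ∀ S : Finset V, M + 1 ≤ S.card → S.card ≤ 2 * m →
      2 * S.card ≤ (nbr G S ∩ (Y2 \ X)).card := by
    intro S h1 h2
    have h3 := hE S h2
    have h4 := Finset.le_card_sdiff X (nbr G S ∩ Y2)
    rw [Finset.inter_sdiff_assoc] at h4
    omega
  obtain ⟨a, ha, b, hb, l, hlY, hlen, hch, hnd⟩ := hJ.exists_connection (Y := Y2 \ X)
    (A := (t :: τ t).toFinset) (B := (u :: τ u).toFinset) (by simp) (by simp)
    (by
      rw [Finset.disjoint_left]
      intro z h1 h2
      rw [List.mem_toFinset] at h1 h2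
      exact hτ.disjoint_cons hC1 ht hu htu h1 h2) hT
    (by rw [hcard t ht]; exact hexp) (by rw [hcard u hu]; exact hexp)
  rw [List.mem_toFinset] at ha hb
  obtain ⟨P, P', hP⟩ := List.append_of_mem ha
  obtain ⟨Q, Q', hQ⟩ := List.append_of_mem hb
  have hPh : (P ++ a :: (l ++ b :: Q.reverse)).head? = some t := by
    have h := congrArg List.head? hP
    cases P <;> simp_all
  have hQh : (P ++ a :: (l ++ b :: Q.reverse)).getLast? = some u := by
    have e : P ++ a :: (l ++ b :: Q.reverse) = (P ++ a :: l) ++ (Q ++ [b]).reverse := by simp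
    rw [e, List.getLast?_append, List.getLast?_reverse]
    have h := congrArg List.head? hQ
    cases Q <;> simp_all
  obtain ⟨mid, hmid⟩ := exists_eq_cons_append htu hPh hQh
  have hPc := hτ.isChain t ht
  have hQc := hτ.isChain u hu
  have hPn := hτ.nodup_cons hC1 ht
  have hQn := hτ.nodup_cons hC1 hu
  have hPl : (t :: τ t).length = M + 1 := by rw [List.length_cons, hM t ht]
  have hQl : (u :: τ u).length = M + 1 := by rw [List.length_cons, hM u hu]
  have hlY2 : ∀ z ∈ l, z ∈ Y2 := fun z hz => (Finset.mem_sdiff.1 (hlY z hz)).1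
  have hPm : ∀ z, z ∈ P ∨ z = a → z ∈ t :: τ t := by
    intro z hz
    rw [hP, List.mem_append, List.mem_cons]
    tauto
  have hQm : ∀ z, z ∈ Q ∨ z = b → z ∈ u :: τ u := by
    intro z hz
    rw [hQ, List.mem_append, List.mem_cons]
    tauto
  have hPQ : ∀ z, z ∈ t :: τ t → z ∉ u :: τ u := fun z => hτ.disjoint_cons hC1 ht hu htu
  rw [hP] at hPc hPn hPl
  rw [hQ] at hQc hQn hQl
  rw [isChain_append_cons] at hPc hQc
  rw [List.length_append, List.length_cons] at hPl hQl
  rw [List.nodup_append] at hPn hQn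
  refine ⟨mid, l.toFinset, ?_, (List.toFinset_card_le l).trans hlen, ?_⟩
  · intro z hz
    exact hlY z (List.mem_toFinset.1 hz)
  rw [linkList, ← hmid]
  refine ⟨?_, ?_, ?_, ?_⟩
  · rw [isChain_append_cons, isChain_cons_append_cons]
    refine ⟨hPc.1, hch, ?_⟩
    have := isChain_reverse_of_isChain hQc.1
    rwa [List.reverse_append, List.reverse_singleton, List.singleton_append] at this
  · rw [List.nodup_append]
    refine ⟨hPn.1, ?_, ?_⟩
    · rw [List.nodup_cons, List.nodup_append, List.mem_append, List.mem_cons, List.mem_reverse,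
        List.nodup_cons, List.mem_reverse, List.nodup_reverse]
      rw [List.nodup_cons, List.nodup_append, List.mem_append, List.mem_singleton] at hnd
      refine ⟨?_, hnd.2.1, ⟨fun h => ?_, hQn.1⟩, ?_⟩
      · rintro (h | h | h)
        · exact hnd.1 (Or.inl h)
        · exact hnd.1 (Or.inr h)
        · exact hPQ a (hPm a (Or.inr rfl)) (hQm a (Or.inl h))
      · exact hQn.2.2 b h b List.mem_cons_self rfl
      · rintro z hz y hy rfl
        rw [List.mem_cons, List.mem_reverse] at hy
        exact hτ.notMem_cons hC2 h12 hu (hlY2 z hz) (hQm z hy.symm)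
    · rintro z hz y hy rfl
      rw [List.mem_cons, List.mem_append, List.mem_cons, List.mem_reverse] at hy
      rcases hy with h | h | h
      · exact hPn.2.2 z hz a List.mem_cons_self h
      · exact hτ.notMem_cons hC2 h12 ht (hlY2 z h) (hPm z (Or.inl hz))
      · exact hPQ z (hPm z (Or.inl hz)) (hQm z h.symm)
  · simp only [List.length_append, List.length_cons, List.length_reverse]
    omega
  · intro z hz
    rw [List.mem_append, List.mem_cons, List.mem_append, List.mem_cons, List.mem_reverse] at hz
    have h1 := hPm z
    have h2 := hQm z
    rw [List.mem_toFinset]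
    tauto

/-- Vertex-disjoint paths linking prescribed pairs of vertices. -/
theorem IsTrails.exists_links (hτ : IsTrails G C Y1 τ) (hC1 : Disjoint C Y1) (hC2 : Disjoint C Y2)
    (h12 : Disjoint Y1 Y2) (hM : ∀ v ∈ C, (τ v).length = M) (hJ : IsJoined G m)
    (hT : 2 * m ≤ 2 ^ T) (hE : ∀ S : Finset V, S.card ≤ 2 * m → 3 * S.card ≤ (nbr G S ∩ Y2).card)
    {ts us : List V} (hlen : ts.length = us.length) (hk : ts.length * (2 * T) ≤ M)
    (hnd : (ts ++ us).Nodup) (hC : ∀ v ∈ ts ++ us, v ∈ C) :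
    ∃ (Ls : List (V × List V × V)) (X : Finset V), Ls.map (fun p => p.1) = ts ∧
      Ls.map (fun p => p.2.2) = us ∧ (∀ p ∈ Ls, (linkList p).IsChain G.Adj) ∧
      (Ls.flatMap linkList).Nodup ∧ (Ls.flatMap linkList).length ≤ ts.length * (2 * M + 2 * T + 2) ∧
      X ⊆ Y2 ∧ X.card ≤ ts.length * (2 * T) ∧
      ∀ z ∈ Ls.flatMap linkList, z ∈ X ∨ ∃ v ∈ ts ++ us, z ∈ v :: τ v := by
  induction ts generalizing us with
  | nil =>
    rw [List.length_nil, eq_comm, List.length_eq_zero_iff] at hlen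
    subst hlen
    exact ⟨[], ∅, by simp⟩
  | cons t ts ih =>
    cases us with
    | nil => simp at hlen
    | cons u us =>
      simp only [List.length_cons, Nat.add_right_cancel_iff] at hlen
      rw [List.length_cons, add_mul, one_mul] at hk
      have hsub : (ts ++ us).Sublist (t :: ts ++ u :: us) :=
        ((List.sublist_cons_self t ts).append (List.sublist_cons_self u us))
      obtain ⟨Ls, X, h1, h2, hch, hn, hl, hXY, hX, hz⟩ := ih hlen (by omega) (hnd.sublist hsub)
        (fun v hv => hC v (hsub.subset hv))
      have ht : t ∈ C := hC t (by simp)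
      have hu : u ∈ C := hC u (by simp)
      rw [List.cons_append, List.nodup_cons, List.nodup_append, List.nodup_cons] at hnd
      have htu : t ≠ u := fun h => hnd.1 (by simp [h])
      have hfresh : ∀ v ∈ ts ++ us, v ∈ C ∧ t ≠ v ∧ u ≠ v := by
        intro v hv
        refine ⟨hC v (hsub.subset hv), ?_, ?_⟩
        · rintro rfl
          exact hnd.1 (((List.Sublist.refl ts).append (List.sublist_cons_self u us)).subset hv)
        · rintro rfl
          rcases List.mem_append.1 hv with h | h
          · exact hnd.2.2.2 u h u List.mem_cons_self rfl
          · exact hnd.2.2.1.1 h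
      obtain ⟨l, X', hX'Y, hX', hlch, hln, hll, hlz⟩ := hτ.exists_link hC1 hC2 h12 hM hJ hT hE
        (hX.trans (by omega)) ht hu htu
      refine ⟨(t, l, u) :: Ls, X' ∪ X, by simp [h1], by simp [h2], ?_, ?_, ?_, ?_, ?_, ?_⟩
      · rintro p (_ | ⟨_, hp⟩)
        · exact hlch
        · exact hch p hp
      · rw [List.flatMap_cons, List.nodup_append]
        refine ⟨hln, hn, ?_⟩
        rintro z hz1 y hz2 rfl
        have hzX' : z ∈ X' → z ∈ Y2 ∧ z ∉ X := fun h => Finset.mem_sdiff.1 (hX'Y h)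
        rcases hlz z hz1 with h | h | h <;> rcases hz z hz2 with h' | ⟨v, hv, h'⟩
        · exact (hzX' h).2 h'
        · exact hτ.notMem_cons hC2 h12 (hfresh v hv).1 (hzX' h).1 h'
        · exact hτ.notMem_cons hC2 h12 ht (hXY h') h
        · exact hτ.disjoint_cons hC1 ht (hfresh v hv).1 (hfresh v hv).2.1 h h'
        · exact hτ.notMem_cons hC2 h12 hu (hXY h') h
        · exact hτ.disjoint_cons hC1 hu (hfresh v hv).1 (hfresh v hv).2.2 h h'
      · rw [List.flatMap_cons, List.length_append, List.length_cons, add_mul, one_mul]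
        omega
      · exact Finset.union_subset (hX'Y.trans Finset.sdiff_subset) hXY
      · rw [List.length_cons, add_mul, one_mul]
        exact (Finset.card_union_le _ _).trans (by omega)
      · intro z hz'
        rw [List.flatMap_cons, List.mem_append] at hz'
        rw [Finset.mem_union]
        rcases hz' with h | h
        · rcases hlz z h with h | h | h
          · exact Or.inl (Or.inl h)
          · exact Or.inr ⟨t, by simp, h⟩
          · exact Or.inr ⟨u, by simp, h⟩
        · rcases hz z h with h | ⟨v, hv, h⟩
          · exact Or.inl (Or.inr h)
          · exact Or.inr ⟨v, hsub.subset hv, h⟩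

end Links

section Criterion

variable {V : Type} [Fintype V] [DecidableEq V] {G : SimpleGraph V} {w : V → V → ZMod 2}

/-- The numerical conditions under which a pseudorandom graph on `n` vertices has the property
that short even cycles are sums of two Hamilton cycles. -/
structure IsAdmissible (n m T k L a M : ℕ) : Prop where
  one_le : 1 ≤ m
  le_two_pow : 2 * m ≤ 2 ^ T
  le_rounds : k ≤ 2 * (T + 1)
  segments_le : 16 * (T + 1) * L + m ≤ n
  le_segments : 22 * m ≤ k * (L - 2)
  sixteen_pow_le : 32 * 16 ^ k * m ≤ n
  twelve_mul_le : 12 * m ≤ n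
  le_avoid : 20 * T + 16 ≤ a
  avoid_lt : a < n
  le_trail : (12 * T + 8) * (2 * T) ≤ M
  links_le : (12 * T + 8) * (2 * M + 2 * T + 2) + 2 ≤ m

variable {m T k L a M : ℕ} {V₁ V₂ V₃ : Finset V}

theorem IsAdmissible.exists_spanningCycle (hA : IsAdmissible (Fintype.card V) m T k L a M)
    (hJ : IsJoined G m) {sp : List V} (hsp : sp.IsChain G.Adj) (hspn : sp.Nodup)
    (hspm : sp.length ≤ m)
    (hE : ∀ S : Finset V, S.card ≤ m → 6 * S.card ≤ (nbr G S \ sp.toFinset).card) :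
    ∃ l, IsSpanningCycle G sp l ∧ 3 ≤ l.length := by
  obtain ⟨l, hl⟩ := _root_.exists_spanningCycle hsp hspn hspm hA.one_le hE hJ
    ((Nat.le_mul_of_pos_left m two_pos).trans hA.le_two_pow) hA.le_rounds hA.segments_le
    hA.le_segments hA.sixteen_pow_le hA.twelve_mul_le
  refine ⟨l, hl, ?_⟩
  have h1 : Fintype.card V ≤ l.length := by
    rw [← List.toFinset_card_of_nodup hl.nodup, ← Finset.card_univ]
    exact Finset.card_le_card fun v _ => List.mem_toFinset.2 (hl.mem v)
  have := hA.le_avoid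
  have := hA.avoid_lt
  omega

theorem exists_split_of_odd_length {t : List V} (ht : Odd t.length) :
    ∃ l e r, t = l ++ e :: r ∧ l.length = r.length := by
  obtain ⟨i, hi⟩ := ht
  have h : i < t.length := by omega
  refine ⟨t.take i, t[i], t.drop (i + 1), ?_, ?_⟩
  · rw [List.cons_getElem_drop_succ, List.take_append_drop]
  · rw [List.length_take, List.length_drop]
    omega

/-- Short even cycles have weight zero if all Hamilton cycles do. -/
theorem IsAdmissible.noEvenNegative (hA : IsAdmissible (Fintype.card V) m T k L a M)
    (h12 : Disjoint V₁ V₂) (h13 : Disjoint V₁ V₃) (h23 : Disjoint V₂ V₃)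
    (E₁ : Expands G V₁ a m) (E₂ : Expands G V₂ a m) (E₃ : Expands G V₃ a m) (hJ : IsJoined G m)
    (hw : ∀ a b, w a b = w b a)
    (hH : ∀ x t, IsCyc G x t → (∀ v, v ∈ x :: t) → cw w x t = 0) :
    NoEvenNegative G w (12 * T + 8) := by
  intro s t ht htodd htl
  obtain ⟨l, e, r, rfl, hlr⟩ := exists_split_of_odd_length htodd
  have hclo := ht.clo
  have hnd := ht.nodup
  have ha := hA.le_avoid
  have hMT := hA.le_trail
  have hlinks := hA.links_le
  have hm := hA.one_le
  rw [List.length_append, List.length_cons] at htl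
  set C := (s :: (l ++ e :: r)).toFinset with hC
  have hCc : C.card ≤ 12 * T + 8 := by
    refine (List.toFinset_card_le _).trans ?_
    rw [List.length_cons, List.length_append, List.length_cons]
    omega
  have hCM : C.card * M ≤ m := by
    have h1 := Nat.mul_le_mul_right M hCc
    have h2 : (12 * T + 8) * M ≤ (12 * T + 8) * (2 * M + 2 * T + 2) :=
      Nat.mul_le_mul_left _ (by omega)
    omega
  have hE : ∀ {Y : Finset V}, Expands G Y a m → ∀ S : Finset V, S.card ≤ 2 * m →
      8 * S.card ≤ (nbr G S ∩ (Y \ C)).card := fun hY S hS => hY C S (by omega) hS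
  obtain ⟨τ, hτ, hτM⟩ := exists_trails (Finset.disjoint_sdiff (s := C) (t := V₁)) hm
    (fun S hS => (Nat.mul_le_mul_right _ (by omega)).trans (hE E₁ S hS)) hCM
  have hkT : l.length * (2 * T) ≤ M := (Nat.mul_le_mul_right _ (by omega)).trans hMT
  rw [List.nodup_cons, List.nodup_append, List.nodup_cons, List.mem_append, List.mem_cons] at hnd
  have hmem : ∀ v, v ∈ l ++ r.reverse ↔ v ∈ l ∨ v ∈ r := by simp
  have hCmem : ∀ v, v ∈ C ↔ v = s ∨ v ∈ l ∨ v = e ∨ v ∈ r := fun v => by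
    rw [hC, List.mem_toFinset, List.mem_cons, List.mem_append, List.mem_cons]
  obtain ⟨Ls, X, hts, hus, hch, hln, hll, hXY, -, hz⟩ := hτ.exists_links
    Finset.disjoint_sdiff (Finset.disjoint_sdiff (s := C) (t := V₂))
    (h12.mono Finset.sdiff_subset Finset.sdiff_subset) hτM hJ hA.le_two_pow
    (fun S hS => (Nat.mul_le_mul_right _ (by omega)).trans (hE E₂ S hS))
    (ts := l) (us := r.reverse) (by simpa using hlr) hkT
    (List.nodup_append.2 ⟨hnd.2.1, List.nodup_reverse.2 hnd.2.2.1.2, fun x hx y hy =>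
      hnd.2.2.2 x hx y (List.mem_cons_of_mem _ (List.mem_reverse.1 hy))⟩)
    (fun v hv => (hCmem v).2 (by have := (hmem v).1 hv; tauto))
  have hfr : ∀ x ∈ C, x ∉ l → x ∉ r → x ∉ Ls.flatMap linkList := by
    intro x hxC hxl hxr hx
    rcases hz x hx with h | ⟨v, hv, h⟩
    · exact (Finset.mem_sdiff.1 (hXY h)).2 hxC
    · rw [hmem] at hv
      rcases List.mem_cons.1 h with rfl | h
      · tauto
      · exact (Finset.mem_sdiff.1 (hτ.mem v ((hCmem v).2 (by tauto)) x h)).2 hxC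
  have hsl : s ∉ Ls.flatMap linkList := hfr s ((hCmem s).2 (by tauto)) (by tauto) (by tauto)
  have hel : e ∉ Ls.flatMap linkList := by
    refine hfr e ((hCmem e).2 (by tauto)) (fun h => ?_) hnd.2.2.1.1
    exact hnd.2.2.2 e h e List.mem_cons_self rfl
  have hperm := (zigzag_perm Ls).1
  rw [IsClo, List.append_assoc, List.cons_append, isChain_cons_append_cons] at hclo
  have hTc : (s :: (Ls.map (fun p => p.1) ++ [e])).IsChain G.Adj := by
    rw [hts]
    exact hclo.1
  have hUc : (s :: (Ls.map (fun p => p.2.2) ++ [e])).IsChain G.Adj := by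
    rw [hus]
    exact reverse_chain_mid hclo.2
  obtain ⟨c, hc, hc3⟩ := hA.exists_spanningCycle hJ (zigzag_isChain hch hTc hUc).1 (by
      rw [List.nodup_cons, List.mem_append, hperm.mem_iff, List.mem_singleton, List.nodup_append]
      refine ⟨by tauto, hperm.nodup_iff.2 hln, List.nodup_singleton e, ?_⟩
      rintro x hx y hy rfl
      rw [List.mem_singleton] at hy
      subst hy
      exact hel (hperm.mem_iff.1 hx))
    (by
      rw [List.length_cons, List.length_append, hperm.length_eq, List.length_singleton]
      have : l.length * (2 * M + 2 * T + 2) ≤ (12 * T + 8) * (2 * M + 2 * T + 2) :=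
        Nat.mul_le_mul_right _ (by omega)
      omega)
    (fun S hS => by
      refine ((Nat.mul_le_mul_right _ (by omega)).trans (hE E₃ S (by omega))).trans
        (Finset.card_le_card ?_)
      intro x hx
      rw [Finset.mem_inter, Finset.mem_sdiff] at hx
      refine Finset.mem_sdiff.2 ⟨hx.1, ?_⟩
      rw [List.mem_toFinset, List.mem_cons, List.mem_append, hperm.mem_iff, List.mem_singleton]
      have hxC := hx.2.2
      have h2 := hCmem x
      rintro (h | h | h)
      · tauto
      · rcases hz x h with h | ⟨v, hv, h⟩
        · exact Finset.disjoint_left.1 h23 (Finset.mem_sdiff.1 (hXY h)).1 hx.2.1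
        · rw [hmem] at hv
          rcases List.mem_cons.1 h with rfl | h
          · tauto
          · exact Finset.disjoint_left.1 h13
              (Finset.mem_sdiff.1 (hτ.mem v ((hCmem v).2 (by tauto)) x h)).1 hx.2.1
      · tauto)
  have hwt := wt_links_eq_zero hw hH hch hTc hUc hc hc3
  rw [hts, hus, wt_reverse_mid hw] at hwt
  rw [cw, List.append_assoc, List.cons_append, wt_cons_append_cons]
  exact hwt

theorem IsAdmissible.hamiltonSpace_eq_cycleSpace
    (hA : IsAdmissible (Fintype.card V) m T k L a M) (hodd : Odd (Fintype.card V))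
    (h12 : Disjoint V₁ V₂) (h13 : Disjoint V₁ V₃) (h23 : Disjoint V₂ V₃)
    (E₁ : Expands G V₁ a m) (E₂ : Expands G V₂ a m) (E₃ : Expands G V₃ a m) (hJ : IsJoined G m) :
    hamiltonSpace G = cycleSpace G := by
  refine _root_.hamiltonSpace_eq_cycleSpace fun w hw hH x t ht => ?_
  have hN := hA.noEvenNegative h12 h13 h23 E₁ E₂ E₃ hJ hw hH
  have ha := hA.le_avoid
  have hm := hA.links_le
  obtain ⟨c, hc, hc3⟩ := hA.exists_spanningCycle hJ (List.isChain_singleton x)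
    (List.nodup_singleton x) (by rw [List.length_singleton]; omega) (fun S hS => by
      refine ((Nat.mul_le_mul_right _ (by omega)).trans (E₃ {x} S (by simp; omega)
        (by omega))).trans (Finset.card_le_card ?_)
      intro z hz
      simp only [Finset.mem_inter, Finset.mem_sdiff, Finset.mem_singleton] at hz
      simpa using ⟨by simpa using hz.1, hz.2.2⟩)
  obtain ⟨r, hr, hrs⟩ := hc.exists_isCyc hc3
  refine hN.cw_eq_zero hw (E₃.hasConnections hJ hA.le_two_pow)
    (E₃.hasOddCycles hJ hA.le_two_pow hA.avoid_lt) ha le_rfl hr.clo ?_ (hH _ _ hr hrs) ht.clo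
  have hlen : (x :: ([] ++ r)).length = Fintype.card V := by
    rw [← List.toFinset_card_of_nodup hr.nodup, ← Finset.card_univ]
    congr 1
    exact Finset.eq_univ_iff_forall.2 fun v => List.mem_toFinset.2 (hrs v)
  rw [← hlen, List.length_cons, Nat.odd_add_one, Nat.not_odd_iff_even] at hodd
  exact hodd

end Criterion

section Expansion

variable {V : Type} [Fintype V] [DecidableEq V] {G : SimpleGraph V}

/-- Counting the edges leaving `S` inside `U`. -/
theorem sum_card_nbr_le (S Y : Finset V) :
    ∑ v ∈ S, (nbr G {v} ∩ Y).card ≤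
      2 * interiorEdgeCount G (S ∪ (nbr G S ∩ Y) : Finset V) := by
  classical
  set U := S ∪ (nbr G S ∩ Y) with hU
  let H : SimpleGraph V :=
    { Adj := fun u v => G.Adj u v ∧ u ∈ U ∧ v ∈ U
      symm := ⟨fun u v h => ⟨h.1.symm, h.2.2, h.2.1⟩⟩
      loopless := ⟨fun u h => G.loopless.irrefl u h.1⟩ }
  have hedge : interiorEdgeCount G (U : Set V) = H.edgeFinset.card := by
    rw [interiorEdgeCount, ← Set.ncard_coe_finset, coe_edgeFinset]
    congr 1
    ext e
    induction e using Sym2.ind with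
    | _ u v => simp [H]
  rw [hedge, ← sum_degrees_eq_twice_card_edges]
  refine (Finset.sum_le_sum fun v hv => ?_).trans
    (Finset.sum_le_sum_of_subset (Finset.subset_univ S))
  rw [← card_neighborFinset_eq_degree]
  refine Finset.card_le_card fun x hx => ?_
  simp only [Finset.mem_inter, mem_nbr, Finset.mem_singleton, exists_eq_left] at hx
  rw [mem_neighborFinset]
  refine ⟨hx.1, Finset.mem_union_left _ hv, Finset.mem_union_right _ ?_⟩
  exact Finset.mem_inter.2 ⟨mem_nbr.2 ⟨v, hv, hx.1⟩, hx.2⟩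

theorem IsJumbled.two_mul_interiorEdgeCount_le {p β : ℝ} (h : IsJumbled G p β) (U : Finset V) :
    2 * (interiorEdgeCount G (U : Set V) : ℝ) ≤ p * U.card ^ 2 + 2 * β * U.card := by
  obtain ⟨hp, -, -, hU⟩ := h
  have h1 := (abs_le.1 (hU U)).2
  rw [Set.ncard_coe_finset, Nat.cast_choose_two] at h1
  have h2 : 0 ≤ p * (U.card : ℝ) := by positivity
  linarith

/-- Small sets of vertices of large degree into `Y` expand into `Y`. -/
theorem IsJumbled.card_nbr_ge {p β : ℝ} (h : IsJumbled G p β) {S Y : Finset V} {d : ℝ}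
    (hd : ∀ v ∈ S, d ≤ (nbr G {v} ∩ Y).card) (hS : 81 * p * S.card + 18 * β < d) :
    8 * S.card ≤ (nbr G S ∩ Y).card := by
  by_contra! hlt
  set U := S ∪ (nbr G S ∩ Y) with hU
  have h1 : S.card * d ≤ 2 * (interiorEdgeCount G (U : Set V) : ℝ) := by
    have h2 : (∑ v ∈ S, (nbr G {v} ∩ Y).card : ℝ) ≤ 2 * (interiorEdgeCount G (U : Set V) : ℝ) := by
      exact_mod_cast sum_card_nbr_le S Y
    have h3 := Finset.card_nsmul_le_sum S (fun v => ((nbr G {v} ∩ Y).card : ℝ)) d hd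
    rw [nsmul_eq_mul] at h3
    exact h3.trans h2
  have h2 := h.two_mul_interiorEdgeCount_le U
  have hUc : (U.card : ℝ) ≤ 9 * S.card := by
    have := Finset.card_union_le S (nbr G S ∩ Y)
    rw [← hU] at this
    exact_mod_cast (show U.card ≤ 9 * S.card by omega)
  have hS0 : (0 : ℝ) < S.card := by
    exact_mod_cast (show 0 < S.card by omega)
  have hp := h.1
  have hβ := h.2.2.1
  have h3 : p * (U.card : ℝ) ^ 2 ≤ p * (9 * S.card) ^ 2 := by gcongr
  have h4 : 2 * β * (U.card : ℝ) ≤ 2 * β * (9 * S.card) := by gcongr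
  have h5 := mul_lt_mul_of_pos_left hS hS0
  nlinarith

theorem IsJumbled.expands {p β : ℝ} (h : IsJumbled G p β) {Y : Finset V} {d : ℝ} {a m : ℕ}
    (hd : ∀ v, d ≤ (nbr G {v} ∩ Y).card) (hm : 162 * p * m + 18 * β + a < d) :
    Expands G Y a m := by
  intro D S hD hS
  refine h.card_nbr_ge (d := d - a) (fun v _ => ?_) ?_
  · have h1 := Finset.le_card_sdiff D (nbr G {v} ∩ Y)
    rw [Finset.inter_sdiff_assoc] at h1
    have h2 : (nbr G {v} ∩ Y).card ≤ (nbr G {v} ∩ (Y \ D)).card + a := by omega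
    have h3 : ((nbr G {v} ∩ Y).card : ℝ) ≤ (nbr G {v} ∩ (Y \ D)).card + a := by exact_mod_cast h2
    linarith [hd v]
  · have hp := h.1
    have h1 : (S.card : ℝ) ≤ 2 * m := by exact_mod_cast hS
    have h2 : 81 * p * (S.card : ℝ) ≤ 81 * p * (2 * m) := by gcongr
    linarith

end Expansion

section Splitting

variable {V : Type} [Fintype V] [DecidableEq V]

theorem sum_pow_card_inter (N : Finset V) (x : ℝ) :
    ∑ A : Finset V, x ^ (A ∩ N).card = (1 + x) ^ N.card * 2 ^ (Fintype.card V - N.card) := by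
  have h1 : ∏ v : V, ((if v ∈ N then x else 1) + 1) =
      (1 + x) ^ N.card * 2 ^ (Fintype.card V - N.card) := by
    have e : ∀ v : V, (if v ∈ N then x else 1) + 1 = if v ∈ N then 1 + x else 2 := by
      intro v
      split_ifs <;> ring
    simp_rw [e]
    rw [Finset.prod_ite, Finset.prod_const, Finset.prod_const, Finset.filter_mem_eq_inter,
      Finset.univ_inter, Finset.filter_not, Finset.filter_mem_eq_inter, Finset.univ_inter,
      Finset.card_univ_sdiff]
  rw [← h1, Finset.prod_add, Finset.powerset_univ]
  refine Finset.sum_congr rfl fun A _ => ?_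
  rw [Finset.prod_const_one, mul_one, Finset.prod_ite, Finset.prod_const_one, mul_one,
    Finset.prod_const, Finset.filter_mem_eq_inter]

/-- A set can be chosen which splits each of a family of large sets into two large parts. -/
theorem exists_splitting {d : ℕ} (hd : 2 * (Fintype.card V : ℝ) * (51 / 64) ^ d < 1)
    (N : V → Finset V) (hN : ∀ v, d ≤ (N v).card) :
    ∃ A : Finset V, ∀ v, (N v).card ≤ 8 * (N v ∩ A).card ∧ (N v).card ≤ 8 * (N v ∩ Aᶜ).card := by
  by_contra! hcon
  set f : V → Finset V → ℝ := fun v A => (3 / 2) ^ (N v).card * (1 / 16) ^ (A ∩ N v).card with hf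
  have hf0 : ∀ v A, 0 ≤ f v A := fun v A => by positivity
  have hbad : ∀ v A, 8 * (A ∩ N v).card < (N v).card → 1 ≤ f v A := by
    intro v A h
    have h1 : ((16 : ℝ)) ^ (A ∩ N v).card ≤ (3 / 2) ^ (N v).card := by
      calc (16 : ℝ) ^ (A ∩ N v).card ≤ ((3 / 2) ^ 8) ^ (A ∩ N v).card := by
            gcongr
            norm_num
        _ = (3 / 2) ^ (8 * (A ∩ N v).card) := by rw [pow_mul]
        _ ≤ (3 / 2) ^ (N v).card := pow_le_pow_right₀ (by norm_num) h.le
    rw [hf]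
    dsimp only
    rw [one_div, inv_pow, ← div_eq_mul_inv, one_le_div (by positivity)]
    exact h1
  have hone : ∀ A : Finset V, 1 ≤ ∑ v, (f v A + f v Aᶜ) := by
    intro A
    obtain ⟨v, hv⟩ := hcon A
    have h1 : 1 ≤ f v A + f v Aᶜ := by
      by_cases h : (N v).card ≤ 8 * (N v ∩ A).card
      · have := hbad v Aᶜ (by rw [Finset.inter_comm]; exact hv h)
        linarith [hf0 v A]
      · have := hbad v A (by rw [Finset.inter_comm]; omega)
        linarith [hf0 v Aᶜ]
    exact h1.trans (Finset.single_le_sum (f := fun v => f v A + f v Aᶜ)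
      (fun v _ => add_nonneg (hf0 v A) (hf0 v Aᶜ)) (Finset.mem_univ v))
  have hsum : ∀ v, ∑ A, f v A = 2 ^ Fintype.card V * (51 / 64) ^ (N v).card := by
    intro v
    have h1 : (2 : ℝ) ^ Fintype.card V = 2 ^ (N v).card * 2 ^ (Fintype.card V - (N v).card) := by
      rw [← pow_add, Nat.add_sub_cancel' (Finset.card_le_univ _)]
    rw [hf]
    dsimp only
    rw [← Finset.mul_sum, sum_pow_card_inter, h1, mul_right_comm, ← mul_pow, ← mul_assoc,
      ← mul_pow]
    norm_num
  have hsumc : ∀ v, ∑ A, f v Aᶜ = ∑ A, f v A := fun v =>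
    Equiv.sum_comp (Equiv.ofBijective (compl : Finset V → Finset V) compl_bijective) (f v)
  have h1 : (2 : ℝ) ^ Fintype.card V ≤ ∑ A : Finset V, ∑ v, (f v A + f v Aᶜ) := by
    have := Finset.card_nsmul_le_sum Finset.univ (fun A : Finset V => ∑ v, (f v A + f v Aᶜ)) 1
      (fun A _ => hone A)
    simpa using this
  rw [Finset.sum_comm] at h1
  have h2 : ∑ v, ∑ A, (f v A + f v Aᶜ) ≤
      ∑ _v : V, 2 * (2 ^ Fintype.card V * (51 / 64 : ℝ) ^ d) := by
    refine Finset.sum_le_sum fun v _ => ?_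
    rw [Finset.sum_add_distrib, hsumc, hsum, ← two_mul]
    gcongr 2 * (_ * ?_)
    exact pow_le_pow_of_le_one (by norm_num) (by norm_num) (hN v)
  rw [Finset.sum_const, Finset.card_univ, nsmul_eq_mul] at h2
  have h3 := h1.trans h2
  have h4 : (0 : ℝ) < 2 ^ Fintype.card V := by positivity
  nlinarith

theorem exists_three_splitting {d : ℕ} (hd : 2 * (Fintype.card V : ℝ) * (51 / 64) ^ d < 1)
    (N : V → Finset V) (hN : ∀ v, 8 * d ≤ (N v).card) :
    ∃ V₁ V₂ V₃ : Finset V, Disjoint V₁ V₂ ∧ Disjoint V₁ V₃ ∧ Disjoint V₂ V₃ ∧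
      ∀ v, (N v).card ≤ 64 * (N v ∩ V₁).card ∧ (N v).card ≤ 64 * (N v ∩ V₂).card ∧
        (N v).card ≤ 64 * (N v ∩ V₃).card := by
  obtain ⟨A, hA⟩ := exists_splitting hd N fun v => by
    have := hN v
    omega
  obtain ⟨B, hB⟩ := exists_splitting hd (fun v => N v ∩ A) fun v => by
    have := hN v
    have := (hA v).1
    omega
  refine ⟨A ∩ B, A ∩ Bᶜ, Aᶜ, ?_, ?_, ?_, fun v => ?_⟩
  · exact (disjoint_compl_right (a := B)).mono Finset.inter_subset_right Finset.inter_subset_right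
  · exact (disjoint_compl_right (a := A)).mono_left Finset.inter_subset_left
  · exact (disjoint_compl_right (a := A)).mono_left Finset.inter_subset_left
  · have h1 := hA v
    have h2 := hB v
    rw [Finset.inter_assoc, Finset.inter_assoc] at h2
    refine ⟨?_, ?_, ?_⟩ <;> omega

end Splitting

section Asymptotics

theorem le_natLog_two_add_one {n : ℕ} (hn : 0 < n) : Real.log n ≤ (Nat.log 2 n + 1 : ℕ) := by
  have h1 : (n : ℝ) ≤ 2 ^ (Nat.log 2 n + 1) := by
    exact_mod_cast (Nat.lt_pow_succ_log_self one_lt_two n).le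
  have h2 := Real.log_le_log (by exact_mod_cast hn) h1
  rw [Real.log_pow] at h2
  have h3 := Real.log_two_lt_d9
  have h4 : (0 : ℝ) ≤ (Nat.log 2 n + 1 : ℕ) := by positivity
  nlinarith

theorem natLog_two_le {n : ℕ} (hn : 0 < n) : (Nat.log 2 n : ℝ) ≤ 3 / 2 * Real.log n := by
  have h1 : ((2 : ℝ)) ^ Nat.log 2 n ≤ n := by exact_mod_cast Nat.pow_log_le_self 2 hn.ne'
  have h2 := Real.log_le_log (by positivity) h1
  rw [Real.log_pow] at h2
  have h3 := Real.log_two_gt_d9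
  have h4 : (0 : ℝ) ≤ Nat.log 2 n := by positivity
  nlinarith

theorem sixteen_pow_mul_le {y : ℝ} (hy : 1 ≤ y) {k : ℕ} (hk : (k : ℝ) ≤ 44 / 1000 * y + 1) :
    32 * (16 : ℝ) ^ k * (2 * (1 / 100000 * y)) ≤ Real.exp y := by
  have h16 : (16 : ℝ) ≤ Real.exp 3 := by
    have h := Real.exp_one_gt_d9
    have e : Real.exp 3 = Real.exp 1 ^ 3 := by
      rw [← Real.exp_nat_mul]
      norm_num
    rw [e]
    calc (16 : ℝ) ≤ 2.7 ^ 3 := by norm_num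
      _ ≤ Real.exp 1 ^ 3 := by
        gcongr
        linarith
  have h3 : Real.exp 3 ≤ 27 := by
    have h := Real.exp_one_lt_d9
    have e : Real.exp 3 = Real.exp 1 ^ 3 := by
      rw [← Real.exp_nat_mul]
      norm_num
    rw [e]
    calc Real.exp 1 ^ 3 ≤ 3 ^ 3 := by
          gcongr
          linarith
      _ = 27 := by norm_num
  have hpow : (16 : ℝ) ^ k ≤ 27 * Real.exp (y / 2) := by
    calc (16 : ℝ) ^ k ≤ Real.exp 3 ^ k := by gcongr
      _ = Real.exp (k * 3) := by rw [Real.exp_nat_mul]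
      _ ≤ Real.exp (3 + y / 2) := Real.exp_le_exp.2 (by linarith)
      _ = Real.exp 3 * Real.exp (y / 2) := Real.exp_add _ _
      _ ≤ 27 * Real.exp (y / 2) := by gcongr
  have hyy : y ≤ 2 * Real.exp (y / 2) := by linarith [Real.add_one_le_exp (y / 2)]
  have e : Real.exp y = Real.exp (y / 2) * Real.exp (y / 2) := by
    rw [← Real.exp_add, add_halves]
  rw [e]
  have hpos := Real.exp_pos (y / 2)
  calc 32 * (16 : ℝ) ^ k * (2 * (1 / 100000 * y))
      ≤ 32 * (27 * Real.exp (y / 2)) * (2 * (1 / 100000 * (2 * Real.exp (y / 2)))) := by gcongr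
    _ ≤ Real.exp (y / 2) * Real.exp (y / 2) := by nlinarith [mul_pos hpos hpos]

theorem links_length_le {T : ℕ} (hT : 1 ≤ T) :
    (12 * T + 8) * (2 * ((12 * T + 8) * (2 * T)) + 2 * T + 2) + 2 ≤ 1700 * T ^ 3 := by
  obtain ⟨j, rfl⟩ := Nat.exists_eq_add_of_le' hT
  ring_nf
  nlinarith [Nat.zero_le j, Nat.zero_le (j ^ 2), Nat.zero_le (j ^ 3)]

theorem isAdmissible_of_large {n : ℕ} (hx : 100 ≤ Real.log n)
    (hn : 1400000000 * Real.log n ^ 4 ≤ n) :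
    ∃ T k L M : ℕ, 20 * (T : ℝ) + 16 ≤ 50 * Real.log n ∧
      IsAdmissible n ⌈1 / 100000 * n * Real.log (Real.log n) / Real.log n⌉₊ T k L (20 * T + 16)
        M := by
  set x := Real.log n with hxdef
  set y := Real.log x with hydef
  set T := Nat.log 2 n + 1 with hTdef
  have hx0 : 0 < x := by linarith
  have hx4 : (100 : ℝ) ^ 3 * x ≤ x ^ 4 := by
    calc (100 : ℝ) ^ 3 * x ≤ x ^ 3 * x := by gcongr
      _ = x ^ 4 := by ring
  have hn0 : 0 < n := by
    rw [Nat.pos_iff_ne_zero]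
    rintro rfl
    norm_num at hn
    nlinarith
  have hexpy : Real.exp y = x := Real.exp_log hx0
  have hy1 : 1 ≤ y := by
    rw [hydef, Real.le_log_iff_exp_le hx0]
    linarith [Real.exp_one_lt_d9]
  have hyx : y ≤ x := by linarith [Real.add_one_le_exp y]
  have hTx : x ≤ T := le_natLog_two_add_one hn0
  have hTx2 : (T : ℝ) + 1 ≤ 2 * x := by
    have := natLog_two_le hn0
    rw [hTdef]
    push_cast
    linarith
  have hT1 : 1 ≤ T := by omega
  set q : ℝ := 1 / 100000 * n * y / x with hq
  have hqx : q * x = 1 / 100000 * n * y := by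
    rw [hq]
    field_simp
  have hq3 : 14000 * x ^ 3 ≤ q := by
    rw [hq, le_div_iff₀ hx0]
    have : (n : ℝ) * 1 ≤ n * y := by gcongr
    nlinarith
  have hx3 : (100 : ℝ) ^ 3 ≤ x ^ 3 := by gcongr
  have hqn : 100000 * q ≤ n := by
    rw [hq, ← mul_div_assoc, div_le_iff₀ hx0]
    have : (n : ℝ) * y ≤ n * x := by gcongr
    linarith
  set m := ⌈q⌉₊ with hm
  have hqm : q ≤ m := Nat.le_ceil q
  have hmq : (m : ℝ) ≤ 2 * q := by
    have := (Nat.ceil_lt_add_one (show 0 ≤ q by linarith)).le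
    linarith
  set k := ⌈44 / 1000 * y⌉₊ with hk
  have hk1 : 44 / 1000 * y ≤ k := Nat.le_ceil _
  have hk2 : (k : ℝ) ≤ 44 / 1000 * y + 1 := (Nat.ceil_lt_add_one (by positivity)).le
  set L := n / (32 * (T + 1)) with hL
  have hL1 : L * (32 * (T + 1)) ≤ n := Nat.div_mul_le_self _ _
  have hL2 : (n : ℝ) / (100 * x) ≤ (L - 2 : ℕ) := by
    have h1 : n < (L + 1) * (32 * (T + 1)) := by
      rw [mul_comm]
      exact Nat.lt_mul_div_succ n (by omega)
    have h2 : (n : ℝ) ≤ (L + 1) * (32 * (T + 1)) := by exact_mod_cast h1.le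
    have h3 : ((L : ℝ) + 1) * (32 * (T + 1)) ≤ (L + 1) * (32 * (2 * x)) := by gcongr
    have h4 : (L : ℝ) ≤ (L - 2 : ℕ) + 2 := by
      exact_mod_cast (show L ≤ L - 2 + 2 by omega)
    have h5 : ((L : ℝ) + 1) * x ≤ ((L - 2 : ℕ) + 3) * x :=
      mul_le_mul_of_nonneg_right (by linarith) hx0.le
    rw [div_le_iff₀ (by positivity)]
    nlinarith
  refine ⟨T, k, L, (12 * T + 8) * (2 * T), by linarith, ?_⟩
  constructor
  · exact_mod_cast (show (1 : ℝ) ≤ m by linarith)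
  · refine le_trans ?_ (Nat.lt_pow_succ_log_self one_lt_two n).le
    exact_mod_cast (show 2 * (m : ℝ) ≤ n by linarith)
  · have : (k : ℝ) ≤ 2 * (T + 1) := by linarith
    exact_mod_cast this
  · have h1 : 2 * m ≤ n := by exact_mod_cast (show 2 * (m : ℝ) ≤ n by linarith)
    have h2 : L * (32 * (T + 1)) = 2 * (16 * (T + 1) * L) := by ring
    omega
  · have h1 : 22 * (m : ℝ) ≤ k * (L - 2 : ℕ) := by
      calc 22 * (m : ℝ) ≤ 44 * q := by linarith
        _ = 44 / 1000 * y * (n / (100 * x)) := by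
          rw [hq]
          field_simp
          norm_num
        _ ≤ k * (L - 2 : ℕ) := by gcongr
    exact_mod_cast h1
  · have h1 := sixteen_pow_mul_le hy1 hk2
    rw [hexpy] at h1
    have h2 : 32 * (16 : ℝ) ^ k * m ≤ n := by
      calc 32 * (16 : ℝ) ^ k * m ≤ 32 * (16 : ℝ) ^ k * (2 * q) := by gcongr
        _ = 32 * (16 : ℝ) ^ k * (2 * (1 / 100000 * y)) * (n / x) := by
          rw [hq]
          ring
        _ ≤ x * (n / x) := by gcongr
        _ = n := by field_simp
    exact_mod_cast h2
  · exact_mod_cast (show 12 * (m : ℝ) ≤ n by linarith)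
  · exact le_rfl
  · have : (20 * (T : ℝ) + 16) < n := by linarith
    exact_mod_cast this
  · exact le_rfl
  · have h1 : (T : ℝ) ^ 3 ≤ (2 * x) ^ 3 := by
      gcongr
      linarith
    have h2 : (12 * T + 8) * (2 * ((12 * T + 8) * (2 * T)) + 2 * T + 2) + 2 ≤ 1700 * T ^ 3 :=
      links_length_le hT1
    have h3 : (1700 * T ^ 3 : ℝ) ≤ m := by
      calc (1700 * T ^ 3 : ℝ) ≤ 1700 * (2 * x) ^ 3 := by gcongr
        _ ≤ 14000 * x ^ 3 := by
          have : 0 ≤ x ^ 3 := by positivity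
          nlinarith
        _ ≤ m := hq3.trans hqm
    exact h2.trans (by exact_mod_cast h3)

end Asymptotics

theorem main_technical :
    ∃ ε C : ℝ, ε > 0 ∧ C > 1 ∧ ∃ N : ℕ, ∀ n : ℕ, Odd n → n ≥ N →
      ∀ (V : Type) [Fintype V] [DecidableEq V] (G : SimpleGraph V),
        Fintype.card V = n →
        ∀ p : ℝ, p ≥ C * Real.log n / n →
        (∀ v : V, ((G.neighborSet v).ncard : ℝ) ≥ (1 - ε) * n * p) →
        (∃ β : ℝ, IsJumbled G p β ∧ β ≤ ε * n * p / Real.log (Real.log n)) →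
        (∀ A B : Set V, Disjoint A B →
          (A.ncard : ℝ) ≥ ε * n * Real.log (Real.log n) / Real.log n →
          (B.ncard : ℝ) ≥ ε * n * Real.log (Real.log n) / Real.log n →
          ∃ a ∈ A, ∃ b ∈ B, G.Adj a b) →
        hamiltonSpace G = cycleSpace G := by
  have hlim1 : ∀ᶠ n : ℕ in Filter.atTop, 100 ≤ Real.log n :=
    (Real.tendsto_log_atTop.comp tendsto_natCast_atTop_atTop).eventually_ge_atTop 100
  have hlim2 : ∀ᶠ n : ℕ in Filter.atTop, 1400000000 * Real.log n ^ 4 ≤ n := by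
    have h := (Real.isLittleO_pow_log_id_atTop (n := 4)).comp_tendsto tendsto_natCast_atTop_atTop
    filter_upwards [h.bound (show (0 : ℝ) < 1 / 1400000000 by norm_num)] with n hn
    simp only [Function.comp_apply, id, Real.norm_eq_abs, Nat.abs_cast] at hn
    have := le_abs_self (Real.log n ^ 4)
    linarith
  obtain ⟨N, hN⟩ := Filter.eventually_atTop.1 (hlim1.and hlim2)
  refine ⟨1 / 100000, 1000000, by norm_num, by norm_num, N, ?_⟩
  intro n hodd hnN V _ _ G hcard p hp hdeg ⟨β, hβ, hβle⟩ hjoin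
  obtain ⟨hx, hn⟩ := hN n hnN
  obtain ⟨T, k, L, M, hT, hA⟩ := isAdmissible_of_large hx hn
  set x := Real.log n with hxdef
  set y := Real.log x with hydef
  have hx0 : 0 < x := by linarith
  have hy1 : 1 ≤ y := by
    rw [hydef, Real.le_log_iff_exp_le hx0]
    linarith [Real.exp_one_lt_d9]
  have hyx : y ≤ x := (Real.log_le_sub_one_of_pos hx0).trans (by linarith)
  have hx4 : (100 : ℝ) ^ 4 ≤ x ^ 4 := by gcongr
  have hn0 : (0 : ℝ) < n := by linarith
  have hnp : 1000000 * x ≤ n * p := by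
    rwa [ge_iff_le, div_le_iff₀ hn0, mul_comm p] at hp
  set q : ℝ := 1 / 100000 * n * y / x with hq
  have hJ : IsJoined G ⌈q⌉₊ := by
    intro A B hAB h1 h2
    obtain ⟨a, ha, b, hb, hab⟩ := hjoin A B (Finset.disjoint_coe.2 hAB)
      (by rw [Set.ncard_coe_finset]; exact Nat.ceil_le.1 h1)
      (by rw [Set.ncard_coe_finset]; exact Nat.ceil_le.1 h2)
    exact ⟨a, ha, b, hb, hab⟩
  have hnbr : ∀ v, (1 - 1 / 100000) * n * p ≤ (nbr G {v}).card := by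
    intro v
    have e : G.neighborSet v = (nbr G {v} : Set V) := by
      ext u
      simp
    have := hdeg v
    rwa [e, Set.ncard_coe_finset] at this
  have hd : 2 * (Fintype.card V : ℝ) * (51 / 64) ^ ⌈10 * x⌉₊ < 1 := by
    have h1 : ((51 : ℝ) / 64) ^ ⌈10 * x⌉₊ ≤ Real.exp (-x) * Real.exp (-x) := by
      calc ((51 : ℝ) / 64) ^ ⌈10 * x⌉₊ ≤ Real.exp (-(1 / 5)) ^ ⌈10 * x⌉₊ := by
            gcongr
            linarith [Real.add_one_le_exp (-(1 / 5) : ℝ)]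
        _ = Real.exp (⌈10 * x⌉₊ * -(1 / 5)) := by rw [Real.exp_nat_mul]
        _ ≤ Real.exp (-x + -x) := Real.exp_le_exp.2 (by linarith [Nat.le_ceil (10 * x)])
        _ = Real.exp (-x) * Real.exp (-x) := Real.exp_add _ _
    rw [Real.exp_neg, hxdef, Real.exp_log hn0] at h1
    rw [hcard]
    calc 2 * (n : ℝ) * (51 / 64) ^ ⌈10 * x⌉₊ ≤ 2 * n * ((n : ℝ)⁻¹ * (n : ℝ)⁻¹) := by gcongr
      _ = 2 / n := by field_simp
      _ < 1 := by
        rw [div_lt_one hn0]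
        linarith
  obtain ⟨V₁, V₂, V₃, h12, h13, h23, hsplit⟩ := exists_three_splitting hd (fun v => nbr G {v})
    fun v => by
      have h1 := (Nat.ceil_lt_add_one (show 0 ≤ 10 * x by linarith)).le
      have h2 := hnbr v
      have h3 : 8 * (⌈10 * x⌉₊ : ℝ) ≤ (nbr G {v}).card := by nlinarith
      exact_mod_cast h3
  have hp0 := hβ.1
  have hm : 162 * p * (⌈q⌉₊ : ℝ) + 18 * β + (20 * T + 16 : ℕ) < (1 - 1 / 100000) * n * p / 64 := by
    have hq0 : 0 ≤ q := by positivity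
    have h1 := (Nat.ceil_lt_add_one hq0).le
    have h2 : q ≤ 1 / 100000 * n := by
      rw [hq, div_le_iff₀ hx0]
      gcongr
    have h3 : 162 * p * (⌈q⌉₊ : ℝ) ≤ 162 * p * (2 / 100000 * n) := by
      gcongr
      linarith
    have h4 : β ≤ 1 / 100000 * n * p := hβle.trans (div_le_self (by positivity) hy1)
    push_cast
    nlinarith
  have hexp : ∀ {Y : Finset V}, (∀ v, (nbr G {v}).card ≤ 64 * (nbr G {v} ∩ Y).card) →
      Expands G Y (20 * T + 16) ⌈q⌉₊ := fun {Y} hY => hβ.expands (fun v => by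
    have h1 : ((nbr G {v}).card : ℝ) ≤ 64 * (nbr G {v} ∩ Y).card := by exact_mod_cast hY v
    linarith [hnbr v]) hm
  rw [← hcard] at hA hodd
  refine hA.hamiltonSpace_eq_cycleSpace hodd h12 h13 h23 (hexp fun v => (hsplit v).1)
    (hexp fun v => (hsplit v).2.1) (hexp fun v => (hsplit v).2.2) hJ
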